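/- For every prime power q = p^d (p prime, d ≥ 1) and every integer m ≥ 2 with m ≠ 3, there exists a finite group G whose covering number σ(G) equals (q^m − 1)/(q − 1). -/

import Mathlib

open scoped ENat

/-- `S` is a cover of the group `G` by proper subgroups: every element of `G`
lies in some member of `S`, and every member of `S` is a proper subgroup. -/
def IsSubgroupCover {G : Type*} [Group G] (S : Finset (Subgroup G)) : Prop :=
  (∀ H ∈ S, H ≠ ⊤) ∧ ∀ g : G, ∃ H ∈ S, g ∈ H

/-- The covering number `σ(G)`: the least size of a cover of `G` by proper
subgroups, equal to `⊤` (infinity) if no such finite collection exists. -/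
noncomputable def coveringNumber (G : Type*) [Group G] : ℕ∞ :=
  sInf {n : ℕ∞ | ∃ S : Finset (Subgroup G), IsSubgroupCover S ∧ (S.card : ℕ∞) = n}

section Framework

/-- The number of `g` that conjugate `x` into `K`. -/
noncomputable def conjCount {G : Type*} [Group G] (K : Subgroup G) (x : G) : ℕ :=
  Nat.card {g : G // g⁻¹ * x * g ∈ K}

variable {G H : Type*} [Group G] [Group H]

theorem conjCount_conj (K : Subgroup G) (x a : G) :
    conjCount K (a * x * a⁻¹) = conjCount K x := by
  refine Nat.card_congr ((Equiv.mulLeft a⁻¹).subtypeEquiv fun g => ?_)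
  simp [mul_assoc]

theorem conjCount_map (e : G ≃* H) (K : Subgroup G) (x : G) :
    conjCount (K.map e.toMonoidHom) (e x) = conjCount K x := by
  refine (Nat.card_congr (e.toEquiv.subtypeEquiv fun g => ?_)).symm
  have : (e.toEquiv g)⁻¹ * e x * e.toEquiv g = e (g⁻¹ * x * g) := by simp
  rw [this]
  exact (Subgroup.mem_map_iff_mem (f := e.toMonoidHom) e.injective).symm

theorem conjCount_map_conj (K : Subgroup G) (x a : G) :
    conjCount (K.map (MulAut.conj a).toMonoidHom) x = conjCount K x := by
  rw [← conjCount_conj _ x a, ← conjCount_map (MulAut.conj a) K x, MulAut.conj_apply]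

/-- To bound `conjCount K x` one may assume `x ∈ K`. -/
theorem conjCount_induction {K : Subgroup G} {x : G} {P : ℕ → ℕ → Prop}
    (h0 : P 0 (Nat.card K))
    (hK : ∀ K' : Subgroup G, (K ≠ ⊤ → K' ≠ ⊤) → x ∈ K' → P (conjCount K' x) (Nat.card K')) :
    P (conjCount K x) (Nat.card K) := by
  by_cases h : ∃ g : G, g⁻¹ * x * g ∈ K
  · obtain ⟨g, hg⟩ := h
    have h1 := hK (K.map (MulAut.conj g).toMonoidHom) (fun hne htop => hne ?_)
      ⟨_, hg, by simp [mul_assoc]⟩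
    · rwa [conjCount_map_conj, Subgroup.card_map_of_injective (MulAut.conj g).injective] at h1
    · exact Subgroup.map_injective (MulAut.conj g).injective
        (htop.trans (Subgroup.map_top_of_surjective _ (MulAut.conj g).surjective).symm)
  · have : conjCount K x = 0 := by
      have : IsEmpty {g : G // g⁻¹ * x * g ∈ K} := ⟨fun g => h ⟨_, g.2⟩⟩
      exact Nat.card_of_isEmpty
    rwa [this]

theorem conjCount_le [Finite G] (K : Subgroup G) (x : G) : conjCount K x ≤ Nat.card G :=
  Finite.card_subtype_le _

theorem card_le_sum_conjCount [Finite G] {ι : Type*} (s : Finset ι) (K : ι → Subgroup G) (x : G)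
    (hx : ∀ g : G, ∃ i ∈ s, g⁻¹ * x * g ∈ K i) :
    Nat.card G ≤ ∑ i ∈ s, conjCount (K i) x := by
  classical
  have := Fintype.ofFinite G
  calc Nat.card G = (Finset.univ : Finset G).card := by simp
    _ ≤ (s.biUnion fun i => Finset.univ.filter fun g : G => g⁻¹ * x * g ∈ K i).card := by
        refine Finset.card_le_card fun g _ => ?_
        simpa using hx g
    _ ≤ ∑ i ∈ s, (Finset.univ.filter fun g : G => g⁻¹ * x * g ∈ K i).card :=
        Finset.card_biUnion_le
    _ = _ := Finset.sum_congr rfl fun i _ => by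
        rw [conjCount, Nat.card_eq_fintype_card, Fintype.card_subtype]

theorem add_le_card_of_weights [Finite G] {ι : Type*} {s : Finset ι} {K : ι → Subgroup G}
    {x h : G} {a b : ℕ}
    (hw : ∀ i ∈ s, a * conjCount (K i) x + b * conjCount (K i) h ≤ Nat.card G)
    (hx : ∀ g : G, ∃ i ∈ s, g⁻¹ * x * g ∈ K i) (hh : ∀ g : G, ∃ i ∈ s, g⁻¹ * h * g ∈ K i) :
    a + b ≤ s.card := by
  have h1 := card_le_sum_conjCount s K x hx
  have h2 := card_le_sum_conjCount s K h hh
  have h3 := Finset.sum_le_sum hw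
  rw [Finset.sum_add_distrib, ← Finset.mul_sum, ← Finset.mul_sum, Finset.sum_const,
    smul_eq_mul] at h3
  have h4 : (a + b) * Nat.card G ≤ s.card * Nat.card G := by nlinarith
  exact Nat.le_of_mul_le_mul_right h4 Nat.card_pos

theorem le_card_of_isSubgroupCover_of_weights [Finite G] {S : Finset (Subgroup G)}
    (hS : IsSubgroupCover S) {x h : G} {a b : ℕ}
    (hw : ∀ K : Subgroup G, K ≠ ⊤ → a * conjCount K x + b * conjCount K h ≤ Nat.card G) :
    a + b ≤ S.card :=
  add_le_card_of_weights (s := S) (K := id) (fun K hK => hw K (hS.1 K hK))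
    (fun _ => hS.2 _) (fun _ => hS.2 _)

theorem le_card_of_isSubgroupCover_of_hom [Finite G] [Finite H] {S : Finset (Subgroup G)}
    (hS : IsSubgroupCover S) (π : G →* H) (hπ : Function.Surjective π)
    (hM : ∀ M : Subgroup G, M ≠ ⊤ → M.map π = ⊤ → ∀ y ∈ M, π y = 1 → y = 1)
    {x h : H} {a b : ℕ} (ha : Nat.card π.ker = a)
    (hw : ∀ K : Subgroup H, K ≠ ⊤ → a * conjCount K x + b * conjCount K h ≤ Nat.card H)
    (g0 : G) (hg0 : π g0 = h) (k : ℕ) (hk1 : π (g0 ^ k) = 1) (hk2 : g0 ^ k ≠ 1) :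
    a + b ≤ S.card := by
  classical
  set T := S.filter fun M => M.map π ≠ ⊤ with hT
  have hwT : ∀ M ∈ T, a * conjCount (M.map π) x + b * conjCount (M.map π) h ≤ Nat.card H :=
    fun M hM => hw _ (Finset.mem_filter.1 hM).2
  have hh : ∀ g : H, ∃ M ∈ T, g⁻¹ * h * g ∈ M.map π := by
    intro g
    obtain ⟨c, rfl⟩ := hπ g
    obtain ⟨M, hMS, hMg⟩ := hS.2 (c⁻¹ * g0 * c)
    refine ⟨M, Finset.mem_filter.2 ⟨hMS, fun htop => hk2 ?_⟩, _, hMg, by simp [hg0]⟩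
    have h1 := hM M (hS.1 M hMS) htop _ (M.pow_mem hMg k)
    have h2 : (c⁻¹ * g0 * c) ^ k = c⁻¹ * g0 ^ k * c := by
      simpa using (conj_pow (a := c⁻¹) (b := g0) (i := k))
    rw [h2] at h1
    have h3 := h1 (by rw [map_mul, map_mul, hk1]; simp)
    have h4 : g0 ^ k = c * (c⁻¹ * g0 ^ k * c) * c⁻¹ := by group
    rw [h4, h3]; simp
  by_cases hx : ∀ g : H, ∃ M ∈ T, g⁻¹ * x * g ∈ M.map π
  · exact (add_le_card_of_weights hwT hx hh).trans (Finset.card_filter_le _ _)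
  · push Not at hx
    obtain ⟨g, hg⟩ := hx
    have hb : b ≤ T.card := by
      have h1 := add_le_card_of_weights (s := T) (K := fun M => M.map π) (x := h) (h := h)
        (a := 0) (b := b) (fun M hM => by have := hwT M hM; omega) hh hh
      omega
    obtain ⟨y, hy⟩ := hπ (g⁻¹ * x * g)
    have hc : ∀ v : π.ker, ∃ M ∈ S \ T, y * v ∈ M := by
      intro v
      obtain ⟨M, hMS, hMv⟩ := hS.2 (y * v)
      refine ⟨M, Finset.mem_sdiff.2 ⟨hMS, fun hMT => hg M hMT ⟨_, hMv, ?_⟩⟩, hMv⟩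
      rw [map_mul, hy, v.2, mul_one]
    choose f hfS hfv using hc
    have hinj : Function.Injective fun v => (⟨f v, hfS v⟩ : {M // M ∈ S \ T}) := by
      intro v w hvw
      have hvw' : f v = f w := congrArg Subtype.val hvw
      have h1 := hfS v
      rw [Finset.mem_sdiff, hT, Finset.mem_filter] at h1
      have h2 : (f v).map π = ⊤ := by tauto
      have h3 := hM _ (hS.1 _ h1.1) h2 _ ((f v).mul_mem ((f v).inv_mem (hfv v))
        (hvw' ▸ hfv w)) (by simp [show π v = 1 from v.2, show π w = 1 from w.2])
      have h4 : (v : G)⁻¹ * w = 1 := by rw [← h3]; group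
      exact Subtype.ext (by rw [inv_mul_eq_one] at h4; exact h4)
    have ha' : a ≤ (S \ T).card := by
      have := Nat.card_le_card_of_injective _ hinj
      rwa [ha, Nat.card_eq_fintype_card, Fintype.card_coe] at this
    have : (S \ T).card + T.card = S.card :=
      Finset.card_sdiff_add_card_eq_card (Finset.filter_subset _ S)
    omega

theorem coveringNumber_eq {n : ℕ} (hlow : ∀ S : Finset (Subgroup G), IsSubgroupCover S → n ≤ S.card)
    {S : Finset (Subgroup G)} (hS : IsSubgroupCover S) (hn : S.card ≤ n) :
    coveringNumber G = n := by
  refine le_antisymm (sInf_le ⟨S, hS, ?_⟩) (le_sInf ?_)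
  · exact congrArg _ (le_antisymm hn (hlow S hS))
  · rintro _ ⟨T, hT, rfl⟩
    exact_mod_cast hlow T hT

end Framework

section Affine

open Module
open scoped LinearAlgebra.Projectivization

variable {F V : Type*} [Field F] [AddCommGroup V] [Module F V]

theorem exists_linearEquiv_comp_eq [FiniteDimensional F V] {ι : Type*} [Finite ι] {s t : ι → V}
    (hs : LinearIndependent F s) (ht : LinearIndependent F t) :
    ∃ g : V ≃ₗ[F] V, ∀ i, g (s i) = t i := by
  obtain ⟨g, hg⟩ := Submodule.exists_linearEquiv_restrict_eq
    (hs.linearCombinationEquiv.symm ≪≫ₗ ht.linearCombinationEquiv)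
  refine ⟨g, fun i => ?_⟩
  have h1 : (hs.linearCombinationEquiv (Finsupp.single i 1) : V) = s i := by simp
  rw [← h1, ← hg]
  simp

theorem exists_linearEquiv_apply_eq [FiniteDimensional F V] {v w : V} (hv : v ≠ 0) (hw : w ≠ 0) :
    ∃ g : V ≃ₗ[F] V, g v = w := by
  obtain ⟨g, hg⟩ := exists_linearEquiv_comp_eq (F := F) (s := fun _ : Unit => v) (t := fun _ => w)
    (linearIndependent_unique_iff.2 hv) (linearIndependent_unique_iff.2 hw)
  exact ⟨g, hg ()⟩

theorem affineEquiv_linearHom_surjective :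
    Function.Surjective (AffineEquiv.linearHom : (V ≃ᵃ[F] V) →* V ≃ₗ[F] V) :=
  fun g => ⟨g.toAffineEquiv, rfl⟩

theorem affineEquiv_apply_eq (g : V ≃ᵃ[F] V) (v : V) : g v = g.linear v + g 0 := by
  simpa using g.map_vadd 0 v

theorem affineEquiv_ext_linear {g g' : V ≃ᵃ[F] V} (h : g.linear = g'.linear) (h0 : g 0 = g' 0) :
    g = g' := by
  ext v
  rw [affineEquiv_apply_eq g, affineEquiv_apply_eq g', h, h0]

/-- Translations are the kernel of the projection to the linear part. -/
def kerLinearHomEquiv : (AffineEquiv.linearHom : (V ≃ᵃ[F] V) →* V ≃ₗ[F] V).ker ≃ V where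
  toFun g := g.1 0
  invFun v := ⟨AffineEquiv.constVAdd F V v, rfl⟩
  left_inv g := Subtype.ext (affineEquiv_ext_linear g.2.symm (by simp))
  right_inv v := by simp

theorem eq_one_of_map_linearHom_eq_top [FiniteDimensional F V] (M : Subgroup (V ≃ᵃ[F] V))
    (hM : M ≠ ⊤) (htop : M.map AffineEquiv.linearHom = ⊤) (y : V ≃ᵃ[F] V) (hy : y ∈ M)
    (hy1 : AffineEquiv.linearHom y = 1) : y = 1 := by
  by_contra hne
  refine hM (eq_top_iff.2 fun g _ => ?_)
  have hsurj : ∀ h : V ≃ₗ[F] V, ∃ m ∈ M, AffineEquiv.linearHom m = h := fun h => by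
    have : h ∈ M.map AffineEquiv.linearHom := by rw [htop]; trivial
    exact this
  have hy0 : y 0 ≠ 0 := fun h0 => hne (affineEquiv_ext_linear hy1 h0)
  have htrans : ∀ u : V ≃ᵃ[F] V, AffineEquiv.linearHom u = 1 → u ∈ M := by
    intro u hu
    by_cases hu0 : u 0 = 0
    · rw [show u = 1 from affineEquiv_ext_linear hu hu0]
      exact M.one_mem
    · obtain ⟨h, hh⟩ := exists_linearEquiv_apply_eq (F := F) hy0 hu0
      obtain ⟨m, hm, hmh⟩ := hsurj h
      have : u = m * y * m⁻¹ := by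
        refine affineEquiv_ext_linear ?_ ?_
        · change AffineEquiv.linearHom u = AffineEquiv.linearHom (m * y * m⁻¹)
          rw [hu, map_mul, map_mul, hy1, map_inv]; simp
        · have h2 : m⁻¹ 0 = - m.linear.symm (m 0) := by
            have : m (- m.linear.symm (m 0)) = 0 := by
              rw [affineEquiv_apply_eq]; simp
            rw [← this, AffineEquiv.inv_def, AffineEquiv.symm_apply_apply, this]
          have h3 : m.linear = h := hmh
          have h4 : y.linear = 1 := hy1
          rw [AffineEquiv.coe_mul, AffineEquiv.coe_mul, Function.comp_apply, Function.comp_apply,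
            h2, affineEquiv_apply_eq m, affineEquiv_apply_eq y, h4, h3]
          simp [hh]
      rw [this]
      exact M.mul_mem (M.mul_mem hm hy) (M.inv_mem hm)
  obtain ⟨m, hm, hmg⟩ := hsurj (AffineEquiv.linearHom g)
  have := M.mul_mem hm (htrans (m⁻¹ * g) (by rw [map_mul, map_inv, hmg]; simp))
  simpa using this

theorem linear_pow_apply_zero (g : V ≃ᵃ[F] V) (k : ℕ) :
    (g ^ k) 0 = ∑ i ∈ Finset.range k, (g.linear ^ i) (g 0) := by
  induction k with
  | zero => simp
  | succ k ih =>
    have : (g ^ k).linear = g.linear ^ k := map_pow AffineEquiv.linearHom g k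
    rw [pow_succ, AffineEquiv.coe_mul, Function.comp_apply, affineEquiv_apply_eq, ih,
      Finset.sum_range_succ, add_comm, this]

/-- The affine maps fixing a given point. -/
def affineStabilizer (F : Type*) {V : Type*} [Field F] [AddCommGroup V] [Module F V] (v : V) :
    Subgroup (V ≃ᵃ[F] V) where
  carrier := {g | g v = v}
  mul_mem' {a b} ha hb := by
    have ha : a v = v := ha
    have hb : b v = v := hb
    change a (b v) = v
    rw [hb, ha]
  one_mem' := rfl
  inv_mem' {a} ha := by
    have ha : a v = v := ha
    change a.symm v = v
    rw [← congrArg a.symm ha, AffineEquiv.symm_apply_apply]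

open scoped Pointwise in
/-- The linear automorphisms preserving a given subspace. -/
def linearStabilizer (W : Submodule F V) : Subgroup (V ≃ₗ[F] V) :=
  MulAction.stabilizer (V ≃ₗ[F] V) W

open scoped Pointwise in
theorem mem_linearStabilizer [Finite V] {W : Submodule F V} {g : V ≃ₗ[F] V} :
    g ∈ linearStabilizer W ↔ ∀ y ∈ W, g y ∈ W := by
  have hfin : FiniteDimensional F V := inferInstance
  rw [linearStabilizer, MulAction.mem_stabilizer_iff]
  constructor
  · intro h y hy
    rw [← h]
    exact Submodule.smul_mem_pointwise_smul y g W hy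
  · intro h
    have hle : g • W ≤ W := by
      rintro _ ⟨y, hy, rfl⟩
      exact h y hy
    refine Submodule.eq_of_le_of_finrank_eq hle ?_
    exact (g.submoduleMap W).finrank_eq.symm

theorem linearStabilizer_ne_top [Finite V] {W : Submodule F V} (hb : W ≠ ⊥) (ht : W ≠ ⊤) :
    linearStabilizer W ≠ ⊤ := by
  have hfin : FiniteDimensional F V := inferInstance
  intro h
  obtain ⟨y, hy, hy0⟩ := W.ne_bot_iff.1 hb
  obtain ⟨z, hz⟩ : ∃ z, z ∉ W := by
    by_contra! hc
    exact ht (eq_top_iff.2 fun z _ => hc z)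
  obtain ⟨g, rfl⟩ := exists_linearEquiv_apply_eq (F := F) hy0
    (w := z) (fun h => hz (h ▸ W.zero_mem))
  exact hz (mem_linearStabilizer.1 (h ▸ Subgroup.mem_top g) y hy)

theorem exists_affine_cover [Finite F] [Finite V] (hn : 2 ≤ finrank F V) :
    ∃ S : Finset (Subgroup (V ≃ᵃ[F] V)), IsSubgroupCover S ∧
      S.card ≤ Nat.card V + (Nat.card V - 1) / (Nat.card F - 1) := by
  classical
  have := Fintype.ofFinite V
  have hfin : FiniteDimensional F V := inferInstance
  have : Finite (Dual F V) := Module.finite_of_finite F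
  have := Fintype.ofFinite (ℙ F (Dual F V))
  have : Nontrivial V := Module.nontrivial_of_finrank_pos (R := F) (by omega)
  let A : V → Subgroup (V ≃ᵃ[F] V) := fun v => affineStabilizer F v
  let B : ℙ F (Dual F V) → Subgroup (V ≃ᵃ[F] V) := fun f =>
    (linearStabilizer (LinearMap.ker f.rep)).comap AffineEquiv.linearHom
  refine ⟨Finset.univ.image A ∪ Finset.univ.image B, ⟨?_, fun g => ?_⟩, ?_⟩
  · intro M hM htop
    simp only [Finset.mem_union, Finset.mem_image, Finset.mem_univ, true_and] at hM
    rcases hM with ⟨v, rfl⟩ | ⟨f, rfl⟩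
    · obtain ⟨w, hw⟩ := exists_ne (0 : V)
      have : AffineEquiv.constVAdd F V w ∈ A v := htop ▸ Subgroup.mem_top _
      have h1 : w + v = v := this
      exact hw (by simpa using h1)
    · refine linearStabilizer_ne_top (W := LinearMap.ker f.rep) ?_ ?_ ?_
      · intro hb
        have h1 := LinearMap.finrank_range_add_finrank_ker f.rep
        have h2 := Submodule.finrank_le (LinearMap.range f.rep)
        rw [hb, finrank_bot] at h1
        rw [finrank_self] at h2
        omega
      · rw [Ne, LinearMap.ker_eq_top]
        exact f.rep_nonzero
      · exact Subgroup.comap_injective affineEquiv_linearHom_surjective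
          (htop.trans (Subgroup.comap_top _).symm)
  · by_cases hg : ∃ v, g v = v
    · obtain ⟨v, hv⟩ := hg
      exact ⟨A v, by simp, hv⟩
    · have hlt : LinearMap.range ((g.linear : V →ₗ[F] V) - 1) < ⊤ := by
        refine lt_top_iff_ne_top.2 fun h => hg ?_
        have h1 : - g 0 ∈ LinearMap.range ((g.linear : V →ₗ[F] V) - 1) := h ▸ trivial
        obtain ⟨v, hv⟩ := h1
        refine ⟨v, ?_⟩
        have : g.linear v - v = - g 0 := hv
        rw [affineEquiv_apply_eq, ← neg_neg (g 0), ← this]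
        abel
      obtain ⟨f, hf0, hf⟩ := Submodule.exists_le_ker_of_lt_top _ hlt
      refine ⟨B (Projectivization.mk F f hf0), by simp, ?_⟩
      change g.linear ∈ linearStabilizer _
      rw [mem_linearStabilizer]
      obtain ⟨a, ha⟩ := Projectivization.exists_smul_eq_mk_rep F f hf0
      intro y hy
      rw [← ha, LinearMap.mem_ker] at *
      have h1 : f (g.linear y - y) = 0 := hf ⟨y, rfl⟩
      rw [map_sub, sub_eq_zero] at h1
      rw [LinearMap.smul_apply] at hy ⊢
      rwa [h1]
  · refine (Finset.card_union_le _ _).trans (add_le_add ?_ ?_)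
    · exact Finset.card_image_le.trans (by simp [Nat.card_eq_fintype_card])
    · refine Finset.card_image_le.trans (le_of_eq ?_)
      rw [Finset.card_univ, ← Nat.card_eq_fintype_card, Projectivization.card'' F (Dual F V)]
      have e : Nat.card (Dual F V) = Nat.card V := by
        rw [Module.natCard_eq_pow_finrank (K := F), Subspace.dual_finrank_eq,
          ← Module.natCard_eq_pow_finrank (K := F)]
      rw [e]

theorem coveringNumber_affineEquiv [Finite F] [Finite V] (hn : 2 ≤ finrank F V) {x h : V ≃ₗ[F] V}
    (hw : ∀ K : Subgroup (V ≃ₗ[F] V), K ≠ ⊤ → Nat.card V * conjCount K x +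
      (Nat.card V - 1) / (Nat.card F - 1) * conjCount K h ≤ Nat.card (V ≃ₗ[F] V))
    (k : ℕ) (hk : h ^ k = 1) (w : V) (hwk : ∑ i ∈ Finset.range k, (h ^ i) w ≠ 0) :
    coveringNumber (V ≃ᵃ[F] V) =
      ((Nat.card V + (Nat.card V - 1) / (Nat.card F - 1) : ℕ) : ℕ∞) := by
  have hfin : FiniteDimensional F V := inferInstance
  have : Finite (V ≃ₗ[F] V) := DFunLike.finite _
  have : Finite (V ≃ᵃ[F] V) := DFunLike.finite _
  obtain ⟨S, hS, hcard⟩ := exists_affine_cover (F := F) (V := V) hn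
  refine coveringNumber_eq (fun T hT => ?_) hS hcard
  let g0 : V ≃ᵃ[F] V := AffineEquiv.constVAdd F V w * h.toAffineEquiv
  have hlin : g0.linear = h := by
    change AffineEquiv.linearHom (_ * _) = h
    rw [map_mul]; rfl
  refine le_card_of_isSubgroupCover_of_hom hT _ affineEquiv_linearHom_surjective
    eq_one_of_map_linearHom_eq_top (Nat.card_congr kerLinearHomEquiv) hw g0 hlin k ?_ ?_
  · rw [map_pow]
    exact (congrArg (· ^ k) hlin).trans hk
  · intro h1
    apply hwk
    have h2 := linear_pow_apply_zero g0 k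
    have h3 : g0 0 = w := by simp [g0]
    rw [hlin, h1, h3] at h2
    exact h2.symm

end Affine

section Perspectivity

open Module

variable {F V : Type*} [Field F] [AddCommGroup V] [Module F V]

/-- `K` contains the map `y ↦ y + f y • c`. -/
def HasPersp (K : Subgroup (V ≃ₗ[F] V)) (c : V) (f : Dual F V) : Prop :=
  ∃ g ∈ K, ∀ y, g y = y + f y • c

variable {K : Subgroup (V ≃ₗ[F] V)} {c c' : V} {f f' : Dual F V}

theorem hasPersp_zero_left (f : Dual F V) : HasPersp K 0 f := ⟨1, K.one_mem, by simp⟩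

theorem hasPersp_zero_right (c : V) : HasPersp K c 0 := ⟨1, K.one_mem, by simp⟩

theorem hasPersp_smul (a : F) : HasPersp K (a • c) f ↔ HasPersp K c (a • f) := by
  refine exists_congr fun g => and_congr_right fun _ => forall_congr' fun y => ?_
  rw [LinearMap.smul_apply, smul_eq_mul, mul_comm, mul_smul]

theorem HasPersp.conj (h : HasPersp K c f) {k : V ≃ₗ[F] V} (hk : k ∈ K) :
    HasPersp K (k c) (f ∘ₗ (k.symm : V →ₗ[F] V)) := by
  obtain ⟨g, hg, hgy⟩ := h
  refine ⟨k * g * k⁻¹, K.mul_mem (K.mul_mem hk hg) (K.inv_mem hk), fun y => ?_⟩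
  change k (g (k.symm y)) = _
  simp [hgy]

theorem HasPersp.add_left (h : HasPersp K c f) (h' : HasPersp K c' f) (hc' : f c' = 0) :
    HasPersp K (c + c') f := by
  obtain ⟨g, hg, hgy⟩ := h
  obtain ⟨g', hg', hgy'⟩ := h'
  refine ⟨g * g', K.mul_mem hg hg', fun y => ?_⟩
  rw [LinearEquiv.mul_apply, hgy', hgy, map_add, map_smul, hc']
  simp only [smul_zero, add_zero, smul_add]
  abel

theorem HasPersp.add_right (h : HasPersp K c f) (h' : HasPersp K c f') (hc : f c = 0) :
    HasPersp K c (f + f') := by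
  obtain ⟨g, hg, hgy⟩ := h
  obtain ⟨g', hg', hgy'⟩ := h'
  refine ⟨g * g', K.mul_mem hg hg', fun y => ?_⟩
  rw [LinearEquiv.mul_apply, hgy', hgy, map_add, map_smul, hc]
  simp only [smul_zero, add_zero, LinearMap.add_apply, add_smul]
  abel

theorem HasPersp.neg_right (h : HasPersp K c f) (hc : f c = 0) : HasPersp K c (-f) := by
  obtain ⟨g, hg, hgy⟩ := h
  refine ⟨g⁻¹, K.inv_mem hg, fun y => ?_⟩
  change g.symm y = _
  rw [LinearEquiv.symm_apply_eq, hgy]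
  simp [hc]

theorem HasPersp.neg_left (h : HasPersp K c f) (hc : f c = 0) : HasPersp K (-c) f := by
  obtain ⟨g, hg, hgy⟩ := h.neg_right hc
  exact ⟨g, hg, fun y => by rw [hgy]; simp⟩

theorem HasPersp.commutator (h : HasPersp K c f) (h' : HasPersp K c' f') (h1 : f c = 0)
    (h2 : f c' = 0) : HasPersp K (f' c • c') f := by
  obtain ⟨g, hg, hgy⟩ := h
  obtain ⟨g', hg', hgy'⟩ := h'
  refine ⟨g' * g * (g * g')⁻¹, K.mul_mem (K.mul_mem hg' hg) (K.inv_mem (K.mul_mem hg hg')),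
    fun y => ?_⟩
  obtain ⟨z, rfl⟩ := (g * g').surjective y
  have : (g' * g * (g * g')⁻¹) ((g * g') z) = (g' * g) z := by
    rw [← LinearEquiv.mul_apply, inv_mul_cancel_right]
  rw [this]
  simp only [LinearEquiv.mul_apply, hgy, hgy', map_add, map_smul, h1, h2, add_smul,
    add_zero, smul_eq_mul, mul_zero, mul_smul]
  abel

theorem exists_dual_apply_eq_one [FiniteDimensional F V] {W : Submodule F V} {v : V} (hv : v ∉ W) :
    ∃ f : Dual F V, f v = 1 ∧ ∀ w ∈ W, f w = 0 := by
  obtain ⟨f, hf, hfW⟩ := Submodule.exists_le_ker_of_notMem hv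
  exact ⟨(f v)⁻¹ • f, by simp [hf], fun w hw => by simp [LinearMap.mem_ker.1 (hfW hw)]⟩

theorem det_persp [FiniteDimensional F V] {g : V ≃ₗ[F] V} (h : ∀ y, g y = y + f y • c) :
    LinearMap.det (g : V →ₗ[F] V) = 1 + f c := by
  rw [← LinearMap.transvection.det]
  congr 1
  ext y
  simp [LinearMap.transvection.apply, h]

theorem exists_persp_apply_eq [FiniteDimensional F V] (hK : ∀ c f, f c = 0 → HasPersp K c f)
    {W : Submodule F V} {a b : V} (ha : a ∉ W) (hb : b ∉ W ⊔ F ∙ a) :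
    ∃ k ∈ K, (∀ w ∈ W, k w = w) ∧ k a = b ∧ LinearMap.det (k : V →ₗ[F] V) = 1 := by
  have h : a ∉ W ⊔ F ∙ (b - a) := by
    intro h
    obtain ⟨w, hw, z, hz, hwz⟩ := Submodule.mem_sup.1 h
    obtain ⟨r, rfl⟩ := Submodule.mem_span_singleton.1 hz
    have hr : r ≠ 0 := by
      rintro rfl
      rw [zero_smul, add_zero] at hwz
      exact ha (hwz ▸ hw)
    refine hb (Submodule.mem_sup.2 ⟨-(r⁻¹ • w), W.neg_mem (W.smul_mem _ hw), (r⁻¹ + 1) • a,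
      Submodule.smul_mem _ _ (Submodule.mem_span_singleton_self a), ?_⟩)
    rw [add_smul, one_smul]
    nth_rewrite 1 [← hwz]
    rw [smul_add, smul_smul, inv_mul_cancel₀ hr, one_smul]
    abel
  obtain ⟨f, hf1, hf0⟩ := exists_dual_apply_eq_one h
  have hfc : f (b - a) = 0 :=
    hf0 _ (Submodule.mem_sup_right (Submodule.mem_span_singleton_self _))
  obtain ⟨k, hk, hky⟩ := hK (b - a) f hfc
  refine ⟨k, hk, fun w hw => ?_, ?_, by rw [det_persp hky, hfc, add_zero]⟩
  · rw [hky, hf0 w (Submodule.mem_sup_left hw)]; simp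
  · rw [hky, hf1]; simp

theorem exists_notMem_of_ne_top {A B : Submodule F V} (hA : A ≠ ⊤) (hB : B ≠ ⊤) :
    ∃ u, u ∉ A ∧ u ∉ B := by
  by_contra! h
  obtain ⟨a, ha⟩ : ∃ a, a ∉ A := by
    by_contra! hc; exact hA (eq_top_iff.2 fun z _ => hc z)
  obtain ⟨b, hb⟩ : ∃ b, b ∉ B := by
    by_contra! hc; exact hB (eq_top_iff.2 fun z _ => hc z)
  have haB := h a ha
  have hbA : b ∈ A := by by_contra hc; exact hb (h b hc)
  by_cases hs : a + b ∈ A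
  · exact ha (by simpa using A.sub_mem hs hbA)
  · exact hb (by simpa using B.sub_mem (h _ hs) haB)

theorem eq_persp_of_fixes [FiniteDimensional F V] {W : Submodule F V}
    (hW : finrank F V ≤ finrank F W + 1) {g : V ≃ₗ[F] V} (hg : ∀ w ∈ W, g w = w) :
    ∃ (c : V) (f : Dual F V), ∀ y, g y = y + f y • c := by
  by_cases hWt : W = ⊤
  · exact ⟨0, 0, fun y => by simp [hg y (hWt ▸ trivial)]⟩
  obtain ⟨v, hv⟩ : ∃ v, v ∉ W := by
    by_contra! hc; exact hWt (eq_top_iff.2 fun z _ => hc z)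
  obtain ⟨f, hf1, hf0⟩ := exists_dual_apply_eq_one hv
  have hker : LinearMap.ker f = W := by
    refine (Submodule.eq_of_le_of_finrank_le (fun w hw => hf0 w hw) ?_).symm
    have h1 := LinearMap.finrank_range_add_finrank_ker f
    have h2 : LinearMap.range f = ⊤ := LinearMap.range_eq_top.2
      (LinearMap.surjective (fun h => by simp [h] at hf1))
    rw [h2, finrank_top, finrank_self] at h1
    omega
  refine ⟨g v - v, f, fun y => ?_⟩
  have h1 : y - f y • v ∈ W := by
    rw [← hker, LinearMap.mem_ker]; simp [hf1]
  have h2 := hg _ h1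
  rw [map_sub, map_smul] at h2
  rw [smul_sub, ← sub_eq_zero]
  rw [← sub_eq_zero] at h2
  rw [← h2]; abel

theorem mem_of_det_eq_one [FiniteDimensional F V] (hK : ∀ c f, f c = 0 → HasPersp K c f)
    {g : V ≃ₗ[F] V} (hg : LinearMap.det (g : V →ₗ[F] V) = 1) : g ∈ K := by
  have key : ∀ m : ℕ, ∀ W : Submodule F V, finrank F V ≤ finrank F W + m + 1 →
      ∀ g : V ≃ₗ[F] V, (∀ w ∈ W, g w = w) → LinearMap.det (g : V →ₗ[F] V) = 1 → g ∈ K := by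
    intro m
    induction m with
    | zero =>
      intro W hW g hg hdet
      obtain ⟨c, f, hcf⟩ := eq_persp_of_fixes hW hg
      rw [det_persp hcf] at hdet
      obtain ⟨k, hk, hky⟩ := hK c f (by simpa using hdet)
      have : g = k := by ext y; rw [hcf, hky]
      exact this ▸ hk
    | succ m ih =>
      intro W hW g hg hdet
      by_cases hlt : finrank F V ≤ finrank F W + m + 1
      · exact ih W hlt g hg hdet
      have hne : ∀ a, W ⊔ F ∙ a ≠ ⊤ := by
        intro a ha
        have h1 := Submodule.finrank_add_le_finrank_add_finrank W (F ∙ a)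
        rw [ha, finrank_top] at h1
        have h2 := finrank_span_le_card (R := F) ({a} : Set V)
        simp only [Set.toFinset_singleton, Finset.card_singleton] at h2
        omega
      obtain ⟨v, hv⟩ : ∃ v, v ∉ W := by
        by_contra! hc
        exact hne 0 (eq_top_iff.2 fun z _ => Submodule.mem_sup_left (hc z))
      have hgv : g v ∉ W := by
        intro h
        apply hv
        have := hg _ h
        rwa [← g.injective this]
      obtain ⟨u, hu1, hu2⟩ := exists_notMem_of_ne_top (hne (g v)) (hne v)
      obtain ⟨k1, hk1, hk1W, hk1v, hk1d⟩ := exists_persp_apply_eq hK hgv hu1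
      have hv' : v ∉ W ⊔ F ∙ u := by
        intro h
        obtain ⟨w, hw, z, hz, hwz⟩ := Submodule.mem_sup.1 h
        obtain ⟨r, rfl⟩ := Submodule.mem_span_singleton.1 hz
        have hr : r ≠ 0 := by
          rintro rfl
          rw [zero_smul, add_zero] at hwz
          exact hv (hwz ▸ hw)
        refine hu2 (Submodule.mem_sup.2 ⟨-(r⁻¹ • w), W.neg_mem (W.smul_mem _ hw), r⁻¹ • v,
          Submodule.smul_mem _ _ (Submodule.mem_span_singleton_self v), ?_⟩)
        rw [← hwz, smul_add, smul_smul, inv_mul_cancel₀ hr, one_smul]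
        abel
      obtain ⟨k2, hk2, hk2W, hk2v, hk2d⟩ := exists_persp_apply_eq hK
        (fun h => hu1 (Submodule.mem_sup_left h)) hv'
      have hmem : k2 * k1 * g ∈ K := by
        refine ih (W ⊔ F ∙ v) ?_ _ ?_ ?_
        · have h1 : finrank F W < finrank F ↥(W ⊔ F ∙ v) :=
            Submodule.finrank_lt_finrank_of_lt (lt_of_le_of_ne le_sup_left fun h => hv
              (h ▸ Submodule.mem_sup_right (Submodule.mem_span_singleton_self v)))
          omega
        · intro w hw
          obtain ⟨w, hwW, z, hz, rfl⟩ := Submodule.mem_sup.1 hw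
          obtain ⟨r, rfl⟩ := Submodule.mem_span_singleton.1 hz
          simp only [LinearEquiv.mul_apply, map_add, map_smul, hk1v, hk2v, hg w hwW,
            hk1W w hwW, hk2W w hwW]
        · have : ((k2 * k1 * g : V ≃ₗ[F] V) : V →ₗ[F] V) = (k2 : V →ₗ[F] V) * k1 * g := rfl
          rw [this, map_mul, map_mul, hk1d, hk2d, hdet]
          simp
      exact (K.mul_mem_cancel_left (K.mul_mem hk2 hk1)).1 hmem
  exact key (finrank F V) ⊥ (by omega) g (by simp) hg

theorem eq_top_of_persp_of_det [FiniteDimensional F V] (hK : ∀ c f, f c = 0 → HasPersp K c f)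
    (hdet : ∀ a : F, a ≠ 0 → ∃ k ∈ K, LinearMap.det (k : V →ₗ[F] V) = a) : K = ⊤ := by
  refine eq_top_iff.2 fun g _ => ?_
  obtain ⟨k, hk, hkd⟩ := hdet (LinearMap.det (g : V →ₗ[F] V)) (g.isUnit_det').ne_zero
  have hmem : k⁻¹ * g ∈ K := by
    refine mem_of_det_eq_one hK ?_
    have h1 : ((k * (k⁻¹ * g) : V ≃ₗ[F] V) : V →ₗ[F] V) =
      (k : V →ₗ[F] V) * ((k⁻¹ * g : V ≃ₗ[F] V) : V →ₗ[F] V) := rfl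
    rw [mul_inv_cancel_left] at h1
    have h2 := congrArg LinearMap.det h1
    rw [map_mul, hkd] at h2
    exact mul_left_cancel₀ (g.isUnit_det').ne_zero (h2.symm.trans (mul_one _).symm)
  exact (K.mul_mem_cancel_left (K.inv_mem hk)).1 hmem

end Perspectivity

section Counting

open Module

theorem AddSubgroup.eq_of_le_of_lt_two_mul {A : Type*} [AddGroup A] [Finite A]
    {M N : AddSubgroup A} (h : M ≤ N) (hc : Nat.card N < 2 * Nat.card M) : M = N := by
  obtain ⟨k, hk⟩ := AddSubgroup.card_dvd_of_le h
  have hM : 0 < Nat.card M := Nat.card_pos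
  have hN : 0 < Nat.card N := Nat.card_pos
  have hk1 : k = 1 := by
    have h1 : k < 2 := by
      by_contra! h2
      nlinarith
    have h2 : k ≠ 0 := by
      rintro rfl
      omega
    omega
  subst hk1
  refine SetLike.coe_injective (Set.eq_of_subset_of_ncard_le h ?_ (Set.toFinite _))
  rw [← Nat.card_coe_set_eq, ← Nat.card_coe_set_eq]
  simpa using hk.le

theorem card_mul_card_le_of_lt {F V : Type*} [Field F] [AddCommGroup V] [Module F V] [Finite V]
    [Finite F] {D A : Submodule F V} (h : D < A) : Nat.card F * Nat.card D ≤ Nat.card A := by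
  rw [Module.natCard_eq_pow_finrank (K := F) (V := D),
    Module.natCard_eq_pow_finrank (K := F) (V := A), ← pow_succ']
  exact Nat.pow_le_pow_right Nat.card_pos (Submodule.finrank_lt_finrank_of_lt h)

theorem card_ker_mul {F V : Type*} [Field F] [AddCommGroup V] [Module F V] [Finite V]
    [Finite F] {f : Dual F V} (hf : f ≠ 0) :
    Nat.card V = Nat.card F * Nat.card (LinearMap.ker f) := by
  have h1 := LinearMap.finrank_range_add_finrank_ker f
  rw [LinearMap.range_eq_top.2 (LinearMap.surjective hf), finrank_top, finrank_self] at h1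
  rw [Module.natCard_eq_pow_finrank (K := F) (V := V),
    Module.natCard_eq_pow_finrank (K := F) (V := LinearMap.ker f), ← h1, pow_add, pow_one]

end Counting

section FieldModel

open Module

variable {F E : Type*} [Field F] [Field E] [Algebra F E]

/-- The functional `y ↦ φ (b * y)`. -/
def dualMul (φ : Dual F E) (b : E) : Dual F E := φ ∘ₗ LinearMap.mulLeft F b

@[simp] theorem dualMul_apply (φ : Dual F E) (b y : E) : dualMul φ b y = φ (b * y) := rfl

theorem dualMul_surjective [Finite E] {φ : Dual F E} (hφ : φ ≠ 0) (f : Dual F E) :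
    ∃ b, dualMul φ b = f := by
  let L : E →ₗ[F] Dual F E :=
    { toFun := dualMul φ
      map_add' := fun a b => by ext y; simp [add_mul]
      map_smul' := fun a b => by ext y; simp }
  have hinj : Function.Injective L := by
    rw [← LinearMap.ker_eq_bot, LinearMap.ker_eq_bot']
    intro b hb
    by_contra hb0
    refine hφ (LinearMap.ext fun y => ?_)
    have := LinearMap.congr_fun hb (b⁻¹ * y)
    simpa [L, mul_inv_cancel_left₀ hb0] using this
  exact (LinearMap.injective_iff_surjective_of_finrank_eq_finrank
    (Subspace.dual_finrank_eq (K := F) (V := E)).symm).1 hinj f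

theorem exists_algebraMap_eq_of_mul_ker_le {φ : Dual F E} (hφ : φ ≠ 0) {e : E}
    (he : ∀ y, φ y = 0 → φ (e * y) = 0) : ∃ a : F, algebraMap F E a = e := by
  obtain ⟨t, ht⟩ : ∃ t, φ t ≠ 0 := by
    by_contra! h
    exact hφ (LinearMap.ext h)
  refine ⟨φ (e * t) / φ t, ?_⟩
  set a := φ (e * t) / φ t with ha
  have h1 : ∀ y, φ ((e - algebraMap F E a) * y) = 0 := by
    intro y
    have h2 := he (y - (φ y / φ t) • t) (by simp [ht])
    rw [mul_sub, map_sub, mul_smul_comm, map_smul, sub_eq_zero] at h2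
    rw [sub_mul, map_sub, ← Algebra.smul_def, map_smul, h2, ha]
    simp only [smul_eq_mul]
    field_simp
    simp
  by_contra hne
  apply ht
  have := h1 ((e - algebraMap F E a)⁻¹ * t)
  rwa [mul_inv_cancel_left₀ (sub_ne_zero.2 (Ne.symm hne))] at this

/-- A hyperplane containing `1` and closed under inversion is contained in the base field. -/
theorem mem_range_of_inv_closed [Finite E] {φ : Dual F E} (hφ : φ ≠ 0) (h1 : φ 1 = 0)
    (hinv : ∀ y, φ y = 0 → φ y⁻¹ = 0) {a : E} (ha : φ a = 0) :
    ∃ t : F, algebraMap F E t = a := by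
  have hua : ∀ a b : E, φ a = 0 → φ b = 0 → φ (a * a * b) = 0 := by
    intro a b ha hb
    by_cases ha0 : a = 0
    · simp [ha0]
    by_cases hb0 : b = 0
    · simp [hb0]
    by_cases hab : a * b = 1
    · rw [mul_assoc, hab, mul_one, ha]
    have hba : b⁻¹ - a ≠ 0 := by
      intro h
      apply hab
      rw [← sub_eq_zero.1 h, inv_mul_cancel₀ hb0]
    have h2 : φ (a⁻¹ + (b⁻¹ - a)⁻¹)⁻¹ = 0 := by
      refine hinv _ ?_
      rw [map_add, hinv a ha, hinv _ (by rw [map_sub, hinv b hb, ha, sub_zero]), add_zero]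
    have h1ab : 1 - a * b ≠ 0 := fun h => hab (sub_eq_zero.1 h).symm
    have e : a * a * b = a - (a⁻¹ + (b⁻¹ - a)⁻¹)⁻¹ := by
      have e1 : b⁻¹ - a = (1 - a * b) / b := by field_simp
      have e2 : a⁻¹ + ((1 - a * b) / b)⁻¹ = 1 / (a * (1 - a * b)) := by
        field_simp
        ring
      rw [e1, e2, one_div, inv_inv]
      ring
    rw [e, map_sub, ha, h2, sub_zero]
  have hsq : ∀ a, φ a = 0 → ∃ t : F, algebraMap F E t = a * a := fun a ha =>
    exists_algebraMap_eq_of_mul_ker_le hφ fun y hy => hua a y ha hy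
  have : Finite F := Finite.of_injective _ (algebraMap F E).injective
  by_cases h2 : ringChar F = 2
  · have := Fintype.ofFinite F
    obtain ⟨t, ht⟩ := hsq a ha
    obtain ⟨s, rfl⟩ := FiniteField.isSquare_of_char_two h2 t
    refine ⟨s, ?_⟩
    have hch : CharP F 2 := h2 ▸ ringChar.charP F
    have : CharP E 2 := charP_of_injective_algebraMap (algebraMap F E).injective 2
    rw [map_mul] at ht
    have h3 : (algebraMap F E s + a) * (algebraMap F E s + a) = 0 := by
      have : (2 : E) = 0 := CharTwo.two_eq_zero
      linear_combination ht + (a * a + algebraMap F E s * a) * this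
    have h4 := mul_self_eq_zero.1 h3
    rwa [CharTwo.add_eq_zero] at h4
  · obtain ⟨t, ht⟩ := hsq a ha
    obtain ⟨s, hs⟩ := hsq (a + 1) (by rw [map_add, ha, h1, add_zero])
    have h2' : (2 : F) ≠ 0 := Ring.two_ne_zero h2
    refine ⟨(s - t - 1) / 2, ?_⟩
    have h3 : (2 : E) ≠ 0 := by
      intro h
      apply h2'
      apply (algebraMap F E).injective
      rw [map_ofNat, map_zero, h]
    rw [map_div₀, map_sub, map_sub, hs, ht, map_one, map_ofNat]
    field_simp
    ring

end FieldModel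

section SingerTransvection

open Module

variable {F E : Type*} [Field F] [Field E] [Algebra F E]

/-- An additive subgroup of `ker φ` that contains `1` and is closed under
`w ↦ φ (z⁻¹ * w) • z` for all `z ∈ ker φ` is all of `ker φ`. -/
theorem eq_ker_of_smul_mem [Finite E] [Finite F] {φ : Dual F E} (hφ : φ ≠ 0)
    (hcard : Nat.card F < Nat.card (LinearMap.ker φ)) {M : AddSubgroup E} (hM1 : (1 : E) ∈ M)
    (hMA : ∀ w ∈ M, φ w = 0)
    (hM : ∀ z, φ z = 0 → z ≠ 0 → ∀ w ∈ M, φ (z⁻¹ * w) • z ∈ M) {z : E} (hz : φ z = 0) :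
    z ∈ M := by
  classical
  have := Fintype.ofFinite E
  have := Fintype.ofFinite F
  set A : Submodule F E := LinearMap.ker φ with hA
  have hφ1 : φ 1 = 0 := hMA 1 hM1
  -- the subspace of inverses of the exceptional multipliers
  let B : Submodule F E :=
    { carrier := {y | ∀ w ∈ M, φ (y * w) = 0}
      zero_mem' := fun w _ => by simp
      add_mem' := fun {a b} ha hb w hw => by rw [add_mul, map_add, ha w hw, hb w hw, add_zero]
      smul_mem' := fun c a ha w hw => by rw [smul_mul_assoc, map_smul, ha w hw, smul_zero] }
  have hBmem : ∀ y, y ∈ B ↔ ∀ w ∈ M, φ (y * w) = 0 := fun y => Iff.rfl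
  have hBA : B < A := by
    refine lt_of_le_of_ne (fun y hy => ?_) fun hBA => ?_
    · have := hy 1 hM1
      rwa [mul_one] at this
    · have hMF : ∀ w ∈ M, ∃ a : F, algebraMap F E a = w := fun w hw =>
        exists_algebraMap_eq_of_mul_ker_le hφ fun y hy => by
          rw [mul_comm]
          have : y ∈ B := hBA ▸ LinearMap.mem_ker.2 hy
          exact this w hw
      have hinv : ∀ y, φ y = 0 → φ y⁻¹ = 0 := by
        intro y hy
        by_cases hy0 : y = 0
        · simp [hy0]
        by_contra hne
        have h1 := hM y hy hy0 1 hM1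
        rw [mul_one] at h1
        obtain ⟨a, ha⟩ := hMF _ h1
        have h2 : y⁻¹ = (a⁻¹ * φ y⁻¹) • 1 := by
          have ha0 : a ≠ 0 := by
            rintro rfl
            rw [map_zero, eq_comm, smul_eq_zero] at ha
            tauto
          rw [Algebra.smul_def, mul_one, map_mul, map_inv₀, ha, Algebra.smul_def]
          have : algebraMap F E (φ y⁻¹) ≠ 0 := by simpa using hne
          rw [mul_inv, mul_right_comm, inv_mul_cancel₀ this, one_mul]
        apply hne
        rw [h2, map_smul, hφ1, smul_zero]
      have hle : Nat.card A ≤ Nat.card F := by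
        have hch : ∀ a : A, ∃ t : F, algebraMap F E t = a := fun a =>
          mem_range_of_inv_closed hφ hφ1 hinv a.2
        choose g hg using hch
        refine Nat.card_le_card_of_injective g fun a b hab => Subtype.ext ?_
        rw [← hg a, ← hg b, hab]
      omega
  obtain ⟨b, hb⟩ : Nat.card F ∣ Nat.card A := by
    rw [Module.natCard_eq_pow_finrank (K := F) (V := A)]
    refine dvd_pow_self _ fun h0 => ?_
    rw [Module.natCard_eq_pow_finrank (K := F) (V := A), h0, pow_zero] at hcard
    have : 0 < Nat.card F := Nat.card_pos
    omega
  have hqpos : 0 < Nat.card F := Nat.card_pos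
  have hq2 : 1 < Nat.card F := Finite.one_lt_card
  have hbound : ∀ D : Submodule F E, D < A → Nat.card D ≤ b := fun D hD =>
    Nat.le_of_mul_le_mul_left (hb ▸ card_mul_card_le_of_lt hD) hqpos
  -- exceptional elements
  let Z0 : Finset E := Finset.univ.filter fun z => z ≠ 0 ∧ φ z = 0 ∧ ∀ w ∈ M, φ (z⁻¹ * w) = 0
  have hZ0 : Z0.card + 1 ≤ b := by
    refine le_trans ?_ (hbound B hBA)
    have h1 : (insert 0 (Z0.image fun z => z⁻¹)).card = Z0.card + 1 := by
      rw [Finset.card_insert_of_notMem, Finset.card_image_of_injective _ inv_injective]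
      simp [Z0]
    rw [← h1, ← Set.ncard_coe_finset, ← SetLike.coe_sort_coe B, Nat.card_coe_set_eq]
    refine Set.ncard_le_ncard ?_ (Set.toFinite _)
    intro y hy
    simp only [Finset.coe_insert, Finset.coe_image, Set.mem_insert_iff, Set.mem_image,
      Finset.mem_coe] at hy
    rcases hy with rfl | ⟨z, hz, rfl⟩
    · exact B.zero_mem
    · exact (hBmem _).2 (Finset.mem_filter.1 hz).2.2.2
  let Λ : E → AddSubgroup F := fun z =>
    M.comap ((LinearMap.toSpanSingleton F E z : F →ₗ[F] E) : F →+ E)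
  have hΛ : ∀ z a, a ∈ Λ z ↔ a • z ∈ M := fun z a => Iff.rfl
  let Z1 : Finset E := Finset.univ.filter fun z => z ≠ 0 ∧ φ z = 0 ∧ ∃ w ∈ M, φ (z⁻¹ * w) ≠ 0
  have hZ1Λ : ∀ z ∈ Z1, 2 ≤ Nat.card (Λ z) := by
    intro z hz
    obtain ⟨-, hz0, hzA, w, hw, hzw⟩ := Finset.mem_filter.1 hz
    have : Nontrivial (Λ z) := (AddSubgroup.nontrivial_iff_exists_ne_zero _).2
      ⟨_, (hΛ z _).2 (hM z hzA hz0 w hw), hzw⟩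
    exact Finite.one_lt_card
  -- it suffices to see that `M` contains all nonexceptional elements
  suffices hsub : ∀ z ∈ Z1, z ∈ M by
    have hMeq : M = A.toAddSubgroup := by
      refine AddSubgroup.eq_of_le_of_lt_two_mul hMA ?_
      have h1 : Nat.card A ≤ Nat.card M + Z0.card := by
        have h2 : Nat.card A = (Finset.univ.filter fun z => φ z = 0).card := by
          rw [← Fintype.card_subtype, ← Nat.card_eq_fintype_card]; rfl
        have h3 : Nat.card M = (Finset.univ.filter fun z => z ∈ M).card := by
          rw [← Fintype.card_subtype, ← Nat.card_eq_fintype_card]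
        rw [h2, h3]
        refine (Finset.card_le_card ?_).trans (Finset.card_union_le _ _)
        intro z hz
        simp only [Finset.mem_filter, Finset.mem_univ, true_and] at hz
        rw [Finset.mem_union]
        by_cases hz0 : z = 0
        · left; simp [hz0, M.zero_mem]
        by_cases hz1 : ∃ w ∈ M, φ (z⁻¹ * w) ≠ 0
        · left; simpa using hsub z (by simp [Z1, hz0, hz, hz1])
        · right; push Not at hz1; simpa [Z0, hz0, hz] using hz1
      change Nat.card A < _
      nlinarith
    rw [hMeq]
    exact hz
  intro z hz
  -- minimal multiplier group
  obtain ⟨z₀, hz₀, hmin⟩ := Finset.exists_min_image Z1 (fun z => Nat.card (Λ z)) ⟨z, hz⟩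
  suffices hfull : Nat.card F ≤ Nat.card (Λ z₀) by
    have h1 : Λ z = ⊤ := by
      refine (AddSubgroup.card_eq_iff_eq_top _).1 (le_antisymm (Finite.card_subtype_le _) ?_)
      exact hfull.trans (hmin z hz)
    have h2 : (1 : F) ∈ Λ z := h1 ▸ AddSubgroup.mem_top _
    simpa using (hΛ z 1).1 h2
  by_cases hq3 : Nat.card F < 3
  · have := hZ1Λ z₀ hz₀
    omega
  obtain ⟨-, hz₀0, hz₀A, w₀, hw₀, hzw₀⟩ := Finset.mem_filter.1 hz₀
  let D : Submodule F E := A ⊓ LinearMap.ker (dualMul φ z₀⁻¹)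
  have hDmem : ∀ y, y ∈ D ↔ φ y = 0 ∧ φ (z₀⁻¹ * y) = 0 := fun y => Iff.rfl
  have hDA : D < A := by
    refine lt_of_le_of_ne inf_le_left fun h => hzw₀ ?_
    have : w₀ ∈ D := h ▸ hMA w₀ hw₀
    exact this.2
  have hDb := hbound D hDA
  let N : AddSubgroup E := M ⊓ D.toAddSubgroup
  have hND : N ≤ D.toAddSubgroup := inf_le_right
  set P := Nat.card (Λ z₀) with hP
  have hP2 : 2 ≤ P := hZ1Λ z₀ hz₀
  have hMN : Nat.card M ≤ P * Nat.card N := by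
    let ψ : M →+ F := ((dualMul φ z₀⁻¹ : E →ₗ[F] F) : E →+ F).comp M.subtype
    have h1 : Nat.card M = Nat.card ψ.range * Nat.card ψ.ker := by
      rw [← AddSubgroup.index_ker, mul_comm, AddSubgroup.card_mul_index]
    have h2 : Nat.card ψ.range ≤ P := by
      refine Nat.card_le_card_of_injective (β := Λ z₀)
        (fun a => ⟨a.1, ?_⟩) fun a b hab => Subtype.ext (Subtype.mk.inj hab)
      obtain ⟨w, hw⟩ := a.2
      rw [← hw]
      exact hM z₀ hz₀A hz₀0 w w.2
    have h3 : Nat.card ψ.ker ≤ Nat.card N := by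
      refine Nat.card_le_card_of_injective (fun a => ⟨a.1.1, a.1.2, hMA _ a.1.2, a.2⟩)
        fun a b hab => Subtype.ext (Subtype.ext (Subtype.mk.inj hab))
    rw [h1]
    exact Nat.mul_le_mul h2 h3
  let T : Finset E := Z1.filter fun y => φ (z₀⁻¹ * y) ≠ 0
  have hT : Nat.card A ≤ T.card + Nat.card D + Z0.card := by
    have h2 : Nat.card A = (Finset.univ.filter fun z => φ z = 0).card := by
      rw [← Fintype.card_subtype, ← Nat.card_eq_fintype_card]; rfl
    have h3 : Nat.card D = (Finset.univ.filter fun z => z ∈ D).card := by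
      rw [← Fintype.card_subtype, ← Nat.card_eq_fintype_card]
    rw [h2, h3]
    refine (Finset.card_le_card ?_).trans ((Finset.card_union_le _ _).trans
      (Nat.add_le_add_right (Finset.card_union_le _ _) _))
    intro z hz
    simp only [Finset.mem_filter, Finset.mem_univ, true_and] at hz
    rw [Finset.mem_union, Finset.mem_union]
    by_cases hzD : φ (z₀⁻¹ * z) = 0
    · left; right; simpa [hDmem, hz] using hzD
    have hz0 : z ≠ 0 := by rintro rfl; simp at hzD
    by_cases hz1 : ∃ w ∈ M, φ (z⁻¹ * w) ≠ 0
    · left; left; simp [T, Z1, hz0, hz, hzD, hz1]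
    · right; push Not at hz1; simpa [Z0, hz0, hz] using hz1
  have hdouble : (P - 1) * T.card ≤ (Nat.card F - 1) * (Nat.card M - Nat.card N) := by
    let X : Finset (Σ _ : E, F) :=
      T.sigma fun y => (Finset.univ.filter fun a => a ∈ Λ y).erase 0
    have h1 : T.card * (P - 1) ≤ X.card := by
      rw [Finset.card_sigma, ← smul_eq_mul]
      refine Finset.card_nsmul_le_sum _ _ _ fun y hy => ?_
      rw [Finset.card_erase_of_mem (by simp [(Λ y).zero_mem]), ← Fintype.card_subtype,
        ← Nat.card_eq_fintype_card]
      exact Nat.sub_le_sub_right (hmin y (Finset.mem_filter.1 hy).1) 1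
    let Y : Finset (E × F) := ((Finset.univ.filter fun w => w ∈ M) \
      (Finset.univ.filter fun w => w ∈ N)) ×ˢ (Finset.univ : Finset F).erase 0
    have h2 : X.card ≤ Y.card := by
      refine Finset.card_le_card_of_injOn (fun u => (u.2 • u.1, u.2)) ?_ ?_
      · rintro ⟨y, a⟩ hu
        simp only [X, Finset.mem_coe, Finset.mem_sigma, Finset.mem_erase, Finset.mem_filter,
          Finset.mem_univ, true_and, T, hΛ] at hu
        obtain ⟨⟨-, hy⟩, ha0, haM⟩ := hu
        simp only [Y, Finset.coe_product, Set.mem_prod, Finset.mem_coe, Finset.mem_sdiff,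
          Finset.mem_filter, Finset.mem_univ, true_and, Finset.mem_erase, and_true]
        refine ⟨⟨haM, fun hN => hy ?_⟩, ha0⟩
        have h3 : φ (z₀⁻¹ * (a • y)) = 0 := hN.2.2
        rw [mul_smul_comm, map_smul, smul_eq_zero] at h3
        exact h3.resolve_left ha0
      · rintro ⟨y, a⟩ hu ⟨y', a'⟩ - huv
        simp only [X, Finset.mem_coe, Finset.mem_sigma, Finset.mem_erase] at hu
        simp only [Prod.mk.injEq] at huv
        obtain ⟨h3, rfl⟩ := huv
        rw [smul_right_injective E hu.2.1 h3]
    have h3 : Y.card = (Nat.card M - Nat.card N) * (Nat.card F - 1) := by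
      rw [Finset.card_product, Finset.card_erase_of_mem (Finset.mem_univ _), Finset.card_univ,
        ← Nat.card_eq_fintype_card, Finset.card_sdiff_of_subset, ← Fintype.card_subtype,
        ← Fintype.card_subtype, ← Nat.card_eq_fintype_card, ← Nat.card_eq_fintype_card]
      intro w hw
      simp only [Finset.mem_filter, Finset.mem_univ, true_and] at hw ⊢
      exact hw.1
    rw [mul_comm, mul_comm (Nat.card F - 1), ← h3]
    exact h1.trans h2
  have hNM : Nat.card N ≤ Nat.card M := AddSubgroup.card_le_of_le inf_le_left
  have hN2 : b < 2 * Nat.card N := by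
    obtain ⟨P', hP'⟩ : ∃ P', P = P' + 2 := ⟨P - 2, by omega⟩
    obtain ⟨r, hr⟩ : ∃ r, Nat.card F = r + 3 := ⟨Nat.card F - 3, by omega⟩
    have h1 : Nat.card M - Nat.card N ≤ (P' + 1) * Nat.card N := by
      rw [hP'] at hMN
      have : (P' + 2) * Nat.card N = (P' + 1) * Nat.card N + Nat.card N := by ring
      omega
    rw [hP', hr, show P' + 2 - 1 = P' + 1 by omega, show r + 3 - 1 = r + 2 by omega] at hdouble
    have h2 : (P' + 1) * T.card ≤ (P' + 1) * ((r + 2) * Nat.card N) := by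
      calc _ ≤ _ := hdouble
        _ ≤ (r + 2) * ((P' + 1) * Nat.card N) := Nat.mul_le_mul_left _ h1
        _ = _ := by ring
    have h3 : T.card ≤ (r + 2) * Nat.card N := Nat.le_of_mul_le_mul_left h2 (by omega)
    rw [hb, hr] at hT
    by_contra! h4
    have h5 : (r + 2) * (2 * Nat.card N) ≤ (r + 2) * b := Nat.mul_le_mul_left _ h4
    nlinarith
  have hNeq : N = D.toAddSubgroup := AddSubgroup.eq_of_le_of_lt_two_mul hND (lt_of_le_of_lt hDb hN2)
  refine le_of_eq ?_
  have : Λ z₀ = ⊤ := by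
    refine eq_top_iff.2 fun a _ => (hΛ z₀ a).2 ?_
    have h1 : a • z₀ ∈ D := by
      rw [hDmem, map_smul, hz₀A, mul_smul_comm, inv_mul_cancel₀ hz₀0, map_smul, hφ1]
      simp
    have h2 : a • z₀ ∈ N := hNeq ▸ h1
    exact h2.1
  rw [hP, this]
  exact Nat.card_congr (Equiv.Set.univ F).symm

end SingerTransvection

section SingerTop

open Module

variable {F E : Type*} [Field F] [Field E] [Algebra F E]

/-- Multiplication by units of `E`, as `F`-linear automorphisms of `E`. -/
def unitMul (F E : Type*) [Field F] [Field E] [Algebra F E] : Eˣ →* E ≃ₗ[F] E :=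
  DistribMulAction.toModuleAut F E

@[simp] theorem unitMul_apply (u : Eˣ) (y : E) : unitMul F E u y = u * y := rfl

@[simp] theorem unitMul_symm_apply (u : Eˣ) (y : E) :
    (unitMul F E u).symm y = (u : E)⁻¹ * y := by
  rw [LinearEquiv.symm_apply_eq, unitMul_apply, mul_inv_cancel_left₀ u.ne_zero]

theorem exists_det_unitMul_eq [Finite E] {a : F} (ha : a ≠ 0) :
    ∃ u : Eˣ, LinearMap.det (unitMul F E u : E →ₗ[F] E) = a := by
  have : Finite F := Finite.of_injective _ (algebraMap F E).injective
  obtain ⟨y, hy⟩ := FiniteField.norm_surjective F E a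
  have hy0 : y ≠ 0 := by
    rintro rfl
    rw [Algebra.norm_zero] at hy
    exact ha hy.symm
  refine ⟨Units.mk0 y hy0, ?_⟩
  rw [← hy, Algebra.norm_apply]
  rfl

theorem forall_unitMul_mem {K : Subgroup (E ≃ₗ[F] E)} {u : Eˣ} (hu : ∀ v, v ∈ Subgroup.zpowers u)
    (h : unitMul F E u ∈ K) (v : Eˣ) : unitMul F E v ∈ K := by
  obtain ⟨k, rfl⟩ := hu v
  rw [map_zpow]
  exact K.zpow_mem h k

theorem eq_top_of_unitMul_mem_of_transvection [Finite E] (hn : 3 ≤ finrank F E)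
    {K : Subgroup (E ≃ₗ[F] E)} (hE : ∀ u, unitMul F E u ∈ K) {c : E} {f : Dual F E}
    (hc : c ≠ 0) (hf : f ≠ 0) (hfc : f c = 0) (h : HasPersp K c f) : K = ⊤ := by
  have : Finite F := Finite.of_injective _ (algebraMap F E).injective
  have hconj : ∀ {u c : E} {f : Dual F E}, u ≠ 0 → HasPersp K c f →
      HasPersp K (u * c) (dualMul f u⁻¹) := by
    intro u c f hu h
    have h1 := h.conj (hE (Units.mk0 u hu))
    have h2 : f ∘ₗ ((unitMul F E (Units.mk0 u hu)).symm : E →ₗ[F] E) = dualMul f u⁻¹ := by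
      ext y; simp
    rwa [h2] at h1
  have hassoc : ∀ (φ : Dual F E) (a b : E), dualMul (dualMul φ a) b = dualMul φ (a * b) :=
    fun φ a b => by ext y; simp [mul_assoc]
  set φ := dualMul f c with hφdef
  have hφ : φ ≠ 0 := by
    intro h0
    refine hf (LinearMap.ext fun y => ?_)
    have := LinearMap.congr_fun h0 (c⁻¹ * y)
    simpa [hφdef, mul_inv_cancel_left₀ hc] using this
  have hφ1 : φ 1 = 0 := by simpa [hφdef] using hfc
  have h1 : HasPersp K 1 φ := by
    have := hconj (inv_ne_zero hc) h
    rwa [inv_mul_cancel₀ hc, inv_inv] at this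
  let M : AddSubgroup E :=
    { carrier := {z | φ z = 0 ∧ HasPersp K z φ}
      zero_mem' := ⟨map_zero _, hasPersp_zero_left _⟩
      add_mem' := fun {a b} ha hb => ⟨by rw [map_add, ha.1, hb.1, add_zero], ha.2.add_left hb.2 hb.1⟩
      neg_mem' := fun {a} ha => ⟨by rw [map_neg, ha.1, neg_zero], ha.2.neg_left ha.1⟩ }
  have hcard : Nat.card F < Nat.card (LinearMap.ker φ) := by
    have h2 := card_ker_mul hφ
    rw [Module.natCard_eq_pow_finrank (K := F) (V := E)] at h2
    have hq : 1 < Nat.card F := Finite.one_lt_card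
    have h3 : Nat.card F ^ 3 ≤ Nat.card F * Nat.card (LinearMap.ker φ) :=
      h2 ▸ Nat.pow_le_pow_right (by omega) hn
    have h4 : Nat.card F ^ 2 ≤ Nat.card (LinearMap.ker φ) :=
      Nat.le_of_mul_le_mul_left (by rw [← pow_succ']; exact h3) (by omega)
    nlinarith
  have hM : ∀ z, φ z = 0 → HasPersp K z φ := by
    intro z hz
    refine (eq_ker_of_smul_mem hφ hcard (M := M) ⟨hφ1, h1⟩ (fun w hw => hw.1) ?_ hz).2
    intro z hz hz0 w hw
    refine ⟨by rw [map_smul, hz, smul_zero], ?_⟩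
    have h2 := hconj hz0 h1
    rw [mul_one] at h2
    exact hw.2.commutator h2 hw.1 hz
  refine eq_top_of_persp_of_det (fun c' f' hcf => ?_) fun a ha => ?_
  · obtain ⟨b, rfl⟩ := dualMul_surjective hφ f'
    by_cases hb : b = 0
    · subst hb
      have : dualMul φ 0 = 0 := by ext y; simp
      rw [this]
      exact hasPersp_zero_right _
    · have h2 := hconj (inv_ne_zero hb) (hM (b * c') (by simpa using hcf))
      rwa [inv_mul_cancel_left₀ hb, inv_inv] at h2
  · obtain ⟨u, hu⟩ := exists_det_unitMul_eq (E := E) ha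
    exact ⟨_, hE u, hu⟩

end SingerTop

section Homology

open Module

variable {F V : Type*} [Field F] [AddCommGroup V] [Module F V]

theorem HasPersp.sub_right {K : Subgroup (V ≃ₗ[F] V)} {c : V} {f f' : Dual F V}
    (h : HasPersp K c f) (h' : HasPersp K c f') (hc : f c = f' c) : HasPersp K c (f - f') := by
  obtain ⟨g, hg, hgy⟩ := h
  obtain ⟨g', hg', hgy'⟩ := h'
  refine ⟨g * g'⁻¹, K.mul_mem hg (K.inv_mem hg'), fun y => ?_⟩
  obtain ⟨z, rfl⟩ := g'.surjective y
  change g (g'.symm (g' z)) = _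
  rw [LinearEquiv.symm_apply_apply, hgy, hgy', LinearMap.sub_apply, map_add, map_add, map_smul,
    map_smul, hc]
  simp only [add_sub_add_right_eq_sub, sub_smul]
  abel

variable {E : Type*} [Field E] [Algebra F E]

theorem exists_algebraMap_eq_of_quadratic [FiniteDimensional F E] (hn : finrank F E = 3) {z : E}
    {a b c : F} (ha : a ≠ 0) (h : a • (z * z) + b • z + algebraMap F E c = 0) :
    ∃ t : F, algebraMap F E t = z := by
  have hzint : IsIntegral F z := Algebra.IsIntegral.isIntegral z
  have hdvd := minpoly.degree_dvd hzint
  rw [hn] at hdvd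
  rcases (Nat.dvd_prime Nat.prime_three).1 hdvd with h1 | h3
  · exact minpoly.natDegree_eq_one_iff.1 h1
  · exfalso
    let p : Polynomial F := Polynomial.C a * Polynomial.X ^ 2 + Polynomial.C b * Polynomial.X +
      Polynomial.C c
    have hp : p.natDegree = 2 := Polynomial.natDegree_quadratic ha
    have hp0 : p ≠ 0 := by
      intro h0
      rw [h0] at hp
      simp at hp
    have := Polynomial.natDegree_le_natDegree (minpoly.degree_le_of_ne_zero F z hp0 (by
      simp only [p, map_add, map_mul, Polynomial.aeval_C, Polynomial.aeval_X, map_pow]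
      rw [← h, Algebra.smul_def, Algebra.smul_def, pow_two]))
    omega

theorem eq_top_of_unitMul_mem_of_homology [Finite E] (hn : finrank F E = 3)
    {K : Subgroup (E ≃ₗ[F] E)} (hE : ∀ u, unitMul F E u ∈ K) {c : E} {f : Dual F E}
    (hfc : f c ≠ 0) (h : HasPersp K c f) : K = ⊤ := by
  have : Finite F := Finite.of_injective _ (algebraMap F E).injective
  by_contra htop
  have huniq : ∀ {c : E} {f f' : Dual F E}, c ≠ 0 → HasPersp K c f → HasPersp K c f' →
      f c = f' c → f = f' := by
    intro c f f' hc h h' hff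
    by_contra hne
    exact htop (eq_top_of_unitMul_mem_of_transvection hn.ge hE hc (sub_ne_zero.2 hne)
      (by rw [LinearMap.sub_apply, hff, sub_self]) (h.sub_right h' hff))
  have hc : c ≠ 0 := by
    rintro rfl
    simp at hfc
  have hconj : ∀ {u c : E} {f : Dual F E}, u ≠ 0 → HasPersp K c f →
      HasPersp K (u * c) (dualMul f u⁻¹) := by
    intro u c f hu h
    have h1 := h.conj (hE (Units.mk0 u hu))
    have h2 : f ∘ₗ ((unitMul F E (Units.mk0 u hu)).symm : E →ₗ[F] E) = dualMul f u⁻¹ := by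
      ext y; simp
    rwa [h2] at h1
  set φ := dualMul f c with hφdef
  have hφ1 : φ 1 ≠ 0 := by simpa [hφdef] using hfc
  have h1 : HasPersp K 1 φ := by
    have := hconj (inv_ne_zero hc) h
    rwa [inv_mul_cancel₀ hc, inv_inv] at this
  have hφ : φ ≠ 0 := by
    intro h0
    simp [h0] at hφ1
  obtain ⟨z, hz, hzF⟩ : ∃ z, φ z ≠ 0 ∧ z ∉ LinearMap.range (Algebra.linearMap F E) := by
    obtain ⟨z, hz1, hz2⟩ := exists_notMem_of_ne_top (A := LinearMap.ker φ)
      (B := LinearMap.range (Algebra.linearMap F E)) (by rwa [Ne, LinearMap.ker_eq_top]) (by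
        intro htop
        have h2 := LinearMap.finrank_range_le (Algebra.linearMap F E)
        rw [htop, finrank_top, finrank_self] at h2
        omega)
    exact ⟨z, hz1, hz2⟩
  have hz0 : z ≠ 0 := by
    rintro rfl
    simp at hz
  have h2 := hconj hz0 h1
  rw [mul_one] at h2
  obtain ⟨g, hg, hgy⟩ := h2
  have h3 := h1.conj hg
  set x := g 1 with hx
  have hx1 : x = 1 + φ z⁻¹ • z := by rw [hx, hgy]; simp
  have hx0 : x ≠ 0 := by
    rw [hx]
    simp
  have h4 := hconj hx0 h1
  rw [mul_one] at h4
  have h5 := huniq hx0 h3 h4 (by simp [hx])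
  have h7 : ∀ w, φ w = φ (x⁻¹ * w) + φ (z⁻¹ * w) * φ (x⁻¹ * z) := by
    intro w
    have := LinearMap.congr_fun h5 (g w)
    rw [LinearMap.comp_apply, LinearEquiv.coe_coe, LinearEquiv.symm_apply_apply] at this
    rw [this, dualMul_apply, hgy, mul_add, map_add, mul_smul_comm, map_smul, smul_eq_mul]
    rfl
  set b := φ (x⁻¹ * z) with hb
  have h8 : (1 : E) - x⁻¹ - b • z⁻¹ = 0 := by
    by_contra hne
    apply hφ
    ext y
    have := h7 ((1 - x⁻¹ - b • z⁻¹)⁻¹ * y)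
    have e : y = (1 - x⁻¹ - b • z⁻¹) * ((1 - x⁻¹ - b • z⁻¹)⁻¹ * y) := by
      rw [mul_inv_cancel_left₀ hne]
    rw [e]
    generalize (1 - x⁻¹ - b • z⁻¹)⁻¹ * y = w at this
    rw [sub_mul, sub_mul, one_mul, map_sub, map_sub, smul_mul_assoc, map_smul, this]
    simp [mul_comm]
  have h9 : φ z⁻¹ • (z * z) + (-(b * φ z⁻¹)) • z + algebraMap F E (-b) = 0 := by
    have e1 : (x - 1) * z - b • x = 0 := by
      have : x * z * (1 - x⁻¹ - b • z⁻¹) = (x - 1) * z - b • x := by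
        rw [Algebra.smul_def, Algebra.smul_def]
        field_simp
      rw [← this, h8, mul_zero]
    rw [← e1, hx1]
    simp only [Algebra.smul_def, map_mul, map_neg]
    ring
  have hb0 : b ≠ 0 := by
    intro hb0
    rw [hb0, zero_smul, sub_zero, sub_eq_zero, eq_comm, inv_eq_one] at h8
    rw [h8, inv_one, one_mul] at hb
    exact hz (hb.symm.trans hb0)
  have ha0 : φ z⁻¹ ≠ 0 := by
    intro ha0
    rw [ha0] at h9
    simp at h9
    exact hb0 h9
  obtain ⟨t, ht⟩ := exists_algebraMap_eq_of_quadratic hn ha0 h9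
  exact hzF ⟨t, ht⟩

end Homology

section FixedPoints

variable {G : Type*} [Group G]

theorem conjCount_eq_card_fixedBy_mul (K : Subgroup G) (x : G) :
    conjCount K x = Nat.card (MulAction.fixedBy (G ⧸ K) x) * Nat.card K := by
  rw [conjCount, mul_comm, ← Nat.card_prod,
    ← Nat.card_congr (QuotientGroup.preimageMkEquivSubgroupProdSet K _)]
  refine Nat.card_congr (Equiv.subtypeEquivRight fun g => ?_)
  rw [Set.mem_preimage, MulAction.mem_fixedBy, MulAction.Quotient.smul_mk, eq_comm,
    QuotientGroup.eq, smul_eq_mul, mul_assoc]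

theorem card_fixedBy_modEq_index [Finite G] (K : Subgroup G) {x : G} {r : ℕ} (hr : r.Prime)
    (hx : x ^ r = 1) : K.index ≡ Nat.card (MulAction.fixedBy (G ⧸ K) x) [MOD r] := by
  have : Fact r.Prime := ⟨hr⟩
  have hP : IsPGroup r (Subgroup.zpowers x) := by
    rintro ⟨_, k, rfl⟩
    refine ⟨1, Subtype.ext ?_⟩
    change (x ^ k) ^ (r ^ 1) = 1
    rw [pow_one, ← zpow_natCast, zpow_comm, zpow_natCast, hx, one_zpow]
  have h := hP.card_modEq_card_fixedPoints (G ⧸ K)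
  have h2 : MulAction.fixedPoints (Subgroup.zpowers x) (G ⧸ K) = MulAction.fixedBy (G ⧸ K) x := by
    ext y
    rw [MulAction.mem_fixedPoints, MulAction.mem_fixedBy]
    refine ⟨fun h => h ⟨x, Subgroup.mem_zpowers x⟩, fun h => ?_⟩
    rintro ⟨g, hg⟩
    have : Subgroup.zpowers x ≤ MulAction.stabilizer G y := by
      rwa [Subgroup.zpowers_le, MulAction.mem_stabilizer_iff]
    exact this hg
  rwa [h2] at h

end FixedPoints

section Singer

open Module

variable {F E : Type*} [Field F] [Field E] [Algebra F E] [Finite E]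

variable (F E) in
/-- Elements of `E` lying in no proper intermediate field, given as nonroots of the polynomials
`X ^ (q ^ d) - X`. -/
def primitiveSet : Set E :=
  {z | ∀ d, d ∣ finrank F E → d < finrank F E → z ^ (Nat.card F ^ d) ≠ z}

theorem adjoin_eq_top_of_mem_primitiveSet {z : E} (hz : z ∈ primitiveSet F E) :
    Algebra.adjoin F {z} = ⊤ := by
  have : Finite F := Finite.of_injective _ (algebraMap F E).injective
  have hzint : IsIntegral F z := Algebra.IsIntegral.isIntegral z
  set L := IntermediateField.adjoin F {z} with hL
  have hdvd : finrank F L ∣ finrank F E := ⟨finrank L E, (finrank_mul_finrank F L E).symm⟩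
  have hle : ¬ finrank F L < finrank F E := by
    intro hlt
    refine hz _ hdvd hlt ?_
    have : Fintype L := Fintype.ofFinite _
    have h := FiniteField.pow_card (⟨z, IntermediateField.mem_adjoin_simple_self F z⟩ : L)
    rw [← Nat.card_eq_fintype_card, natCard_eq_pow_finrank (K := F)] at h
    exact congrArg Subtype.val h
  have htop : L = ⊤ := by
    apply IntermediateField.eq_of_le_of_finrank_le le_top
    rw [IntermediateField.finrank_top']
    omega
  rw [← IntermediateField.adjoin_simple_toSubalgebra_of_isAlgebraic hzint.isAlgebraic, ← hL, htop]
  rfl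

theorem ncard_pow_eq_le {E : Type*} [Field E] {q d : ℕ} (hq : 1 < q) (hd : d ≠ 0) :
    {z : E | z ^ (q ^ d) = z}.ncard ≤ q ^ d := by
  classical
  have := Polynomial.card_roots' (Polynomial.X ^ (q ^ d) - Polynomial.X : Polynomial E)
  rw [FiniteField.X_pow_card_pow_sub_X_natDegree_eq E hd hq] at this
  refine le_trans ?_ (le_trans (Multiset.toFinset_card_le _) this)
  rw [← Set.ncard_coe_finset]
  refine Set.ncard_le_ncard (fun z hz => ?_) (Finset.finite_toSet _)
  have hz' : z ^ (q ^ d) = z := hz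
  simp [FiniteField.X_pow_card_pow_sub_X_ne_zero E hd hq, hz']

theorem ncard_compl_primitiveSet_le_of_two (hn : finrank F E = 2) :
    (primitiveSet F E)ᶜ.ncard ≤ Nat.card F := by
  have : Finite F := Finite.of_injective _ (algebraMap F E).injective
  have h := ncard_pow_eq_le (E := E) (Finite.one_lt_card (α := F)) one_ne_zero
  rw [pow_one] at h
  refine le_trans (Set.ncard_le_ncard (fun z hz => ?_)) h
  simp only [primitiveSet, hn, Set.mem_compl_iff, Set.mem_ofPred_eq, not_forall, not_not] at hz
  obtain ⟨d, hd, hd2, hz⟩ := hz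
  interval_cases d
  · simp at hd
  · simpa using hz

theorem ncard_compl_primitiveSet_le (hn : 3 ≤ finrank F E) :
    (primitiveSet F E)ᶜ.ncard ≤ Nat.card F ^ (finrank F E - 2) := by
  have : Finite F := Finite.of_injective _ (algebraMap F E).injective
  set q := Nat.card F with hq
  have hq1 : 1 < q := Finite.one_lt_card
  by_cases h5 : finrank F E < 5
  · refine le_trans (Set.ncard_le_ncard (fun z hz => ?_)) (ncard_pow_eq_le (E := E) hq1 (by omega))
    simp only [primitiveSet, Set.mem_compl_iff, Set.mem_ofPred_eq, not_forall, not_not] at hz ⊢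
    obtain ⟨d, hd, hd2, hz⟩ := hz
    obtain h | h : finrank F E = 3 ∨ finrank F E = 4 := by omega
    · rw [h] at hd hd2 ⊢
      interval_cases d <;> omega
    · rw [h] at hd hd2 ⊢
      interval_cases d <;> try first | omega | exact hz
      rw [pow_one] at hz
      change z ^ q ^ 2 = z
      rw [pow_two, pow_mul, hz, hz]
  · set n := finrank F E with hndef
    have hsub : (primitiveSet F E)ᶜ ⊆ ⋃ d ∈ n.properDivisors, {z : E | z ^ (q ^ d) = z} := by
      intro z hz
      simp only [primitiveSet, Set.mem_compl_iff, Set.mem_ofPred_eq, not_forall, not_not] at hz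
      obtain ⟨d, hd, hd2, hz⟩ := hz
      exact Set.mem_biUnion (x := d) (Nat.mem_properDivisors.2 ⟨hd, hd2⟩) hz
    refine le_trans (Set.ncard_le_ncard hsub) ?_
    refine le_trans (Finset.set_ncard_biUnion_le _ _) ?_
    refine le_trans (Finset.sum_le_sum (g := fun d => q ^ d) fun d hd => ncard_pow_eq_le hq1 ?_) ?_
    · exact (Nat.pos_of_mem_properDivisors hd).ne'
    · refine (Nat.geomSum_lt hq1 fun d hd => ?_).le
      obtain ⟨⟨c, hc⟩, hd2⟩ := Nat.mem_properDivisors.1 hd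
      have hc2 : 2 ≤ c := by
        by_contra hlt
        interval_cases c <;> omega
      by_cases h6 : n = 5
      · rw [h6] at hd hd2 ⊢
        have : d ∣ 5 := h6 ▸ ⟨c, hc⟩
        interval_cases d <;> omega
      · have : 2 * d ≤ n := by nlinarith
        omega

theorem apply_aeval_of_intertwine {F E : Type*} [Field F] [Field E] [Algebra F E]
    {k : E →ₗ[F] E} {z₀ z : E} (hk : ∀ w, k (z₀ * w) = z * k w) (P : Polynomial F) : k (Polynomial.aeval z₀ P) = Polynomial.aeval z P * k 1 := by
  have hpow : ∀ i : ℕ, k (z₀ ^ i) = z ^ i * k 1 := by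
    intro i
    induction i with
    | zero => simp
    | succ i ih => rw [pow_succ', hk, ih, pow_succ', mul_assoc]
  induction P using Polynomial.induction_on' with
  | add P Q hP hQ => rw [map_add, map_add, hP, hQ, map_add, add_mul]
  | monomial i a =>
    rw [Polynomial.aeval_monomial, ← Algebra.smul_def, map_smul, hpow, Polynomial.aeval_monomial,
      ← Algebra.smul_def, smul_mul_assoc]

theorem conjCount_mul_ncard_primitiveSet_le (hn : 2 ≤ finrank F E) {K : Subgroup (E ≃ₗ[F] E)} {u : Eˣ}
    (hu : ∀ w : Eˣ, w ∈ Subgroup.zpowers u) :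
    conjCount K (unitMul F E u) * (primitiveSet F E).ncard ≤
      finrank F E * (Nat.card E - 1) * Nat.card K := by
  classical
  have : Finite F := Finite.of_injective _ (algebraMap F E).injective
  have : Finite (E ≃ₗ[F] E) := DFunLike.finite _
  have : Fintype (E ≃ₗ[F] E) := Fintype.ofFinite _
  have := Fintype.ofFinite E
  have hne : ∀ z ∈ primitiveSet F E, z ≠ 0 := by
    rintro z hz rfl
    refine hz 1 (one_dvd _) hn ?_
    simp [Nat.card_pos.ne']
  have hmem : ∀ g : E ≃ₗ[F] E, g⁻¹ * unitMul F E u * g ∈ K →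
      ∀ w : Eˣ, g⁻¹ * unitMul F E w * g ∈ K := by
    intro g hg w
    have : Subgroup.zpowers u ≤ (K.comap (MulAut.conj g⁻¹).toMonoidHom).comap (unitMul F E) := by
      rw [Subgroup.zpowers_le]
      simpa using hg
    simpa using this (hu w)
  let s : Finset ((E ≃ₗ[F] E) × E) := (Finset.univ.filter fun g => g⁻¹ * unitMul F E u * g ∈ K) ×ˢ
    (Finset.univ.filter fun z => z ∈ primitiveSet F E)
  have hs : s.card = conjCount K (unitMul F E u) * (primitiveSet F E).ncard := by
    rw [Finset.card_product, conjCount, Nat.card_eq_fintype_card, Fintype.card_subtype]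
    congr 1
    rw [← Set.ncard_coe_finset]
    simp
  let t : Finset (E →ₗ[F] E) := ((Finset.univ : Finset (E ≃ₗ[F] E)).filter (· ∈ K)).image
    fun g : E ≃ₗ[F] E => (g : E →ₗ[F] E)
  have ht : t.card ≤ Nat.card K := by
    refine le_trans Finset.card_image_le (le_of_eq ?_)
    rw [Nat.card_eq_fintype_card, ← Fintype.card_subtype]
  rw [← hs]
  refine le_trans (Finset.card_le_mul_card_image_of_maps_to
    (f := fun a : (E ≃ₗ[F] E) × E => ((a.1.symm : E →ₗ[F] E) ∘ₗ LinearMap.mulLeft F a.2) ∘ₗ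
      (a.1 : E →ₗ[F] E)) (t := t) ?_ (finrank F E * (Nat.card E - 1)) ?_)
    (Nat.mul_le_mul_left _ ht)
  · rintro ⟨g, z⟩ h
    obtain ⟨hg, hz⟩ := Finset.mem_product.1 h
    have hz' := hne z (Finset.mem_filter.1 hz).2
    refine Finset.mem_image.2 ⟨_, Finset.mem_filter.2 ⟨Finset.mem_univ _,
      hmem g (Finset.mem_filter.1 hg).2 (Units.mk0 z hz')⟩, ?_⟩
    ext y
    change g.symm _ = g.symm _
    simp
  · intro b hb
    rcases Finset.eq_empty_or_nonempty (s.filter fun a => ((a.1.symm : E →ₗ[F] E) ∘ₗ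
      LinearMap.mulLeft F a.2) ∘ₗ (a.1 : E →ₗ[F] E) = b) with h0 | ⟨⟨g₀, z₀⟩, h0⟩
    · rw [h0]; simp
    obtain ⟨h0s, h0b⟩ := Finset.mem_filter.1 h0
    have hz0 : z₀ ∈ primitiveSet F E := (Finset.mem_filter.1 (Finset.mem_product.1 h0s).2).2
    have hzint : IsIntegral F z₀ := Algebra.IsIntegral.isIntegral z₀
    have hkey : ∀ a ∈ (s.filter fun a => ((a.1.symm : E →ₗ[F] E) ∘ₗ
      LinearMap.mulLeft F a.2) ∘ₗ (a.1 : E →ₗ[F] E) = b), ∀ w,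
        ((a.1 : E →ₗ[F] E) ∘ₗ (g₀.symm : E →ₗ[F] E)) (z₀ * w) = a.2 * ((a.1 : E →ₗ[F] E) ∘ₗ (g₀.symm : E →ₗ[F] E)) w := by
      intro a ha w
      have h1 := (Finset.mem_filter.1 ha).2.trans h0b.symm
      have h2 := LinearMap.congr_fun h1 (g₀.symm w)
      simp only [LinearMap.comp_apply, LinearEquiv.coe_coe, LinearMap.mulLeft_apply,
        LinearEquiv.apply_symm_apply] at h2 ⊢
      rw [← h2, LinearEquiv.apply_symm_apply]
    have hne0 : ∀ a : (E ≃ₗ[F] E) × E, ((a.1 : E →ₗ[F] E) ∘ₗ (g₀.symm : E →ₗ[F] E)) 1 ≠ 0 := by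
      intro a
      simp
    have hcard : (((minpoly F z₀).aroots E).toFinset ×ˢ
        (Finset.univ.erase (0 : E))).card ≤ finrank F E * (Nat.card E - 1) := by
      rw [Finset.card_product, Finset.card_erase_of_mem (Finset.mem_univ _), Finset.card_univ,
        Nat.card_eq_fintype_card]
      refine Nat.mul_le_mul_right _ ((Multiset.toFinset_card_le _).trans ?_)
      refine (Polynomial.card_roots' _).trans ?_
      rw [Polynomial.natDegree_map]
      exact minpoly.natDegree_le z₀
    refine le_trans (Finset.card_le_card_of_injOn
      (fun a => (a.2, ((a.1 : E →ₗ[F] E) ∘ₗ (g₀.symm : E →ₗ[F] E)) 1)) ?_ ?_) hcard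
    · intro a ha
      have h1 := apply_aeval_of_intertwine (hkey a ha) (minpoly F z₀)
      rw [minpoly.aeval, map_zero, eq_comm, mul_eq_zero, or_iff_left (hne0 a)] at h1
      rw [Finset.mem_coe, Finset.mem_product, Multiset.mem_toFinset, Polynomial.mem_aroots]
      exact ⟨⟨minpoly.ne_zero hzint, h1⟩, Finset.mem_erase.2 ⟨hne0 a, Finset.mem_univ _⟩⟩
    · rintro ⟨g, z⟩ ha ⟨g', z'⟩ ha' heq
      obtain ⟨h1, h2⟩ := Prod.mk.inj heq
      change z = z' at h1
      subst h1
      have hgg : g = g' := by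
        ext y
        obtain ⟨P, hP⟩ : ∃ P : Polynomial F, Polynomial.aeval z₀ P = g₀ y := by
          have : g₀ y ∈ Algebra.adjoin F {z₀} := by
            rw [adjoin_eq_top_of_mem_primitiveSet hz0]; trivial
          rwa [Algebra.adjoin_singleton_eq_range_aeval] at this
        have e1 := apply_aeval_of_intertwine (hkey _ ha) P
        have e2 := apply_aeval_of_intertwine (hkey _ ha') P
        rw [hP] at e1 e2
        have h3 : ((g : E →ₗ[F] E) ∘ₗ (g₀.symm : E →ₗ[F] E)) (g₀ y) = ((g' : E →ₗ[F] E) ∘ₗ (g₀.symm : E →ₗ[F] E)) (g₀ y) := by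
          rw [e1, e2, h2]
        simpa using h3
      rw [hgg]

theorem card_fixedBy_unitMul_lt (hn : 3 ≤ finrank F E) {K : Subgroup (E ≃ₗ[F] E)} {u : Eˣ}
    (hu : ∀ w : Eˣ, w ∈ Subgroup.zpowers u) :
    Nat.card (MulAction.fixedBy ((E ≃ₗ[F] E) ⧸ K) (unitMul F E u)) * (Nat.card F ^ 2 - 1) <
      finrank F E * Nat.card F ^ 2 := by
  have : Finite F := Finite.of_injective _ (algebraMap F E).injective
  have : Finite (E ≃ₗ[F] E) := DFunLike.finite _
  have h1 := conjCount_mul_ncard_primitiveSet_le (by omega) (K := K) hu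
  have h2 := ncard_compl_primitiveSet_le hn
  have h3 := Set.ncard_add_ncard_compl (primitiveSet F E)
  rw [conjCount_eq_card_fixedBy_mul] at h1
  rw [natCard_eq_pow_finrank (K := F) (V := E)] at h1 h3
  set f := Nat.card (MulAction.fixedBy ((E ≃ₗ[F] E) ⧸ K) (unitMul F E u))
  set q := Nat.card F
  have hq : 1 < q := Finite.one_lt_card
  obtain ⟨n, hn'⟩ : ∃ n, finrank F E = n + 2 := ⟨finrank F E - 2, by omega⟩
  rw [hn'] at h1 h2 h3 ⊢
  rw [Nat.add_sub_cancel] at h2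
  have h4 : f * (primitiveSet F E).ncard ≤ (n + 2) * (q ^ (n + 2) - 1) := by
    refine Nat.le_of_mul_le_mul_right (le_of_eq_of_le ?_ h1) (Nat.card_pos (α := K))
    ring
  have h5 : q ^ n * (q ^ 2 - 1) ≤ (primitiveSet F E).ncard := by
    rw [Nat.mul_sub, ← pow_add, mul_one]
    omega
  have h6 : f * (q ^ n * (q ^ 2 - 1)) ≤ (n + 2) * (q ^ (n + 2) - 1) :=
    le_trans (Nat.mul_le_mul_left _ h5) h4
  have h7 : 0 < q ^ (n + 2) := by positivity
  refine Nat.lt_of_mul_lt_mul_left (a := q ^ n) ?_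
  calc q ^ n * (f * (q ^ 2 - 1)) = f * (q ^ n * (q ^ 2 - 1)) := by ring
    _ ≤ (n + 2) * (q ^ (n + 2) - 1) := h6
    _ < (n + 2) * q ^ (n + 2) := Nat.mul_lt_mul_of_pos_left (by omega) (by omega)
    _ = q ^ n * ((n + 2) * q ^ 2) := by ring

theorem card_fixedBy_unitMul_le_two (hn : finrank F E = 2) (hq : 3 ≤ Nat.card F)
    {K : Subgroup (E ≃ₗ[F] E)} {u : Eˣ} (hu : ∀ w : Eˣ, w ∈ Subgroup.zpowers u) :
    Nat.card (MulAction.fixedBy ((E ≃ₗ[F] E) ⧸ K) (unitMul F E u)) ≤ 2 := by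
  have : Finite F := Finite.of_injective _ (algebraMap F E).injective
  have : Finite (E ≃ₗ[F] E) := DFunLike.finite _
  have h1 := conjCount_mul_ncard_primitiveSet_le (by omega) (K := K) hu
  have h2 := ncard_compl_primitiveSet_le_of_two hn
  have h3 := Set.ncard_add_ncard_compl (primitiveSet F E)
  rw [conjCount_eq_card_fixedBy_mul] at h1
  rw [natCard_eq_pow_finrank (K := F) (V := E), hn] at h1 h3
  set f := Nat.card (MulAction.fixedBy ((E ≃ₗ[F] E) ⧸ K) (unitMul F E u))
  set q := Nat.card F
  have h4 : f * (primitiveSet F E).ncard ≤ 2 * (q ^ 2 - 1) := by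
    refine Nat.le_of_mul_le_mul_right (le_of_eq_of_le ?_ h1) (Nat.card_pos (α := K))
    ring
  by_contra h
  have h5 : 3 * (primitiveSet F E).ncard ≤ 2 * (q ^ 2 - 1) :=
    le_trans (Nat.mul_le_mul_right _ (by omega)) h4
  have : 3 * q ≤ q ^ 2 := by nlinarith
  omega

end Singer

section Burnside

variable {G : Type*} [Group G]

theorem card_fixedBy_eq_of_conj (L : Subgroup G) (g a : G) :
    Nat.card (MulAction.fixedBy (G ⧸ L) (g * a * g⁻¹)) = Nat.card (MulAction.fixedBy (G ⧸ L) a) := by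
  refine (Nat.card_congr ((MulAction.toPerm g).subtypeEquiv fun y => ?_)).symm
  rw [MulAction.mem_fixedBy, MulAction.mem_fixedBy, MulAction.toPerm_apply, smul_smul,
    mul_assoc, mul_assoc, inv_mul_cancel, mul_one, mul_smul, smul_left_cancel_iff]

theorem le_of_index_lt_of_conj [Finite G] {T L : Subgroup G}
    (hT : ∀ a ∈ T, ∀ b ∈ T, a ≠ 1 → b ≠ 1 → ∃ g, g * a * g⁻¹ = b) (hj : L.index < Nat.card T) :
    T ≤ L := by
  classical
  intro a ha
  by_cases ha1 : a = 1
  · rw [ha1]; exact L.one_mem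
  have := Fintype.ofFinite T
  have := Fintype.ofFinite (G ⧸ L)
  have h := MulAction.sum_card_fixedBy_eq_card_orbits_mul_card_group T (G ⧸ L)
  have hc : ∀ t : T, t ∈ Finset.univ.erase (1 : T) → Fintype.card (MulAction.fixedBy (G ⧸ L) t) =
      Nat.card (MulAction.fixedBy (G ⧸ L) a) := by
    intro t ht
    have ht1 : (t : G) ≠ 1 := by simpa using ht
    obtain ⟨g, hg⟩ := hT a ha t t.2 ha1 ht1
    rw [← card_fixedBy_eq_of_conj L g a, hg, Nat.card_eq_fintype_card]
    rfl
  rw [← Finset.add_sum_erase _ _ (Finset.mem_univ (1 : T)), Finset.sum_congr rfl hc,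
    Finset.sum_const, Finset.card_erase_of_mem (Finset.mem_univ _), Finset.card_univ] at h
  have h1 : Fintype.card (MulAction.fixedBy (G ⧸ L) (1 : T)) = L.index := by
    rw [← Nat.card_eq_fintype_card, MulAction.fixedBy_one_eq_univ, Nat.card_univ]
    rfl
  have hle : Nat.card (MulAction.fixedBy (G ⧸ L) a) ≤ L.index := Finite.card_subtype_le _
  rw [h1, ← Nat.card_eq_fintype_card (α := T), smul_eq_mul] at h
  set φ := Nat.card (MulAction.fixedBy (G ⧸ L) a)
  set Q := Nat.card T
  have hdvd : Q ∣ L.index - φ := by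
    have hQ : 0 < Q := Nat.card_pos
    have e : L.index - φ + φ * Q = Fintype.card (Quotient (MulAction.orbitRel T (G ⧸ L))) * Q := by
      rw [← h, Nat.sub_mul, one_mul, mul_comm Q]
      have : φ ≤ φ * Q := Nat.le_mul_of_pos_right _ hQ
      omega
    exact (Nat.dvd_add_left (Dvd.intro_left _ rfl)).1 (e ▸ Dvd.intro_left _ rfl)
  have heq : φ = L.index := by
    have := Nat.eq_zero_of_dvd_of_lt hdvd (by omega)
    omega
  have hmem : ((1 : G) : G ⧸ L) ∈ MulAction.fixedBy (G ⧸ L) a := by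
    have : MulAction.fixedBy (G ⧸ L) a = Set.univ :=
      Set.eq_of_subset_of_ncard_le (Set.subset_univ _) (by
        rw [Set.ncard_univ, ← Nat.card_coe_set_eq]
        exact heq.ge)
    rw [this]; trivial
  rw [MulAction.mem_fixedBy, MulAction.Quotient.smul_mk, eq_comm, QuotientGroup.eq] at hmem
  simpa using hmem

/-- A subgroup meeting all conjugates of `K` trivially has order dividing the index of `K`. -/
theorem card_dvd_index_of_disjoint [Finite G] {P K : Subgroup G}
    (h : ∀ g a : G, a ∈ P → g⁻¹ * a * g ∈ K → a = 1) : Nat.card P ∣ K.index := by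
  classical
  have := Fintype.ofFinite P
  have := Fintype.ofFinite (G ⧸ K)
  have hb := MulAction.sum_card_fixedBy_eq_card_orbits_mul_card_group P (G ⧸ K)
  rw [Finset.sum_eq_single (1 : P)] at hb
  · rw [← Nat.card_eq_fintype_card, ← Nat.card_eq_fintype_card (α := P),
      MulAction.fixedBy_one_eq_univ, Nat.card_univ] at hb
    exact Dvd.intro_left _ hb.symm
  · intro t _ ht
    rw [Fintype.card_eq_zero_iff]
    refine ⟨fun ⟨y, hy⟩ => ht ?_⟩
    obtain ⟨g, rfl⟩ := QuotientGroup.mk_surjective y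
    rw [MulAction.mem_fixedBy] at hy
    have hy' : ((t : G) • (g : G ⧸ K)) = g := hy
    rw [MulAction.Quotient.smul_mk, eq_comm, QuotientGroup.eq, smul_eq_mul, ← mul_assoc] at hy'
    exact Subtype.ext (h g t t.2 hy')
  · simp

end Burnside

section TransvectionGroup

open Module

variable {F V : Type*} [Field F] [AddCommGroup V] [Module F V]

/-- The group of transvections with axis `ker f`. -/
def axisHom (f : Dual F V) : Multiplicative (LinearMap.ker f) →* V ≃ₗ[F] V where
  toFun c := LinearEquiv.ofLinearMap (LinearMap.id + f.smulRight (c.toAdd : V))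
    (LinearMap.id - f.smulRight (c.toAdd : V))
    (by ext y; simp [LinearMap.mem_ker.1 c.toAdd.2])
    (by ext y; simp [LinearMap.mem_ker.1 c.toAdd.2])
  map_one' := by ext y; simp
  map_mul' c c' := by
    ext y
    have := LinearMap.mem_ker.1 c'.toAdd.2
    simp [this]
    abel

theorem axisHom_apply (f : Dual F V) (c : Multiplicative (LinearMap.ker f)) (y : V) :
    axisHom f c y = y + f y • (c.toAdd : V) := rfl

theorem axisHom_injective {f : Dual F V} (hf : f ≠ 0) : Function.Injective (axisHom f) := by
  obtain ⟨y, hy⟩ : ∃ y, f y ≠ 0 := by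
    by_contra! h
    exact hf (LinearMap.ext h)
  intro c c' h
  have := LinearEquiv.congr_fun h y
  rw [axisHom_apply, axisHom_apply, add_right_inj] at this
  exact Multiplicative.toAdd.injective (Subtype.ext (smul_right_injective V hy this))

theorem card_ker_dual [Finite F] [FiniteDimensional F V] {f : Dual F V} (hf : f ≠ 0) :
    Nat.card (LinearMap.ker f) = Nat.card F ^ (finrank F V - 1) := by
  rw [natCard_eq_pow_finrank (K := F)]
  congr 1
  have h1 := f.finrank_range_add_finrank_ker
  have h2 : finrank F (LinearMap.range f) = 1 := by
    rw [LinearMap.range_eq_top.2 (LinearMap.surjective hf), finrank_top, finrank_self]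
  omega

theorem exists_conj_transvection [FiniteDimensional F V] {f : Dual F V} {c c' : V} (hc : c ≠ 0)
    (hc' : c' ≠ 0) (hfc : f c = 0) (hfc' : f c' = 0) :
    ∃ g : V ≃ₗ[F] V, g c = c' ∧ ∀ y, f (g y) = f y := by
  obtain ⟨a, ha, ha'⟩ : ∃ a : Dual F V, a c ≠ 0 ∧ a c' ≠ 0 := by
    obtain ⟨a, h1, h2⟩ := exists_notMem_of_ne_top (V := Dual F V)
      (A := LinearMap.ker (Dual.eval F V c)) (B := LinearMap.ker (Dual.eval F V c')) (by
        rwa [Ne, LinearMap.ker_eq_top, Module.eval_apply_eq_zero_iff]) (by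
        rwa [Ne, LinearMap.ker_eq_top, Module.eval_apply_eq_zero_iff])
    exact ⟨a, h1, h2⟩
  set φ : V →ₗ[F] V := LinearMap.id + ((a c)⁻¹ • a).smulRight (c' - c) with hφ
  have hφy : ∀ y, φ y = y + ((a c)⁻¹ * a y) • (c' - c) := fun y => by simp [hφ]
  have hφc : φ c = c' := by rw [hφy, inv_mul_cancel₀ ha, one_smul]; abel
  have hinj : Function.Injective φ := by
    rw [← LinearMap.ker_eq_bot, LinearMap.ker_eq_bot']
    intro y hy
    have h0 : a y = 0 := by
      have := congrArg a hy
      rw [hφy, map_add, map_smul, map_sub, map_zero, smul_eq_mul, mul_sub] at this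
      have h3 : (a c)⁻¹ * a c' * a y = 0 := by
        rw [← this]; field_simp; ring
      have h4 : (a c)⁻¹ * a c' ≠ 0 := mul_ne_zero (inv_ne_zero ha) ha'
      exact (mul_eq_zero.1 h3).resolve_left h4
    rw [hφy, h0, mul_zero, zero_smul, add_zero] at hy
    exact hy
  refine ⟨LinearEquiv.ofInjectiveEndo φ hinj, hφc, fun y => ?_⟩
  change f (φ y) = f y
  rw [hφy, map_add, map_smul, map_sub, hfc, hfc', sub_zero, smul_zero, add_zero]

theorem hasPersp_of_index_lt [Finite F] [Finite V] {L : Subgroup (V ≃ₗ[F] V)}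
    (hL : L.index < Nat.card F ^ (finrank F V - 1)) (c : V) (f : Dual F V) (hfc : f c = 0) :
    HasPersp L c f := by
  have : Finite (V ≃ₗ[F] V) := DFunLike.finite _
  by_cases hf : f = 0
  · rw [hf]; exact hasPersp_zero_right c
  have hle : (axisHom f).range ≤ L := by
    apply le_of_index_lt_of_conj
    · rintro _ ⟨b, rfl⟩ _ ⟨b', rfl⟩ hb hb'
      have hb0 : (b.toAdd : V) ≠ 0 := by
        intro h0
        exact hb (by ext y; simp [axisHom_apply, h0])
      have hb0' : (b'.toAdd : V) ≠ 0 := by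
        intro h0
        exact hb' (by ext y; simp [axisHom_apply, h0])
      obtain ⟨g, hg, hgf⟩ := exists_conj_transvection hb0 hb0' b.toAdd.2 b'.toAdd.2
      refine ⟨g, ?_⟩
      ext y
      obtain ⟨z, rfl⟩ := g.surjective y
      change g (axisHom f b (g.symm (g z))) = _
      rw [LinearEquiv.symm_apply_apply, axisHom_apply, axisHom_apply, map_add, map_smul, hg, hgf]
    · rw [Nat.card_congr (MonoidHom.ofInjective (axisHom_injective hf)).symm.toEquiv,
        Nat.card_congr Multiplicative.toAdd, card_ker_dual hf]
      exact hL
  exact ⟨axisHom f (Multiplicative.ofAdd ⟨c, hfc⟩), hle ⟨_, rfl⟩, fun y => rfl⟩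

end TransvectionGroup

section PointStabilizer

open Module

variable {F V X : Type*} [Field F] [AddCommGroup V] [Module F V] [AddCommGroup X] [Module F X]

/-- The group induced on `X` by the stabilizer of `v` in `K`, along `π : V → X`. -/
def pointImage (π : V →ₗ[F] X) (v : V) (K : Subgroup (V ≃ₗ[F] V)) : Subgroup (X ≃ₗ[F] X) where
  carrier := {l | ∃ k ∈ K, k v = v ∧ ∀ y, l (π y) = π (k y)}
  one_mem' := ⟨1, K.one_mem, rfl, fun _ => rfl⟩
  mul_mem' := by
    rintro l l' ⟨k, hk, hkv, hl⟩ ⟨k', hk', hkv', hl'⟩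
    refine ⟨k * k', K.mul_mem hk hk', ?_, fun y => ?_⟩
    · rw [LinearEquiv.mul_apply, hkv', hkv]
    · rw [LinearEquiv.mul_apply, LinearEquiv.mul_apply, hl', hl]
  inv_mem' := by
    rintro l ⟨k, hk, hkv, hl⟩
    refine ⟨k⁻¹, K.inv_mem hk, ?_, fun y => ?_⟩
    · change k.symm v = v
      rw [LinearEquiv.symm_apply_eq, hkv]
    · change l.symm (π y) = π (k.symm y)
      rw [LinearEquiv.symm_apply_eq, hl, LinearEquiv.apply_symm_apply]

variable {π : V →ₗ[F] X} {v : V} {K : Subgroup (V ≃ₗ[F] V)}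

theorem exists_descend (hπ : Function.Surjective π) (hker : LinearMap.ker π = F ∙ v)
    {g : V ≃ₗ[F] V} (hg : g v = v) : ∃ l : X ≃ₗ[F] X, ∀ y, l (π y) = π (g y) := by
  have hmap : (LinearMap.ker π).map (g : V →ₗ[F] V) = LinearMap.ker π := by
    rw [hker, Submodule.map_span, Set.image_singleton, LinearEquiv.coe_coe, hg]
  refine ⟨(π.quotKerEquivOfSurjective hπ).symm ≪≫ₗ Submodule.Quotient.equiv _ _ g hmap ≪≫ₗ
    π.quotKerEquivOfSurjective hπ, fun y => ?_⟩
  have : (π.quotKerEquivOfSurjective hπ).symm (π y) = Submodule.Quotient.mk y := by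
    rw [LinearEquiv.symm_apply_eq, LinearMap.quotKerEquivOfSurjective_apply_mk]
  simp only [LinearEquiv.trans_apply, this, Submodule.Quotient.equiv_apply, Submodule.mapQ_apply]
  exact LinearMap.quotKerEquivOfSurjective_apply_mk _ _ _

theorem exists_dual_eq_smul (hker : LinearMap.ker π = F ∙ v) (hv : v ≠ 0) {φ : V →ₗ[F] V}
    (hφ : ∀ y, π (φ y) = 0) : ∃ f : Dual F V, ∀ y, φ y = f y • v := by
  have hmem : ∀ y, φ y ∈ F ∙ v := fun y => by rw [← hker]; exact hφ y
  refine ⟨(LinearEquiv.toSpanNonzeroSingleton F V v hv).symm.toLinearMap ∘ₗ φ.codRestrict _ hmem,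
    fun y => ?_⟩
  have := LinearEquiv.toSpanNonzeroSingleton_apply F V v hv
    ((LinearEquiv.toSpanNonzeroSingleton F V v hv).symm (φ.codRestrict _ hmem y))
  rw [LinearEquiv.apply_symm_apply] at this
  exact congrArg Subtype.val this

/-- `K` contains no nontrivial transvection. -/
def TransvectionFree (K : Subgroup (V ≃ₗ[F] V)) : Prop :=
  ∀ c f, c ≠ 0 → f c = 0 → HasPersp K c f → f = 0

theorem TransvectionFree.eq_one (hK : TransvectionFree K) (hker : LinearMap.ker π = F ∙ v)
    (hv : v ≠ 0) {k : V ≃ₗ[F] V} (hk : k ∈ K) (hkv : k v = v) (hkπ : ∀ y, π (k y) = π y) :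
    k = 1 := by
  obtain ⟨f, hf⟩ := exists_dual_eq_smul hker hv (φ := (k : V →ₗ[F] V) - LinearMap.id) (fun y => by
    simp [hkπ])
  have hfy : ∀ y, k y = y + f y • v := fun y => by
    rw [← hf]; simp
  have hfv : f v = 0 := by
    have := hfy v
    rw [hkv, left_eq_add, smul_eq_zero] at this
    exact this.resolve_right hv
  have := hK v f hv hfv ⟨k, hk, hfy⟩
  ext y
  rw [hfy, this]
  simp

theorem TransvectionFree.eq_of_descend (hK : TransvectionFree K) (hker : LinearMap.ker π = F ∙ v)
    (hv : v ≠ 0) {k k' : V ≃ₗ[F] V} (hk : k ∈ K) (hk' : k' ∈ K) (hkv : k v = v) (hkv' : k' v = v)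
    (h : ∀ y, π (k y) = π (k' y)) : k = k' := by
  have : k'⁻¹ * k = 1 := by
    refine hK.eq_one hker hv (K.mul_mem (K.inv_mem hk') hk) ?_ fun y => ?_
    · change k'.symm (k v) = v
      rw [hkv, LinearEquiv.symm_apply_eq, hkv']
    · change π (k'.symm (k y)) = π y
      have hsub : k y - k' y ∈ F ∙ v := by
        rw [← hker, LinearMap.mem_ker, map_sub, h, sub_self]
      obtain ⟨r, hr⟩ := Submodule.mem_span_singleton.1 hsub
      have e : k'.symm (k y) = y + r • v := by
        rw [LinearEquiv.symm_apply_eq, map_add, map_smul, hkv', hr]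
        abel
      have hπv : π v = 0 := by
        rw [← LinearMap.mem_ker, hker]; exact Submodule.mem_span_singleton_self v
      rw [e, map_add, map_smul, hπv, smul_zero, add_zero]
  exact (inv_mul_eq_one.1 this).symm

theorem TransvectionFree.card_pointImage (hK : TransvectionFree K) (hπ : Function.Surjective π)
    (hker : LinearMap.ker π = F ∙ v) (hv : v ≠ 0) :
    Nat.card (pointImage π v K) = Nat.card {k : V ≃ₗ[F] V // k ∈ K ∧ k v = v} := by
  have hex : ∀ k : {k : V ≃ₗ[F] V // k ∈ K ∧ k v = v}, ∃ l : X ≃ₗ[F] X, ∀ y, l (π y) = π (k.1 y) :=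
    fun k => exists_descend hπ hker k.2.2
  choose d hd using hex
  refine (Nat.card_eq_of_bijective (fun k => (⟨d k, k.1, k.2.1, k.2.2, hd k⟩ : pointImage π v K))
    ⟨fun k k' h => ?_, ?_⟩).symm
  · refine Subtype.ext (hK.eq_of_descend hker hv k.2.1 k'.2.1 k.2.2 k'.2.2 fun y => ?_)
    rw [← hd, ← hd]
    exact LinearEquiv.congr_fun (congrArg Subtype.val h) (π y)
  · rintro ⟨l, k, hk, hkv, hl⟩
    refine ⟨⟨k, hk, hkv⟩, Subtype.ext ?_⟩
    ext y
    obtain ⟨z, rfl⟩ := hπ y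
    change d _ (π z) = l (π z)
    rw [hd, hl]

theorem card_eq_of_transitive [Finite V] (hv : v ≠ 0)
    (htrans : ∀ w : V, w ≠ 0 → ∃ k ∈ K, k v = w) :
    Nat.card K = (Nat.card V - 1) * Nat.card {k : V ≃ₗ[F] V // k ∈ K ∧ k v = v} := by
  have h := Nat.card_congr (MulAction.orbitProdStabilizerEquivGroup K v)
  rw [← h, Nat.card_prod]
  congr 1
  · have : MulAction.orbit K v = {0}ᶜ := by
      ext w
      rw [MulAction.mem_orbit_iff, Set.mem_compl_iff, Set.mem_singleton_iff]
      constructor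
      · rintro ⟨k, rfl⟩ h0
        exact hv (k.1.map_eq_zero_iff.1 h0)
      · intro hw
        obtain ⟨k, hk, hkv⟩ := htrans w hw
        exact ⟨⟨k, hk⟩, hkv⟩
    rw [this, Nat.card_coe_set_eq, Set.ncard_compl, Set.ncard_singleton]
  · exact Nat.card_congr
      { toFun := fun k => ⟨k.1.1, k.1.2, k.2⟩
        invFun := fun k => ⟨⟨k.1, k.2.1⟩, k.2.2⟩
        left_inv := fun _ => rfl
        right_inv := fun _ => rfl }

theorem card_linearEquiv [Finite F] [Finite V] :
    Nat.card (V ≃ₗ[F] V) = ∏ i ∈ Finset.range (finrank F V),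
      (Nat.card F ^ finrank F V - Nat.card F ^ i) := by
  have := Fintype.ofFinite F
  have hfin : FiniteDimensional F V := inferInstance
  rw [← Fin.prod_univ_eq_prod_range (fun i => Nat.card F ^ finrank F V - Nat.card F ^ i),
    Nat.card_eq_fintype_card (α := F), ← Matrix.card_GL_field]
  exact Nat.card_congr ((LinearMap.GeneralLinearGroup.generalLinearEquiv F V).symm.toEquiv.trans
    (Units.mapEquiv (LinearMap.toMatrixAlgEquiv (finBasis F V)).toMulEquiv).toEquiv)

theorem card_linearEquiv_eq [Finite F] [Finite V] [Finite X]
    (hX : finrank F V = finrank F X + 1) :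
    Nat.card (V ≃ₗ[F] V) = (Nat.card V - 1) * Nat.card F ^ finrank F X * Nat.card (X ≃ₗ[F] X) := by
  rw [card_linearEquiv, card_linearEquiv, natCard_eq_pow_finrank (K := F) (V := V), hX,
    Finset.prod_range_succ', mul_comm, pow_zero, mul_assoc]
  congr 1
  have e : Nat.card F ^ finrank F X = ∏ _i ∈ Finset.range (finrank F X), Nat.card F := by simp
  rw [e, ← Finset.prod_mul_distrib]
  refine Finset.prod_congr rfl fun i _ => ?_
  rw [← e, Nat.mul_sub, ← pow_succ', ← pow_succ']

theorem TransvectionFree.index_eq [Finite F] [Finite V] [Finite X] (hK : TransvectionFree K)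
    (hπ : Function.Surjective π) (hker : LinearMap.ker π = F ∙ v) (hv : v ≠ 0)
    (htrans : ∀ w : V, w ≠ 0 → ∃ k ∈ K, k v = w) :
    K.index = Nat.card F ^ finrank F X * (pointImage π v K).index := by
  have : Finite (V ≃ₗ[F] V) := DFunLike.finite _
  have : Finite (X ≃ₗ[F] X) := DFunLike.finite _
  have hX : finrank F V = finrank F X + 1 := by
    have h1 := π.finrank_range_add_finrank_ker
    rw [hker, finrank_span_singleton hv, LinearMap.range_eq_top.2 hπ, finrank_top] at h1
    omega
  have h1 := K.index_mul_card
  have h2 := (pointImage π v K).index_mul_card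
  rw [card_linearEquiv_eq hX, ← h2, card_eq_of_transitive hv htrans,
    ← hK.card_pointImage hπ hker hv] at h1
  have hpos : 0 < (Nat.card V - 1) * Nat.card (pointImage π v K) := by
    refine Nat.mul_pos ?_ Nat.card_pos
    have : Nontrivial V := ⟨v, 0, hv⟩
    have := Finite.one_lt_card (α := V)
    omega
  refine Nat.eq_of_mul_eq_mul_right hpos (h1.trans ?_)
  ring

end PointStabilizer

section Lifts

open Module

variable {F V X : Type*} [Field F] [AddCommGroup V] [Module F V] [AddCommGroup X] [Module F X]

/-- `K` contains an element inducing on the quotient by `v` the transvection given by `c`, `a`. -/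
def HasLift (K : Subgroup (V ≃ₗ[F] V)) (v c : V) (a f : Dual F V) : Prop :=
  ∃ g ∈ K, ∀ y, g y = y + a y • c + f y • v

variable {π : V →ₗ[F] X} {v : V} {K : Subgroup (V ≃ₗ[F] V)}

theorem exists_hasLift (hker : LinearMap.ker π = F ∙ v) (hv : v ≠ 0) {c : V} {a : Dual F X}
    (h : HasPersp (pointImage π v K) (π c) a) :
    ∃ f : Dual F V, f v = 0 ∧ HasLift K v c (a ∘ₗ π) f := by
  obtain ⟨l, ⟨k, hk, hkv, hlk⟩, hl⟩ := h
  obtain ⟨f, hf⟩ := exists_dual_eq_smul hker hv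
    (φ := (k : V →ₗ[F] V) - LinearMap.id - (a ∘ₗ π).smulRight c) (fun y => by
      simp [← hlk, hl])
  have hky : ∀ y, k y = y + (a ∘ₗ π) y • c + f y • v := fun y => by
    rw [← hf]
    simp
  refine ⟨f, ?_, k, hk, hky⟩
  have hπv : π v = 0 := by
    rw [← LinearMap.mem_ker, hker]; exact Submodule.mem_span_singleton_self v
  have := hky v
  rw [hkv, LinearMap.comp_apply, hπv, map_zero, zero_smul, add_zero, left_eq_add,
    smul_eq_zero] at this
  exact this.resolve_right hv

theorem exists_dual_comp_eq (hπ : Function.Surjective π) (hker : LinearMap.ker π = F ∙ v)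
    {f : Dual F V} (hfv : f v = 0) : ∃ b : Dual F X, b ∘ₗ π = f := by
  obtain ⟨s, hs⟩ := π.exists_rightInverse_of_surjective (LinearMap.range_eq_top.2 hπ)
  refine ⟨f ∘ₗ s, LinearMap.ext fun y => ?_⟩
  have : s (π y) - y ∈ F ∙ v := by
    rw [← hker, LinearMap.mem_ker, map_sub, sub_eq_zero]
    exact LinearMap.congr_fun hs (π y)
  obtain ⟨t, ht⟩ := Submodule.mem_span_singleton.1 this
  have e : s (π y) = y + t • v := by rw [ht]; abel
  simp [e, hfv]

theorem HasLift.commutator {c c' : V} {a a' f f' : Dual F V} (h : HasLift K v c a f)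
    (h' : HasLift K v c' a' f') (hav : a v = 0) (hfv : f v = 0) (hav' : a' v = 0)
    (hfv' : f' v = 0) (hac' : a c' = 0) (hac2 : a' c = 0) :
    HasPersp K v (f c' • a' - f' c • a) := by
  obtain ⟨g, hg, hgy⟩ := h
  obtain ⟨g', hg', hgy'⟩ := h'
  refine ⟨(g' * g)⁻¹ * (g * g'), K.mul_mem (K.inv_mem (K.mul_mem hg' hg)) (K.mul_mem hg hg'),
    fun y => ?_⟩
  change (g' * g).symm (g (g' y)) = _
  rw [LinearEquiv.symm_apply_eq]
  change _ = g' (g _)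
  simp only [hgy, hgy', map_add, map_smul, LinearMap.sub_apply, LinearMap.smul_apply, hav, hfv,
    hav', hfv', hac', hac2, smul_eq_mul]
  module

theorem HasLift.mul_same {c c' : V} {a f f' : Dual F V} (h : HasLift K v c a f)
    (h' : HasLift K v c' a f') (hav : a v = 0) (hfv : f v = 0) (hac' : a c' = 0) :
    HasLift K v (c + c') a (f + f' + f c' • a) := by
  obtain ⟨g, hg, hgy⟩ := h
  obtain ⟨g', hg', hgy'⟩ := h'
  refine ⟨g * g', K.mul_mem hg hg', fun y => ?_⟩
  rw [LinearEquiv.mul_apply]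
  simp only [hgy, hgy', map_add, map_smul, LinearMap.add_apply, LinearMap.smul_apply, hav, hfv,
    hac', smul_eq_mul]
  module

theorem exists_dual_notMem_span [FiniteDimensional F V] {W : Submodule F V}
    (hW : finrank F W + 2 ≤ finrank F V) (a : Dual F V) :
    ∃ a' : Dual F V, (∀ w ∈ W, a' w = 0) ∧ a' ∉ F ∙ a := by
  by_contra! h
  have hle : W.dualAnnihilator ≤ F ∙ a := fun a' ha' =>
    h a' fun w hw => (Submodule.mem_dualAnnihilator a').1 ha' w hw
  have h1 := Submodule.finrank_mono hle
  have h2 := Subspace.finrank_add_finrank_dualAnnihilator_eq W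
  have h3 := finrank_span_le_card (R := F) ({a} : Set (Dual F V))
  simp only [Set.toFinset_singleton, Finset.card_singleton] at h3
  omega

theorem finrank_span_pair_le (v c : V) : finrank F (Submodule.span F {v, c}) ≤ 2 := by
  classical
  have := finrank_span_finset_le_card (R := F) ({v, c} : Finset V)
  rw [Finset.coe_pair] at this
  exact this.trans Finset.card_le_two

theorem finrank_span_triple_le (v c c' : V) : finrank F (Submodule.span F {v, c, c'}) ≤ 3 := by
  classical
  have := finrank_span_finset_le_card (R := F) ({v, c, c'} : Finset V)
  rw [Finset.coe_insert, Finset.coe_pair] at this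
  exact this.trans Finset.card_le_three

theorem TransvectionFree.hasLift_apply_eq_zero [FiniteDimensional F V] (hK : TransvectionFree K)
    (hv : v ≠ 0) (hlift : ∀ c a, a v = 0 → a c = 0 → ∃ f : Dual F V, f v = 0 ∧ HasLift K v c a f)
    {c c' : V} {a f : Dual F V} (hav : a v = 0) (hac' : a c' = 0)
    (hfv : f v = 0) (h : HasLift K v c a f)
    (hW : finrank F (Submodule.span F {v, c, c'}) + 2 ≤ finrank F V) : f c' = 0 := by
  by_contra hf
  obtain ⟨a', ha', hsp⟩ := exists_dual_notMem_span hW a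
  have hav' := ha' v (Submodule.subset_span (by simp))
  have hac2 := ha' c (Submodule.subset_span (by simp))
  obtain ⟨f', hfv', h'⟩ := hlift c' a' hav' (ha' c' (Submodule.subset_span (by simp)))
  have h0 := hK v _ hv (by simp [hav, hav'])
    (h.commutator h' hav hfv hav' hfv' hac' hac2)
  refine hsp (Submodule.mem_span_singleton.2 ⟨(f c')⁻¹ * f' c, ?_⟩)
  rw [sub_eq_zero] at h0
  rw [mul_smul, ← h0, smul_smul, inv_mul_cancel₀ hf, one_smul]

theorem TransvectionFree.false_of_hasLift [FiniteDimensional F V] (hK : TransvectionFree K)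
    (hv : v ≠ 0) (hlift : ∀ c a, a v = 0 → a c = 0 → ∃ f : Dual F V, f v = 0 ∧ HasLift K v c a f)
    (hn : 5 ≤ finrank F V ∨ finrank F V = 4 ∧ (2 : F) ≠ 0) : False := by
  obtain ⟨c, hc⟩ : ∃ c, c ∉ F ∙ v := by
    by_contra! h
    have := finrank_span_le_card (R := F) ({v} : Set V)
    rw [Submodule.eq_top_iff'.2 h, finrank_top] at this
    simp at this
    omega
  obtain ⟨a, ha, hsp⟩ := exists_dual_notMem_span (W := Submodule.span F {v, c}) (by
    have := finrank_span_pair_le (F := F) v c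
    omega) (0 : Dual F V)
  have hav := ha v (Submodule.subset_span (by simp))
  have hac := ha c (Submodule.subset_span (by simp))
  have ha0 : a ≠ 0 := by
    rintro rfl
    exact hsp (Submodule.zero_mem _)
  obtain ⟨f, hfv, hf⟩ := hlift c a hav hac
  have hzero : ∀ c', a c' = 0 → f c' = 0 := by
    intro c' hac'
    rcases hn with h5 | ⟨h4, h2⟩
    · refine hK.hasLift_apply_eq_zero hv hlift hav hac' hfv hf ?_
      have := finrank_span_triple_le (F := F) v c c'
      omega
    · have hself : ∀ (c : V) (f : Dual F V), a c = 0 → f v = 0 → HasLift K v c a f → f c = 0 := by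
        intro c f hac hfv h
        refine hK.hasLift_apply_eq_zero hv hlift hav hac hfv h ?_
        have := finrank_span_pair_le (F := F) v c
        rw [Set.pair_eq_singleton c]
        omega
      obtain ⟨f', hfv', hf'⟩ := hlift c' a hav hac'
      have h1 := hK v _ hv (by simp [hav]) (hf.commutator hf' hav hfv hav hfv' hac' hac)
      replace h1 := smul_left_injective F ha0 (sub_eq_zero.1 h1)
      change f c' = f' c at h1
      have h2' := hself _ _ (by rw [map_add, hac, hac', add_zero])
        (by simp [hfv, hfv', hav]) (hf.mul_same hf' hav hfv hac')
      simp only [LinearMap.add_apply, map_add, LinearMap.smul_apply, hac, hac', hself c f hac hfv hf,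
        hself c' f' hac' hfv' hf', ← h1, smul_zero, add_zero, zero_add] at h2'
      rw [← two_mul] at h2'
      exact (mul_eq_zero.1 h2').resolve_left h2
  obtain ⟨e, he⟩ := LinearMap.surjective ha0 1
  obtain ⟨g, hg, hgy⟩ := hf
  refine ha0 (hK (c + f e • v) a ?_ (by simp [hac, hav]) ⟨g, hg, fun y => ?_⟩)
  · intro h0
    refine hc (Submodule.mem_span_singleton.2 ⟨-f e, ?_⟩)
    rw [neg_smul, eq_comm]
    exact eq_neg_of_add_eq_zero_left h0
  · have hfy : f y = a y * f e := by
      have := hzero (y - a y • e) (by simp [he])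
      rwa [map_sub, map_smul, sub_eq_zero] at this
    rw [hgy, hfy]
    module

/-- If the group induced at `v` contains a transvection commuting with an element `τ` without
nonzero invariant functional, then the transvection lifts. -/
theorem TransvectionFree.eq_zero_of_commute (hK : TransvectionFree K)
    (hπ : Function.Surjective π) (hker : LinearMap.ker π = F ∙ v) (hv : v ≠ 0) {c : X}
    {a : Dual F X} (hc : c ≠ 0) (hac : a c = 0) (h : HasPersp (pointImage π v K) c a)
    {τ : X ≃ₗ[F] X} (hτ : τ ∈ pointImage π v K) {r : F} (hr : r ≠ 1) (hτc : τ c = r • c)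
    (hτa : ∀ y, a (τ y) = r • a y) (hτ1 : ∀ b : Dual F X, (∀ y, b (τ y) = b y) → b = 0) :
    a = 0 := by
  have hπv : π v = 0 := by
    rw [← LinearMap.mem_ker, hker]; exact Submodule.mem_span_singleton_self v
  obtain ⟨k, hk, hkv, hkπ⟩ := hτ
  obtain ⟨c₁, hc₁⟩ := hπ c
  obtain ⟨γ, hγ⟩ : ∃ γ : F, γ • v = k c₁ - r • c₁ := by
    apply Submodule.mem_span_singleton.1
    rw [← hker, LinearMap.mem_ker, map_sub, ← hkπ, hc₁, hτc, map_smul, hc₁, sub_self]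
  obtain ⟨c₂, hc₂, hkc⟩ : ∃ c₂, π c₂ = c ∧ k c₂ = r • c₂ := by
    have hr' : r - 1 ≠ 0 := sub_ne_zero.2 hr
    refine ⟨c₁ + (γ / (r - 1)) • v, by simp [hc₁, hπv], ?_⟩
    have e : k c₁ = r • c₁ + γ • v := by rw [hγ]; abel
    rw [map_add, map_smul, hkv, e]
    have e2 : γ = (r - 1) * (γ / (r - 1)) := by field_simp
    nth_rw 1 [e2]
    module
  subst hc₂
  obtain ⟨f, hfv, g, hg, hgy⟩ := exists_hasLift hker hv h
  have hgv : g v = v := by simp [hgy, hπv, hfv]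
  have hcomm : k * g = g * k := by
    refine hK.eq_of_descend hker hv (K.mul_mem hk hg) (K.mul_mem hg hk) ?_ ?_ fun y => ?_
    · rw [LinearEquiv.mul_apply, hgv, hkv]
    · rw [LinearEquiv.mul_apply, hkv, hgv]
    · simp only [LinearEquiv.mul_apply, hgy, map_add, map_smul, hπv, hkv, hkc, ← hkπ,
        LinearMap.comp_apply, hτa, smul_zero, add_zero]
      rw [smul_assoc, smul_comm r]
  have hfk : ∀ y, f (k y) = f y := by
    intro y
    have := LinearEquiv.congr_fun hcomm y
    simp only [LinearEquiv.mul_apply, hgy, map_add, map_smul, hkv, hkc, LinearMap.comp_apply,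
      ← hkπ, hτa] at this
    rw [smul_assoc, smul_comm r, add_right_inj, ] at this
    exact ((smul_left_injective F hv) this).symm
  obtain ⟨b, hb⟩ := exists_dual_comp_eq hπ hker hfv
  have hb0 : b = 0 := by
    refine hτ1 b fun y => ?_
    obtain ⟨z, rfl⟩ := hπ y
    rw [hkπ, ← LinearMap.comp_apply, ← LinearMap.comp_apply, hb, hfk]
  have hf0 : f = 0 := by rw [← hb, hb0, LinearMap.zero_comp]
  have := hK c₂ (a ∘ₗ π) (by rintro rfl; simp at hc) hac ⟨g, hg, fun y => by rw [hgy, hf0]; simp⟩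
  ext y
  obtain ⟨z, rfl⟩ := hπ y
  exact LinearMap.congr_fun this z

end Lifts

section PointImageIndex

open Module

variable {F V X : Type*} [Field F] [AddCommGroup V] [Module F V] [AddCommGroup X] [Module F X]

variable {π : V →ₗ[F] X} {v : V} {K : Subgroup (V ≃ₗ[F] V)}

theorem finrank_eq_of_ker [FiniteDimensional F V] (hπ : Function.Surjective π)
    (hker : LinearMap.ker π = F ∙ v) (hv : v ≠ 0) : finrank F V = finrank F X + 1 := by
  have h1 := π.finrank_range_add_finrank_ker
  rw [hker, finrank_span_singleton hv, LinearMap.range_eq_top.2 hπ, finrank_top] at h1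
  omega

/-- The diagonal map with entries `d` in the basis `b`. -/
theorem exists_diagonal {ι : Type*} [Fintype ι] [DecidableEq ι] (b : Basis ι F X) (d : ι → F)
    (hd : ∀ i, d i ≠ 0) : ∃ τ : X ≃ₗ[F] X, (∀ i, τ (b i) = d i • b i) ∧
      LinearMap.det (τ : X →ₗ[F] X) = ∏ i, d i := by
  have hu : IsUnit (LinearMap.toMatrix b b (Matrix.toLin b b (Matrix.diagonal d))).det := by
    rw [LinearMap.toMatrix_toLin, Matrix.det_diagonal, isUnit_iff_ne_zero]
    exact Finset.prod_ne_zero_iff.2 fun i _ => hd i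
  refine ⟨LinearEquiv.ofIsUnitDet hu, fun i => ?_, ?_⟩
  · rw [LinearEquiv.ofIsUnitDet_apply, Matrix.toLin_self]
    rw [Finset.sum_eq_single i]
    · rw [Matrix.diagonal_apply_eq]
    · intro j _ hj
      rw [Matrix.diagonal_apply_ne _ hj, zero_smul]
    · simp
  · rw [LinearEquiv.coe_ofIsUnitDet, LinearMap.det_toLin, Matrix.det_diagonal]

theorem TransvectionFree.pow_le_index_pointImage [Finite F] [Finite V] [Finite X]
    (hK : TransvectionFree K) (hπ : Function.Surjective π) (hker : LinearMap.ker π = F ∙ v)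
    (hv : v ≠ 0) (hn : 3 ≤ finrank F X) (h42 : finrank F X = 3 → Nat.card F ≠ 2) :
    Nat.card F ^ (finrank F X - 1) ≤ (pointImage π v K).index := by
  by_contra! hlt
  have hV := finrank_eq_of_ker hπ hker hv
  have hL := hasPersp_of_index_lt hlt
  by_cases hcase : 5 ≤ finrank F V ∨ finrank F V = 4 ∧ (2 : F) ≠ 0
  · refine hK.false_of_hasLift hv (fun c a hav hac => ?_) hcase
    obtain ⟨b, rfl⟩ := exists_dual_comp_eq hπ hker hav
    exact exists_hasLift hker hv (hL _ _ hac)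
  · have hX : finrank F X = 3 := by omega
    have h2 : (2 : F) = 0 := by
      by_contra h2
      exact hcase (Or.inr ⟨by omega, h2⟩)
    classical
    have := Fintype.ofFinite F
    obtain ⟨r, hr⟩ : ∃ r : F, r ∉ ({0, 1} : Finset F) := by
      by_contra! h
      have h3 := Finset.card_le_card (fun x _ => h x : Finset.univ ⊆ ({0, 1} : Finset F))
      rw [Finset.card_univ, ← Nat.card_eq_fintype_card] at h3
      have h4 := Finset.card_le_two (a := (0 : F)) (b := 1)
      have h5 := Finite.one_lt_card (α := F)
      exact h42 hX (by omega)
    simp only [Finset.mem_insert, Finset.mem_singleton, not_or] at hr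
    obtain ⟨hr0, hr1⟩ := hr
    have hrr : (r * r)⁻¹ ≠ 1 := by
      intro h
      rw [inv_eq_one] at h
      have : (r - 1) * (r - 1) = 0 := by linear_combination h - (r - 1) * h2
      exact hr1 (sub_eq_zero.1 (mul_self_eq_zero.1 this))
    let b := finBasisOfFinrankEq F X hX
    obtain ⟨τ, hτ, hdet⟩ := exists_diagonal b ![r, (r * r)⁻¹, r] (by
      intro i
      fin_cases i <;> simp [hr0])
    have hτL : τ ∈ pointImage π v K := by
      refine mem_of_det_eq_one hL ?_
      rw [hdet, Fin.prod_univ_three]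
      simp
      field_simp
    have hac : b.coord 2 (b 0) = 0 := by simp
    have ha0 := hK.eq_zero_of_commute hπ hker hv (b.ne_zero 0) hac (hL _ _ hac) hτL hr1
      (by rw [hτ]; simp) (fun y => ?_) (fun f hf => ?_)
    · have := LinearMap.congr_fun ha0 (b 2)
      simp at this
    · have : b.coord 2 ∘ₗ (τ : X →ₗ[F] X) = r • b.coord 2 := by
        refine b.ext fun i => ?_
        rw [LinearMap.comp_apply, LinearEquiv.coe_coe, hτ]
        fin_cases i <;> simp
      exact LinearMap.congr_fun this y
    · refine b.ext fun i => ?_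
      have h1 := hf (b i)
      rw [hτ, map_smul, smul_eq_mul] at h1
      have h3 : (![r, (r * r)⁻¹, r] i - 1) * f (b i) = 0 := by rw [sub_mul, h1]; ring
      refine (mul_eq_zero.1 h3).resolve_left (sub_ne_zero.2 ?_)
      fin_cases i
      · exact hr1
      · exact hrr
      · exact hr1

theorem TransvectionFree.pointImage_ne_top [Finite F] [Finite V] [Finite X]
    (hK : TransvectionFree K) (hπ : Function.Surjective π) (hker : LinearMap.ker π = F ∙ v)
    (hv : v ≠ 0) (hX : 2 ≤ finrank F X) (hq : 3 ≤ Nat.card F) : pointImage π v K ≠ ⊤ := by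
  intro htop
  classical
  have := Fintype.ofFinite F
  obtain ⟨r, hr⟩ : ∃ r : F, r ∉ ({0, 1} : Finset F) := by
    by_contra! h
    have h3 := Finset.card_le_card (fun x _ => h x : Finset.univ ⊆ ({0, 1} : Finset F))
    rw [Finset.card_univ, ← Nat.card_eq_fintype_card] at h3
    have h4 := Finset.card_le_two (a := (0 : F)) (b := 1)
    omega
  simp only [Finset.mem_insert, Finset.mem_singleton, not_or] at hr
  obtain ⟨hr0, hr1⟩ := hr
  have : Nontrivial X := nontrivial_of_finrank_pos (R := F) (by omega)
  obtain ⟨c, hc⟩ := exists_ne (0 : X)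
  have hle := finrank_span_le_card (R := F) ({c} : Set X)
  simp only [Set.toFinset_singleton, Finset.card_singleton] at hle
  obtain ⟨y, hy⟩ : ∃ y, y ∉ F ∙ c := by
    by_contra! h
    rw [Submodule.eq_top_iff'.2 h, finrank_top] at hle
    omega
  obtain ⟨a, hay, hac⟩ := exists_dual_apply_eq_one hy
  replace hac := hac c (Submodule.mem_span_singleton_self c)
  have := hK.eq_zero_of_commute hπ hker hv hc hac
    ⟨axisHom a (Multiplicative.ofAdd ⟨c, hac⟩), htop ▸ Subgroup.mem_top _, fun y => rfl⟩
    (τ := LinearEquiv.smulOfNeZero F X r hr0) (htop ▸ Subgroup.mem_top _) hr1 rfl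
    (fun y => by simp) (fun f hf => by
      ext y
      have h1 := hf y
      rw [LinearEquiv.smulOfNeZero_apply, map_smul, smul_eq_mul] at h1
      have h3 : (r - 1) * f y = 0 := by rw [sub_mul, h1]; ring
      exact (mul_eq_zero.1 h3).resolve_left (sub_ne_zero.2 hr1))
  rw [this] at hay
  simp at hay

end PointImageIndex

section SingerCubic

open Module

variable {F E : Type*} [Field F] [Field E] [Algebra F E] {K : Subgroup (E ≃ₗ[F] E)}

theorem transvectionFree_of_unitMul_mem [Finite E] (hn : 3 ≤ finrank F E) (htop : K ≠ ⊤)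
    (hE : ∀ u, unitMul F E u ∈ K) : TransvectionFree K := by
  intro c f hc hfc h
  by_contra hf
  exact htop (eq_top_of_unitMul_mem_of_transvection hn hE hc hf hfc h)

theorem exists_apply_one_eq_of_unitMul_mem (hE : ∀ u, unitMul F E u ∈ K) (w : E) (hw : w ≠ 0) :
    ∃ k ∈ K, k 1 = w :=
  ⟨_, hE (Units.mk0 w hw), by simp⟩

theorem index_eq_of_unitMul_mem [Finite E] (hn : 3 ≤ finrank F E) (htop : K ≠ ⊤)
    (hE : ∀ u, unitMul F E u ∈ K) :
    K.index = Nat.card F ^ (finrank F E - 1) *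
      (pointImage (F ∙ (1 : E)).mkQ (1 : E) K).index := by
  have : Finite F := Finite.of_injective _ (algebraMap F E).injective
  have : Finite (E ⧸ (F ∙ (1 : E))) := Quotient.finite _
  have hker : LinearMap.ker (F ∙ (1 : E)).mkQ = F ∙ (1 : E) := Submodule.ker_mkQ _
  have hV := finrank_eq_of_ker (Submodule.mkQ_surjective _) hker one_ne_zero
  rw [hV, Nat.add_sub_cancel]
  exact (transvectionFree_of_unitMul_mem hn htop hE).index_eq (Submodule.mkQ_surjective _) hker
    one_ne_zero (exists_apply_one_eq_of_unitMul_mem hE)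

/-- Proper overgroups of a Singer cycle in dimension three have point stabilizers of odd order. -/
theorem odd_card_pointImage_of_unitMul_mem [Finite E] (hn : finrank F E = 3) (htop : K ≠ ⊤)
    (hE : ∀ u, unitMul F E u ∈ K) :
    ¬ 2 ∣ Nat.card (pointImage (F ∙ (1 : E)).mkQ (1 : E) K) := by
  have : Finite F := Finite.of_injective _ (algebraMap F E).injective
  have : Finite (E ⧸ (F ∙ (1 : E))) := Quotient.finite _
  have : Finite ((E ⧸ (F ∙ (1 : E))) ≃ₗ[F] (E ⧸ (F ∙ (1 : E)))) := DFunLike.finite _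
  have hfree := transvectionFree_of_unitMul_mem hn.ge htop hE
  have hker : LinearMap.ker (F ∙ (1 : E)).mkQ = F ∙ (1 : E) := Submodule.ker_mkQ _
  intro hdvd
  have : Fact (Nat.Prime 2) := ⟨Nat.prime_two⟩
  obtain ⟨⟨l, k, hk, hk1, hkl⟩, hl⟩ := exists_prime_orderOf_dvd_card' 2 hdvd
  have hl2 : l * l = 1 := by
    have h1 := pow_orderOf_eq_one (⟨l, k, hk, hk1, hkl⟩ : pointImage (F ∙ (1 : E)).mkQ (1 : E) K)
    rw [hl, pow_two] at h1
    exact congrArg Subtype.val h1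
  have hne : k ≠ 1 := by
    rintro rfl
    have : l = 1 := by
      ext y
      obtain ⟨z, rfl⟩ := Submodule.mkQ_surjective _ y
      exact hkl z
    subst this
    have h1 := orderOf_one (G := pointImage (F ∙ (1 : E)).mkQ (1 : E) K)
    change orderOf 1 = 2 at hl
    omega
  have hkk : ∀ y, k (k y) = y := by
    have h1 : k * k = 1 := by
      refine hfree.eq_of_descend hker one_ne_zero (K.mul_mem hk hk) K.one_mem ?_ rfl fun y => ?_
      · change k (k 1) = 1
        rw [hk1, hk1]
      · change (F ∙ (1 : E)).mkQ (k (k y)) = (F ∙ (1 : E)).mkQ y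
        rw [← hkl, ← hkl]
        exact LinearEquiv.congr_fun hl2 _
    exact LinearEquiv.congr_fun h1
  set A : E →ₗ[F] E := (k : E →ₗ[F] E) - LinearMap.id with hA
  set B : E →ₗ[F] E := (k : E →ₗ[F] E) + LinearMap.id with hB
  have hAB : finrank F (LinearMap.range A) ≤ finrank F (LinearMap.ker B) := by
    refine Submodule.finrank_mono ?_
    rintro _ ⟨y, rfl⟩
    simp [hA, hB, hkk]
  have hrk := A.finrank_range_add_finrank_ker
  have persp : ∀ g ∈ K, (∃ W : Submodule F E, 2 ≤ finrank F W ∧ ∀ w ∈ W, g w = w) → g = 1 := by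
    rintro g hg ⟨W, hW, hgW⟩
    obtain ⟨c, f, hcf⟩ := eq_persp_of_fixes (by omega) hgW
    have hp : HasPersp K c f := ⟨g, hg, hcf⟩
    by_cases hfc : f c = 0
    · by_cases hc : c = 0
      · ext y; simp [hcf, hc]
      · ext y; simp [hcf, hfree c f hc hfc hp]
    · exact absurd (eq_top_of_unitMul_mem_of_homology hn hE hfc hp) htop
  by_cases h2 : 2 ≤ finrank F (LinearMap.ker A)
  · refine hne (persp k hk ⟨_, h2, fun w hw => ?_⟩)
    have : k w - w = 0 := hw
    exact sub_eq_zero.1 this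
  · have h3 := persp (unitMul F E (-1) * k) (K.mul_mem (hE _) hk)
      ⟨LinearMap.ker B, by omega, fun w hw => by
        have : k w + w = 0 := hw
        rw [LinearEquiv.mul_apply, unitMul_apply, eq_neg_of_add_eq_zero_left this]
        simp⟩
    have h4 : ∀ y, -k y = y := fun y => by
      have := LinearEquiv.congr_fun h3 y
      simpa using this
    have h5 : (-1 : E) = 1 := by simpa [hk1] using h4 1
    refine hne ?_
    ext y
    have := h4 y
    rw [neg_eq_neg_one_mul, h5, one_mul] at this
    exact this

/-- The group of homologies with a fixed center and axis. -/
def homologyHom {V : Type*} [AddCommGroup V] [Module F V] (f : Dual F V) (c : V) (hfc : f c = 1) :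
    Fˣ →* V ≃ₗ[F] V where
  toFun a :=
    { toFun := fun y => y + ((a.1 - 1) * f y) • c
      map_add' := fun y z => by
        rw [map_add, mul_add, add_smul]
        abel
      map_smul' := fun t y => by
        rw [map_smul, smul_eq_mul, mul_left_comm, mul_smul, RingHom.id_apply, smul_add]
      invFun := fun y => y + ((a⁻¹.1 - 1) * f y) • c
      left_inv := fun y => by
        simp only [map_add, map_smul, hfc, add_assoc, ← add_smul, smul_eq_mul]
        rw [show (a.1 - 1) * f y + (a⁻¹.1 - 1) * (f y + (a.1 - 1) * f y * 1) =
          (a⁻¹.1 * a.1 - 1) * f y by ring]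
        simp
      right_inv := fun y => by
        simp only [map_add, map_smul, hfc, add_assoc, ← add_smul, smul_eq_mul]
        rw [show (a⁻¹.1 - 1) * f y + (a.1 - 1) * (f y + (a⁻¹.1 - 1) * f y * 1) =
          (a⁻¹.1 * a.1 - 1) * f y by ring]
        simp }
  map_one' := by
    ext y
    change y + (((1 : Fˣ).1 - 1) * f y) • c = y
    simp
  map_mul' a b := by
    ext y
    change y + ((a.1 * b.1 - 1) * f y) • c =
      (y + ((b.1 - 1) * f y) • c) + ((a.1 - 1) * f (y + ((b.1 - 1) * f y) • c)) • c
    rw [map_add, map_smul, hfc, add_assoc, ← add_smul, smul_eq_mul]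
    congr 2
    ring

theorem homologyHom_apply {V : Type*} [AddCommGroup V] [Module F V] (f : Dual F V) (c : V)
    (hfc : f c = 1) (a : Fˣ) (y : V) :
    homologyHom f c hfc a y = y + ((a.1 - 1) * f y) • c := rfl

theorem card_units_dvd_index_of_unitMul_mem [Finite E] (hn : finrank F E = 3) (htop : K ≠ ⊤)
    (hE : ∀ u, unitMul F E u ∈ K) : Nat.card F - 1 ∣ K.index := by
  have : Finite F := Finite.of_injective _ (algebraMap F E).injective
  have : Finite (E ≃ₗ[F] E) := DFunLike.finite _
  obtain ⟨f, hf, -⟩ := exists_dual_apply_eq_one (F := F) (v := (1 : E)) (W := ⊥) (by simp)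
  have hinj : Function.Injective (homologyHom f 1 hf) := by
    intro a b hab
    have := LinearEquiv.congr_fun hab 1
    simp only [homologyHom_apply, hf, mul_one, add_right_inj] at this
    have := smul_left_injective F (one_ne_zero (α := E)) this
    exact Units.ext (sub_left_injective this)
  have hcard : Nat.card (homologyHom f 1 hf).range = Nat.card F - 1 := by
    rw [← Nat.card_units]
    exact (Nat.card_congr (MonoidHom.ofInjective hinj).toEquiv).symm
  rw [← hcard]
  refine card_dvd_index_of_disjoint ?_
  rintro g _ ⟨a, rfl⟩ hg
  by_contra hne
  have ha : a.1 - 1 ≠ 0 := fun h => hne (by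
    rw [show a = 1 from Units.ext (sub_eq_zero.1 h), map_one])
  refine htop (eq_top_of_unitMul_mem_of_homology hn hE (c := g.symm 1)
    (f := (a.1 - 1) • f ∘ₗ (g : E →ₗ[F] E)) ?_ ⟨_, hg, fun y => ?_⟩)
  · simp [hf, ha]
  · change g.symm (g y + ((a.1 - 1) * f (g y)) • 1) = _
    simp

theorem card_fixedBy_le_of_finrank_three [Finite E] (hn : finrank F E = 3) {u : Eˣ}
    (hu : ∀ w : Eˣ, w ∈ Subgroup.zpowers u) :
    Nat.card (MulAction.fixedBy ((E ≃ₗ[F] E) ⧸ K) (unitMul F E u)) ≤ 3 := by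
  have : Finite F := Finite.of_injective _ (algebraMap F E).injective
  have hq : 2 ≤ Nat.card F := Finite.one_lt_card
  have h := card_fixedBy_unitMul_lt hn.ge (K := K) hu
  rw [hn] at h
  by_contra! h4
  have h5 : 4 ≤ Nat.card F ^ 2 := by nlinarith
  obtain ⟨t, ht⟩ := Nat.exists_eq_add_of_le' h5
  rw [ht] at h
  have := Nat.mul_le_mul_right (t + 4 - 1) h4
  omega

theorem pow_mul_card_fixedBy_le_of_finrank_three [Finite E] (hn : finrank F E = 3) (htop : K ≠ ⊤)
    (hE : ∀ u, unitMul F E u ∈ K) {u : Eˣ} (hu : ∀ w : Eˣ, w ∈ Subgroup.zpowers u) :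
    Nat.card F ^ 3 * Nat.card (MulAction.fixedBy ((E ≃ₗ[F] E) ⧸ K) (unitMul F E u)) ≤
      K.index := by
  have : Finite F := Finite.of_injective _ (algebraMap F E).injective
  have : Finite (E ≃ₗ[F] E) := DFunLike.finite _
  have : Finite (E ⧸ (F ∙ (1 : E))) := Quotient.finite _
  have : Finite ((E ⧸ (F ∙ (1 : E))) ≃ₗ[F] (E ⧸ (F ∙ (1 : E)))) := DFunLike.finite _
  have hf := card_fixedBy_le_of_finrank_three hn (K := K) hu
  have hidx := index_eq_of_unitMul_mem hn.ge htop hE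
  have hker : LinearMap.ker (F ∙ (1 : E)).mkQ = F ∙ (1 : E) := Submodule.ker_mkQ _
  have hX := finrank_eq_of_ker (Submodule.mkQ_surjective _) hker one_ne_zero
  have hodd := odd_card_pointImage_of_unitMul_mem hn htop hE
  have hdvd := card_units_dvd_index_of_unitMul_mem hn htop hE
  have hprod := (pointImage (F ∙ (1 : E)).mkQ (1 : E) K).index_mul_card
  rw [card_linearEquiv, show finrank F (E ⧸ (F ∙ (1 : E))) = 2 by omega] at hprod
  rw [hn] at hidx
  have hq : 2 ≤ Nat.card F := Finite.one_lt_card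
  have hmod : Nat.card F = 2 →
      K.index ≡ Nat.card (MulAction.fixedBy ((E ≃ₗ[F] E) ⧸ K) (unitMul F E u)) [MOD 7] := by
    intro hq2
    refine card_fixedBy_modEq_index K (by norm_num) ?_
    rw [← map_pow]
    have h1 : Nat.card Eˣ = 7 := by
      rw [Nat.card_units, natCard_eq_pow_finrank (K := F) (V := E), hn, hq2]
      norm_num
    rw [← h1, pow_card_eq_one', map_one]
  generalize Nat.card (MulAction.fixedBy ((E ≃ₗ[F] E) ⧸ K) (unitMul F E u)) = f at *
  generalize (pointImage (F ∙ (1 : E)).mkQ (1 : E) K).index = j at *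
  generalize Nat.card (pointImage (F ∙ (1 : E)).mkQ (1 : E) K) = l at *
  generalize K.index = i at *
  simp only [Finset.prod_range_succ, Finset.prod_range_zero, pow_zero, pow_one, one_mul] at hprod
  have hpp : 2 ∣ Nat.card F → ∃ k, Nat.card F = 2 ^ k := by
    intro h2
    have := Fintype.ofFinite F
    have hp := FiniteField.isPrimePow_card F
    rw [← Nat.card_eq_fintype_card, isPrimePow_nat_iff] at hp
    obtain ⟨p, k, hp, hk, hpk⟩ := hp
    rw [← hpk] at h2
    have := (Nat.prime_dvd_prime_iff_eq Nat.prime_two hp).1 (Nat.prime_two.dvd_of_dvd_pow h2)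
    exact ⟨k, by rw [← hpk, this]⟩
  generalize Nat.card F = q at *
  by_cases hq2 : q = 2
  · subst hq2
    have h1 := hmod rfl
    norm_num at hprod hidx
    have hj : j ∣ 6 := ⟨l, hprod.symm⟩
    have hj6 := Nat.le_of_dvd (by norm_num) hj
    rw [Nat.ModEq] at h1
    interval_cases j <;> omega
  · have hq3 : 3 ≤ q := by omega
    obtain ⟨r, rfl⟩ : ∃ r, q = r + 1 := ⟨q - 1, by omega⟩
    rw [hidx] at hdvd
    have hcop : Nat.Coprime (r + 1 - 1) ((r + 1) ^ (3 - 1)) := by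
      rw [Nat.add_sub_cancel]
      refine Nat.Coprime.pow_right _ ?_
      simp
    obtain ⟨t, rfl⟩ := hcop.dvd_of_dvd_mul_left hdvd
    rw [Nat.add_sub_cancel] at hidx hprod
    have e1 : (r + 1) ^ 2 - 1 = r * (r + 2) := by
      rw [show (r + 1) ^ 2 = r * (r + 2) + 1 by ring, Nat.add_sub_cancel]
    have e2 : (r + 1) ^ 2 - (r + 1) = r * (r + 1) := by
      rw [show (r + 1) ^ 2 = r * (r + 1) + (r + 1) by ring, Nat.add_sub_cancel]
    rw [e1, e2] at hprod
    have hr : 0 < r := by omega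
    have htl : t * l = (r + 1) * (r * (r + 2)) := by
      refine Nat.eq_of_mul_eq_mul_left hr ?_
      linarith
    have hl : Nat.Coprime 2 l := (Nat.prime_two.coprime_iff_not_dvd).2 hodd
    suffices 3 * (r + 1) ≤ r * t by
      rw [hidx]
      calc (r + 1) ^ 3 * f ≤ (r + 1) ^ 3 * 3 := Nat.mul_le_mul_left _ hf
        _ = (r + 1) ^ 2 * (3 * (r + 1)) := by ring
        _ ≤ (r + 1) ^ 2 * (r * t) := Nat.mul_le_mul_left _ this
    by_cases h2 : 2 ∣ r + 1
    · obtain ⟨k, hk⟩ := hpp h2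
      have h3 : r + 1 ∣ t := by
        refine Nat.Coprime.dvd_of_dvd_mul_right ?_ (htl ▸ Dvd.intro _ rfl : r + 1 ∣ t * l)
        rw [hk]
        exact hl.pow_left k
      have ht : r + 1 ≤ t := Nat.le_of_dvd (Nat.pos_of_ne_zero fun h => by
        rw [h, zero_mul] at htl
        have : 0 < (r + 1) * (r * (r + 2)) := by positivity
        omega) h3
      have hr3 : 3 ≤ r := by omega
      nlinarith
    · have h3 : 8 ∣ t := by
        refine Nat.Coprime.dvd_of_dvd_mul_right (hl.pow_left 3) (htl ▸ Dvd.dvd.mul_left ?_ _)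
        obtain ⟨z, rfl⟩ : ∃ z, r = 2 * z := ⟨r / 2, by omega⟩
        obtain ⟨w, hw⟩ := (Nat.even_mul_succ_self z).two_dvd
        exact ⟨w, by
          rw [show 2 * z * (2 * z + 2) = 4 * (z * (z + 1)) by ring, hw]
          ring⟩
      have ht : 8 ≤ t := Nat.le_of_dvd (Nat.pos_of_ne_zero fun h => by
        rw [h, zero_mul] at htl
        have : 0 < (r + 1) * (r * (r + 2)) := by positivity
        omega) h3
      nlinarith

end SingerCubic

section SylowFixedPoints

variable {G : Type*} [Group G]

/-- If `K` contains the centralizer of an element `z` of prime order `r` and `r ^ 2` does not divide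
the order of the group, then the number of fixed points of `z` on the cosets of `K` divides
`r - 1`. -/
theorem card_fixedBy_dvd_pred_of_prime [Finite G] {K : Subgroup G} {z : G} {r : ℕ} (hr : r.Prime)
    (hz : orderOf z = r) (hr2 : ¬ r ^ 2 ∣ Nat.card G) (hC : ∀ g, g * z = z * g → g ∈ K) :
    Nat.card (MulAction.fixedBy (G ⧸ K) z) ∣ r - 1 := by
  have : Fact r.Prime := ⟨hr⟩
  have hzK : z ∈ K := hC z rfl
  set R := Subgroup.zpowers z with hR
  set N := Subgroup.normalizer (R : Set G) with hN
  have hRK : R ≤ K := Subgroup.zpowers_le.2 hzK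
  have hfac : (Nat.card K).factorization r = 1 := by
    have h1 : r ∣ Nat.card K := by
      rw [← hz]
      exact Subgroup.orderOf_dvd_natCard _ hzK
    have h2 : ¬ r ^ 2 ∣ Nat.card K := fun h => hr2 (h.trans (Subgroup.card_subgroup_dvd_card K))
    have h3 := (hr.pow_dvd_iff_le_factorization (k := 1) (Nat.card_pos (α := K)).ne').1 (by simpa)
    have h4 := mt (hr.pow_dvd_iff_le_factorization (k := 2) (Nat.card_pos (α := K)).ne').2 h2
    omega
  have hSyl : ∀ a : K, orderOf a = r →
      Nat.card (Subgroup.zpowers a) = r ^ (Nat.card K).factorization r := by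
    intro a ha
    rw [hfac, pow_one, Nat.card_zpowers, ha]
  have horb : MulAction.orbit N ((1 : G) : G ⧸ K) = MulAction.fixedBy (G ⧸ K) z := by
    ext w
    constructor
    · rintro ⟨n, rfl⟩
      rw [MulAction.mem_fixedBy]
      change z • ((n.1 * 1 : G) : G ⧸ K) = ((n.1 * 1 : G) : G ⧸ K)
      rw [MulAction.Quotient.smul_coe, eq_comm, QuotientGroup.eq, mul_one, smul_eq_mul, ← mul_assoc]
      exact hRK ((Subgroup.mem_normalizer_iff''.1 n.2 z).1 (Subgroup.mem_zpowers z))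
    · obtain ⟨g, rfl⟩ := QuotientGroup.mk_surjective w
      intro hg
      rw [MulAction.mem_fixedBy, MulAction.Quotient.smul_coe, eq_comm, QuotientGroup.eq,
        smul_eq_mul, ← mul_assoc] at hg
      have ho : orderOf (⟨g⁻¹ * z * g, hg⟩ : K) = r := by
        rw [Subgroup.orderOf_mk, ← hz]
        simpa using orderOf_injective (MulAut.conj g⁻¹).toMonoidHom (MulAut.conj g⁻¹).injective z
      have ho' : orderOf (⟨z, hzK⟩ : K) = r := by rw [Subgroup.orderOf_mk, hz]
      obtain ⟨k, hk⟩ := MulAction.exists_smul_eq K (Sylow.ofCard _ (hSyl _ ho'))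
        (Sylow.ofCard _ (hSyl _ ho))
      have hmem : k * ⟨z, hzK⟩ * k⁻¹ ∈ Subgroup.zpowers (⟨g⁻¹ * z * g, hg⟩ : K) := by
        have h1 : k * ⟨z, hzK⟩ * k⁻¹ ∈ (k • Sylow.ofCard _ (hSyl _ ho') : Sylow r K) := by
          rw [← SetLike.mem_coe, Sylow.coe_smul]
          exact Subgroup.smul_mem_pointwise_smul _ (MulAut.conj k) _ (Subgroup.mem_zpowers _)
        rw [hk] at h1
        exact h1
      obtain ⟨i, hi⟩ := hmem
      have hi' : (g⁻¹ * z * g) ^ i = k.1 * z * k.1⁻¹ := congrArg Subtype.val hi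
      have hconj : (g * k.1) * z * (g * k.1)⁻¹ = z ^ i := by
        have h2 : (g⁻¹ * z * g) ^ i = g⁻¹ * z ^ i * g := by
          simpa using conj_zpow (a := g⁻¹) (b := z) (i := i)
        rw [h2] at hi'
        calc (g * k.1) * z * (g * k.1)⁻¹ = g * (k.1 * z * k.1⁻¹) * g⁻¹ := by group
          _ = z ^ i := by rw [← hi']; group
      have hn : g * k.1 ∈ N := by
        refine Subgroup.mem_normalizer_fintype ?_
        rintro _ ⟨l, rfl⟩
        have h3 : g * k.1 * (z ^ l) * (g * k.1)⁻¹ = (z ^ i) ^ l := by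
          rw [← hconj, conj_zpow]
        rw [SetLike.mem_coe]
        change g * k.1 * (z ^ l) * (g * k.1)⁻¹ ∈ R
        rw [h3]
        exact R.zpow_mem (R.zpow_mem (Subgroup.mem_zpowers z) i) l
      refine ⟨⟨_, hn⟩, ?_⟩
      change ((g * k.1 * 1 : G) : G ⧸ K) = _
      rw [mul_one, QuotientGroup.eq]
      simp
  have hstab : MulAction.stabilizer N ((1 : G) : G ⧸ K) = K.subgroupOf N := by
    ext n
    rw [MulAction.mem_stabilizer_iff, Subgroup.mem_subgroupOf]
    change ((n.1 * 1 : G) : G ⧸ K) = _ ↔ _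
    rw [eq_comm, QuotientGroup.eq]
    simp
  have h1 := MulAction.index_stabilizer N ((1 : G) : G ⧸ K)
  rw [horb, hstab] at h1
  rw [Nat.card_coe_set_eq, ← h1]
  have hCK : Subgroup.centralizer (R : Set G) ≤ K := fun g hg =>
    hC g (Subgroup.mem_centralizer_iff.1 hg z (Subgroup.mem_zpowers z)).symm
  have h2 : (Subgroup.centralizer (R : Set G)).relIndex N ∣ r - 1 := by
    have h3 := Subgroup.index_ker R.normalizerMonoidHom
    rw [Subgroup.normalizerMonoidHom_ker] at h3
    have h4 := Subgroup.card_subgroup_dvd_card R.normalizerMonoidHom.range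
    rw [← h3, IsCyclic.card_mulAut, hR, Nat.card_zpowers, hz, Nat.totient_prime hr] at h4
    exact h4
  exact (Subgroup.relIndex_dvd_of_le_left N hCK).trans h2

theorem card_fixedBy_le_pow [Finite G] (K : Subgroup G) (x : G) (k : ℕ) :
    Nat.card (MulAction.fixedBy (G ⧸ K) x) ≤ Nat.card (MulAction.fixedBy (G ⧸ K) (x ^ k)) := by
  refine Nat.card_mono (Set.toFinite _) fun w hw => ?_
  rw [MulAction.mem_fixedBy] at hw ⊢
  induction k with
  | zero => simp
  | succ k ih => rw [pow_succ, mul_smul, hw, ih]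

end SylowFixedPoints

section SingerIndex

open Module

variable {F E : Type*} [Field F] [Field E] [Algebra F E] {K : Subgroup (E ≃ₗ[F] E)}

theorem eq_one_of_card_eq_two (h2 : Nat.card F = 2) {a : F} (ha : a ≠ 0) : a = 1 := by
  have : Finite F := Nat.finite_of_card_ne_zero (by omega)
  have h1 : Nat.card Fˣ = 1 := by rw [Nat.card_units, h2]
  have := Finite.card_le_one_iff_subsingleton.1 h1.le
  exact congrArg Units.val (Subsingleton.elim (Units.mk0 a ha) 1)

theorem unitMul_injective : Function.Injective (unitMul F E) := by
  intro u w h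
  have := LinearEquiv.congr_fun h 1
  simpa [Units.ext_iff] using this

theorem orderOf_eq_of_generator [Finite E] {u : Eˣ} (hu : ∀ w : Eˣ, w ∈ Subgroup.zpowers u) :
    orderOf u = Nat.card F ^ finrank F E - 1 := by
  have : Finite F := Finite.of_injective _ (algebraMap F E).injective
  rw [orderOf_eq_card_of_forall_mem_zpowers hu, Nat.card_units,
    natCard_eq_pow_finrank (K := F) (V := E)]

/-- An endomorphism commuting with multiplication by a primitive element is a multiplication. -/
theorem exists_eq_unitMul_of_commute [Finite E] {z : E} (hz : z ∈ primitiveSet F E)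
    {g : E ≃ₗ[F] E} (hg : ∀ w, g (z * w) = z * g w) : ∃ u, g = unitMul F E u := by
  have h1 : g 1 ≠ 0 := by simp
  refine ⟨Units.mk0 _ h1, ?_⟩
  ext w
  have hw : w ∈ Algebra.adjoin F {z} := by
    rw [adjoin_eq_top_of_mem_primitiveSet hz]
    trivial
  obtain ⟨P, rfl⟩ := Algebra.adjoin_singleton_eq_range_aeval F z ▸ hw
  rw [unitMul_apply, Units.val_mk0, mul_comm]
  exact apply_aeval_of_intertwine (k := (g : E →ₗ[F] E)) hg P

theorem card_fixedBy_dvd_four [Finite E] (hn : finrank F E = 4) (hE : ∀ u, unitMul F E u ∈ K)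
    {u : Eˣ} (hu : orderOf u = 5) (h5 : ∀ d, d ∣ 4 → d < 4 → (Nat.card F ^ d - 1).Coprime 5)
    (h25 : ¬ 5 ^ 2 ∣ Nat.card (E ≃ₗ[F] E)) :
    Nat.card (MulAction.fixedBy ((E ≃ₗ[F] E) ⧸ K) (unitMul F E u)) ∣ 4 := by
  have : Finite F := Finite.of_injective _ (algebraMap F E).injective
  have : Finite (E ≃ₗ[F] E) := DFunLike.finite _
  refine card_fixedBy_dvd_pred_of_prime (r := 5) (by norm_num) ?_ h25 fun g hg => ?_
  · rw [orderOf_injective _ unitMul_injective, hu]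
  · have hprim : (u : E) ∈ primitiveSet F E := by
      intro d hd hd4 h
      rw [hn] at hd hd4
      have hpos : 0 < Nat.card F ^ d := pow_pos Nat.card_pos d
      have h1 : u ^ (Nat.card F ^ d - 1) = 1 := by
        refine mul_right_cancel (b := u) ?_
        rw [← pow_succ, Nat.sub_add_cancel hpos, one_mul]
        exact Units.ext (by simpa using h)
      have h2 := orderOf_dvd_of_pow_eq_one h1
      rw [hu] at h2
      have h3 := Nat.dvd_gcd h2 dvd_rfl
      rw [h5 d hd hd4] at h3
      norm_num at h3
    obtain ⟨w, rfl⟩ := exists_eq_unitMul_of_commute hprim (g := g) fun w => by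
      have := LinearEquiv.congr_fun hg w
      simpa using this
    exact hE w

theorem three_mul_card_fixedBy_lt [Finite E] (hn : 3 ≤ finrank F E) {u : Eˣ}
    (hu : ∀ w : Eˣ, w ∈ Subgroup.zpowers u) :
    3 * Nat.card (MulAction.fixedBy ((E ≃ₗ[F] E) ⧸ K) (unitMul F E u)) < 4 * finrank F E := by
  have : Finite F := Finite.of_injective _ (algebraMap F E).injective
  have hq : 2 ≤ Nat.card F := Finite.one_lt_card
  have h := card_fixedBy_unitMul_lt hn (K := K) hu
  generalize Nat.card (MulAction.fixedBy ((E ≃ₗ[F] E) ⧸ K) (unitMul F E u)) = f at *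
  have h4 : 4 ≤ Nat.card F ^ 2 := by nlinarith
  obtain ⟨t, ht⟩ := Nat.exists_eq_add_of_le' h4
  rw [ht, show t + 4 - 1 = t + 3 by omega] at h
  by_contra! hc
  have h1 : f * (3 * (t + 4)) ≤ f * (4 * (t + 3)) := Nat.mul_le_mul_left _ (by omega)
  have h2 := Nat.mul_le_mul_right (t + 4) hc
  linarith

/-- A general bound on the number of fixed points. -/
theorem card_fixedBy_le_pow_sub_three [Finite E] (hn : 4 ≤ finrank F E)
    (h4 : finrank F E = 4 → 4 ≤ Nat.card F) (h5 : finrank F E = 5 → 3 ≤ Nat.card F) {u : Eˣ}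
    (hu : ∀ w : Eˣ, w ∈ Subgroup.zpowers u) :
    Nat.card (MulAction.fixedBy ((E ≃ₗ[F] E) ⧸ K) (unitMul F E u)) ≤
      Nat.card F ^ (finrank F E - 3) := by
  have : Finite F := Finite.of_injective _ (algebraMap F E).injective
  have hq : 2 ≤ Nat.card F := Finite.one_lt_card
  have h := card_fixedBy_unitMul_lt (by omega) (K := K) hu
  have h3 := three_mul_card_fixedBy_lt (by omega) (K := K) hu
  generalize Nat.card (MulAction.fixedBy ((E ≃ₗ[F] E) ⧸ K) (unitMul F E u)) = f at *
  generalize finrank F E = n at *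
  obtain rfl | rfl | h6 : n = 4 ∨ n = 5 ∨ 6 ≤ n := by omega
  · have h4 := h4 rfl
    norm_num
    obtain h4 | h4 : Nat.card F = 4 ∨ 5 ≤ Nat.card F := by omega
    · rw [h4] at h ⊢
      omega
    · omega
  · have h5 := h5 rfl
    norm_num
    nlinarith
  · have h7 : 2 ^ (n - 3) ≤ Nat.card F ^ (n - 3) := Nat.pow_le_pow_left hq _
    have h8 : 4 * n ≤ 3 * 2 ^ (n - 3) + 3 := by
      obtain ⟨s, rfl⟩ := Nat.exists_eq_add_of_le' h6
      rw [show s + 6 - 3 = s + 3 by omega]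
      clear * -
      induction s with
      | zero => norm_num
      | succ s ih =>
        rw [show s + 1 + 3 = s + 3 + 1 by omega, pow_succ]
        have : 2 ^ 3 ≤ 2 ^ (s + 3) := Nat.pow_le_pow_right (by norm_num) (by omega)
        omega
    omega

theorem pow_mul_card_fixedBy_le_of_unitMul_mem [Finite E] (hn : 3 ≤ finrank F E) (htop : K ≠ ⊤)
    (hE : ∀ u, unitMul F E u ∈ K) {u : Eˣ} (hu : ∀ w : Eˣ, w ∈ Subgroup.zpowers u) :
    Nat.card F ^ finrank F E *
      Nat.card (MulAction.fixedBy ((E ≃ₗ[F] E) ⧸ K) (unitMul F E u)) ≤ K.index := by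
  obtain hn3 | hn4 : finrank F E = 3 ∨ 4 ≤ finrank F E := by omega
  · rw [hn3]
    exact pow_mul_card_fixedBy_le_of_finrank_three hn3 htop hE hu
  have : Finite F := Finite.of_injective _ (algebraMap F E).injective
  have : Finite (E ≃ₗ[F] E) := DFunLike.finite _
  have : Finite (E ⧸ (F ∙ (1 : E))) := Quotient.finite _
  have : Finite ((E ⧸ (F ∙ (1 : E))) ≃ₗ[F] (E ⧸ (F ∙ (1 : E)))) := DFunLike.finite _
  have hq : 2 ≤ Nat.card F := Finite.one_lt_card
  have hidx := index_eq_of_unitMul_mem hn htop hE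
  have hker : LinearMap.ker (F ∙ (1 : E)).mkQ = F ∙ (1 : E) := Submodule.ker_mkQ _
  have hX := finrank_eq_of_ker (Submodule.mkQ_surjective _) hker one_ne_zero
  have hfree := transvectionFree_of_unitMul_mem hn htop hE
  have hj := hfree.pow_le_index_pointImage (Submodule.mkQ_surjective _) hker one_ne_zero (by omega)
  rw [show finrank F (E ⧸ (F ∙ (1 : E))) = finrank F E - 1 by omega] at hj
  suffices Nat.card F * Nat.card (MulAction.fixedBy ((E ≃ₗ[F] E) ⧸ K) (unitMul F E u)) ≤
      (pointImage (F ∙ (1 : E)).mkQ (1 : E) K).index by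
    rw [hidx]
    calc _ = Nat.card F ^ (finrank F E - 1) * (Nat.card F *
        Nat.card (MulAction.fixedBy ((E ≃ₗ[F] E) ⧸ K) (unitMul F E u))) := by
          rw [← mul_assoc, ← pow_succ, Nat.sub_add_cancel (by omega)]
      _ ≤ _ := Nat.mul_le_mul_left _ this
  have hord := orderOf_eq_of_generator (F := F) hu
  have h3 := three_mul_card_fixedBy_lt hn (K := K) hu
  by_cases h52 : finrank F E = 5 ∧ Nat.card F = 2
  · obtain ⟨h5, h2⟩ := h52
    have hmod : K.index ≡
        Nat.card (MulAction.fixedBy ((E ≃ₗ[F] E) ⧸ K) (unitMul F E u)) [MOD 31] := by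
      refine card_fixedBy_modEq_index K (by norm_num) ?_
      rw [← map_pow, show 31 = orderOf u by rw [hord, h5, h2]; norm_num, pow_orderOf_eq_one, map_one]
    have hj := hj (by omega)
    rw [h5, h2] at hidx hj
    rw [h5] at h3
    rw [hidx, Nat.ModEq] at hmod
    rw [h2]
    omega
  by_cases h4 : finrank F E = 4 ∧ Nat.card F ≤ 3
  · obtain ⟨h4, hq3⟩ := h4
    have hdvd : 5 ∣ Nat.card F ^ 4 - 1 := by
      interval_cases Nat.card F <;> norm_num
    obtain ⟨k, hk⟩ := hdvd
    have hk0 : k ≠ 0 := by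
      rintro rfl
      interval_cases Nat.card F <;> norm_num at hk
    have hord5 : orderOf (u ^ k) = 5 := by
      rw [orderOf_pow_of_dvd hk0 (by rw [hord, h4, hk]; exact Dvd.intro_left _ rfl), hord, h4, hk,
        Nat.mul_div_cancel _ (Nat.pos_of_ne_zero hk0)]
    have hf4 := card_fixedBy_dvd_four h4 hE hord5 (fun d hd hd4 => by
        interval_cases Nat.card F <;> interval_cases d <;> first | omega | norm_num) (by
        rw [card_linearEquiv, h4]
        simp only [Finset.prod_range_succ, Finset.prod_range_zero]
        interval_cases Nat.card F <;> norm_num)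
    have hmod : K.index ≡
        Nat.card (MulAction.fixedBy ((E ≃ₗ[F] E) ⧸ K) (unitMul F E (u ^ k))) [MOD 5] := by
      refine card_fixedBy_modEq_index K (by norm_num) ?_
      rw [← map_pow, ← hord5, pow_orderOf_eq_one, map_one]
    have hle := card_fixedBy_le_pow K (unitMul F E u) k
    rw [← map_pow] at hle
    generalize Nat.card (MulAction.fixedBy ((E ≃ₗ[F] E) ⧸ K) (unitMul F E u)) = f at *
    have hz : Nat.card (MulAction.fixedBy ((E ≃ₗ[F] E) ⧸ K) (unitMul F E (u ^ k))) = 1 ∨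
        Nat.card (MulAction.fixedBy ((E ≃ₗ[F] E) ⧸ K) (unitMul F E (u ^ k))) = 2 ∨
        Nat.card (MulAction.fixedBy ((E ≃ₗ[F] E) ⧸ K) (unitMul F E (u ^ k))) = 4 := by
      generalize Nat.card (MulAction.fixedBy ((E ≃ₗ[F] E) ⧸ K) (unitMul F E (u ^ k))) = t at hf4
      have := Nat.le_of_dvd (by norm_num) hf4
      interval_cases t <;> omega
    rw [hidx, Nat.ModEq, h4] at hmod
    obtain h2 | h3 : Nat.card F = 2 ∨ Nat.card F = 3 := by omega
    · have hj' : (pointImage (F ∙ (1 : E)).mkQ (1 : E) K).index = 1 ∨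
          4 ≤ (pointImage (F ∙ (1 : E)).mkQ (1 : E) K).index := by
        by_contra! hlt
        refine hlt.1 (Subgroup.index_eq_one.2 (eq_top_of_persp_of_det
          (hasPersp_of_index_lt ?_) fun a ha => ⟨1, Subgroup.one_mem _, ?_⟩))
        · rw [show finrank F (E ⧸ (F ∙ (1 : E))) = 3 by omega, h2]
          exact hlt.2
        · rw [eq_one_of_card_eq_two h2 ha]
          exact LinearMap.det_id
      rw [h2] at hmod ⊢
      omega
    · have hj := hj (by omega)
      rw [h4, h3] at hj
      rw [h3] at hmod ⊢
      omega
  · have hle := card_fixedBy_le_pow_sub_three hn4 (K := K) (by omega) (by omega) hu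
    calc _ ≤ Nat.card F * Nat.card F ^ (finrank F E - 3) := Nat.mul_le_mul_left _ hle
      _ = Nat.card F ^ (finrank F E - 1 - 1) := by
        rw [← pow_succ']
        congr 1
        omega
      _ ≤ _ := hj (by omega)

/-- Singer cycles lie in few conjugates of a proper subgroup. -/
theorem pow_mul_conjCount_unitMul_le [Finite E] (hn : 3 ≤ finrank F E) (htop : K ≠ ⊤) {u : Eˣ}
    (hu : ∀ w : Eˣ, w ∈ Subgroup.zpowers u) :
    Nat.card F ^ finrank F E * conjCount K (unitMul F E u) ≤ Nat.card (E ≃ₗ[F] E) := by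
  have : Finite F := Finite.of_injective _ (algebraMap F E).injective
  have : Finite (E ≃ₗ[F] E) := DFunLike.finite _
  refine conjCount_induction
    (P := fun a _ => Nat.card F ^ finrank F E * a ≤ Nat.card (E ≃ₗ[F] E)) (by simp) ?_
  intro K' hK' hu'
  have h1 := pow_mul_card_fixedBy_le_of_unitMul_mem hn (hK' htop) (forall_unitMul_mem hu hu') hu
  rw [conjCount_eq_card_fixedBy_mul, ← mul_assoc, ← K'.index_mul_card]
  exact Nat.mul_le_mul_right _ h1

end SingerIndex

section CountingVectors

open Module

variable {F V : Type*} [Field F] [AddCommGroup V] [Module F V]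

theorem exists_linearEquiv_dual_comp_eq [FiniteDimensional F V] {f f' : Dual F V} (hf : f ≠ 0)
    (hf' : f' ≠ 0) : ∃ g : V ≃ₗ[F] V, ∀ y, f (g y) = f' y := by
  obtain ⟨γ, hγ⟩ := exists_linearEquiv_apply_eq (F := F) hf hf'
  refine ⟨evalEquiv F V ≪≫ₗ γ.dualMap ≪≫ₗ (evalEquiv F V).symm, fun y => ?_⟩
  have h1 : ∀ z : Dual F (Dual F V), f ((evalEquiv F V).symm z) = z f := fun z => by
    conv_rhs => rw [← (evalEquiv F V).apply_symm_apply z]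
    rfl
  change f ((evalEquiv F V).symm (γ.dualMap (evalEquiv F V y))) = _
  rw [h1, LinearEquiv.dualMap_apply, hγ]
  rfl

theorem card_ne_zero [Finite V] : Nat.card {w : V // w ≠ 0} = Nat.card V - 1 := by
  classical
  have := Fintype.ofFinite V
  rw [Nat.card_eq_fintype_card, Fintype.card_subtype_compl, Nat.card_eq_fintype_card,
    Fintype.card_subtype_eq]

theorem card_apply_eq_mul_le [Finite F] [Finite V] (w w' : V) (hw' : w' ≠ 0) :
    (Nat.card V - 1) * Nat.card {g : V ≃ₗ[F] V // g w = w'} ≤ Nat.card (V ≃ₗ[F] V) := by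
  have : Finite (V ≃ₗ[F] V) := DFunLike.finite _
  have hex : ∀ z : {z : V // z ≠ 0}, ∃ t : V ≃ₗ[F] V, t w' = z :=
    fun z => exists_linearEquiv_apply_eq hw' z.2
  choose t ht using hex
  rw [← card_ne_zero, ← Nat.card_prod]
  refine Nat.card_le_card_of_injective (fun a => t a.1 * a.2.1) ?_
  rintro ⟨z, g, hg⟩ ⟨z', g', hg'⟩ h
  have h1 : z = z' := by
    have := LinearEquiv.congr_fun h w
    simp only [LinearEquiv.mul_apply, hg, hg', ht] at this
    exact Subtype.ext this
  subst h1
  have h2 : g = g' := mul_left_cancel h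
  subst h2
  rfl

theorem card_dual_comp_eq_mul_le [Finite F] [Finite V] (f f' : Dual F V) (hf' : f' ≠ 0) :
    (Nat.card V - 1) * Nat.card {g : V ≃ₗ[F] V // ∀ y, f (g y) = f' y} ≤
      Nat.card (V ≃ₗ[F] V) := by
  have : Finite (V ≃ₗ[F] V) := DFunLike.finite _
  have : Finite (Dual F V) := DFunLike.finite _
  have hex : ∀ z : {z : Dual F V // z ≠ 0}, ∃ t : V ≃ₗ[F] V, ∀ y, f' (t y) = z.1 y :=
    fun z => exists_linearEquiv_dual_comp_eq hf' z.2
  choose t ht using hex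
  have hcard : Nat.card (Dual F V) = Nat.card V := by
    rw [natCard_eq_pow_finrank (K := F) (V := V), natCard_eq_pow_finrank (K := F) (V := Dual F V),
      Subspace.dual_finrank_eq]
  rw [← hcard, ← card_ne_zero, ← Nat.card_prod]
  refine Nat.card_le_card_of_injective (fun a => a.2.1 * t a.1) ?_
  rintro ⟨z, g, hg⟩ ⟨z', g', hg'⟩ h
  have h1 : z = z' := by
    refine Subtype.ext (LinearMap.ext fun y => ?_)
    rw [← ht, ← ht, ← hg, ← hg']
    exact congrArg f (LinearEquiv.congr_fun h y)
  subst h1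
  have h2 : g = g' := mul_right_cancel h
  subst h2
  rfl

variable {K : Subgroup (V ≃ₗ[F] V)} {h : V ≃ₗ[F] V}

/-- A bound for the number of conjugates of `h` fixing a given point, when `h` fixes only one
point. -/
theorem card_mul_conjCount_le_of_fixes_point [Finite F] [Finite V] {v : V} (hv : v ≠ 0)
    (hh : ∀ (w : V) (a : F), h w = a • w → ∃ b : F, w = b • v)
    (hK : ∀ k ∈ K, ∃ a : F, k v = a • v) :
    (Nat.card V - 1) * conjCount K h ≤ (Nat.card F - 1) * Nat.card (V ≃ₗ[F] V) := by
  have : Finite (V ≃ₗ[F] V) := DFunLike.finite _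
  have hex : ∀ g : {g : V ≃ₗ[F] V // g⁻¹ * h * g ∈ K}, ∃ b : F, b ≠ 0 ∧ g.1 v = b • v := by
    rintro ⟨g, hg⟩
    obtain ⟨a, ha⟩ := hK _ hg
    obtain ⟨b, hb⟩ := hh (g v) a (by
      rw [← map_smul, ← ha]
      simp [LinearEquiv.mul_apply])
    refine ⟨b, fun hb0 => hv ?_, hb⟩
    rw [hb0, zero_smul] at hb
    exact g.map_eq_zero_iff.1 hb
  choose b hb0 hb using hex
  have hle : conjCount K h ≤ (Nat.card F - 1) * Nat.card {g : V ≃ₗ[F] V // g v = v} := by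
    rw [← card_ne_zero, ← Nat.card_prod]
    refine Nat.card_le_card_of_injective (fun g => (⟨b g, hb0 g⟩,
      ⟨(LinearEquiv.smulOfNeZero F V (b g)⁻¹ (inv_ne_zero (hb0 g))) * g.1, ?_⟩)) ?_
    · rw [LinearEquiv.mul_apply, LinearEquiv.smulOfNeZero_apply, hb, smul_smul,
        inv_mul_cancel₀ (hb0 g), one_smul]
    · intro g g' hgg
      simp only [Prod.mk.injEq, Subtype.mk.injEq] at hgg
      obtain ⟨h1, h2⟩ := hgg
      refine Subtype.ext (LinearEquiv.ext fun y => ?_)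
      have h3 := LinearEquiv.congr_fun h2 y
      simp only [LinearEquiv.mul_apply, LinearEquiv.smulOfNeZero_apply, h1] at h3
      exact smul_right_injective V (inv_ne_zero (hb0 g')) h3
  calc _ ≤ (Nat.card V - 1) * ((Nat.card F - 1) * Nat.card {g : V ≃ₗ[F] V // g v = v}) :=
        Nat.mul_le_mul_left _ hle
    _ = (Nat.card F - 1) * ((Nat.card V - 1) * Nat.card {g : V ≃ₗ[F] V // g v = v}) := by ring
    _ ≤ _ := Nat.mul_le_mul_left _ (card_apply_eq_mul_le v v hv)

/-- A bound for the number of conjugates of `h` fixing a given hyperplane, when `h` fixes only one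
hyperplane. -/
theorem card_mul_conjCount_le_of_fixes_hyperplane [Finite F] [Finite V] {f : Dual F V} (hf : f ≠ 0)
    (hh : ∀ (φ : Dual F V) (a : F), (∀ y, φ (h y) = a * φ y) → ∃ b : F, φ = b • f)
    (hK : ∀ k ∈ K, ∃ a : F, ∀ y, f (k y) = a * f y) :
    (Nat.card V - 1) * conjCount K h ≤ (Nat.card F - 1) * Nat.card (V ≃ₗ[F] V) := by
  have : Finite (V ≃ₗ[F] V) := DFunLike.finite _
  have hex : ∀ g : {g : V ≃ₗ[F] V // g⁻¹ * h * g ∈ K}, ∃ b : F, b ≠ 0 ∧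
      ∀ y, f (g.1.symm y) = b * f y := by
    rintro ⟨g, hg⟩
    obtain ⟨a, ha⟩ := hK _ hg
    obtain ⟨b, hb⟩ := hh (f ∘ₗ (g.symm : V →ₗ[F] V)) a (fun y => by
      have h1 := ha (g.symm y)
      rw [LinearEquiv.mul_apply, LinearEquiv.mul_apply, g.apply_symm_apply] at h1
      exact h1)
    refine ⟨b, fun hb0 => hf ?_, fun y => LinearMap.congr_fun hb y⟩
    rw [hb0, zero_smul] at hb
    ext y
    simpa using LinearMap.congr_fun hb (g y)
  choose b hb0 hb using hex
  have hle : conjCount K h ≤ (Nat.card F - 1) * Nat.card {g : V ≃ₗ[F] V // ∀ y, f (g y) = f y} := by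
    rw [← card_ne_zero, ← Nat.card_prod]
    refine Nat.card_le_card_of_injective (fun g => (⟨b g, hb0 g⟩,
      ⟨(LinearEquiv.smulOfNeZero F V (b g) (hb0 g)) * g.1, fun y => ?_⟩)) ?_
    · have h1 := hb g (g.1 y)
      rw [LinearEquiv.symm_apply_apply] at h1
      rw [LinearEquiv.mul_apply, LinearEquiv.smulOfNeZero_apply, map_smul, smul_eq_mul, ← h1]
    · intro g g' hgg
      simp only [Prod.mk.injEq, Subtype.mk.injEq] at hgg
      obtain ⟨h1, h2⟩ := hgg
      refine Subtype.ext (LinearEquiv.ext fun y => ?_)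
      have h3 := LinearEquiv.congr_fun h2 y
      simp only [LinearEquiv.mul_apply, LinearEquiv.smulOfNeZero_apply, h1] at h3
      exact smul_right_injective V (hb0 g') h3
  calc _ ≤ (Nat.card V - 1) * ((Nat.card F - 1) *
          Nat.card {g : V ≃ₗ[F] V // ∀ y, f (g y) = f y}) := Nat.mul_le_mul_left _ hle
    _ = (Nat.card F - 1) * ((Nat.card V - 1) *
          Nat.card {g : V ≃ₗ[F] V // ∀ y, f (g y) = f y}) := by ring
    _ ≤ _ := Nat.mul_le_mul_left _ (card_dual_comp_eq_mul_le f f hf)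

end CountingVectors

section LineMul

open Module

variable {F S : Type*} [Field F] [Field S] [Algebra F S]

/-- The units of `S` acting on `F × S`, trivially on the first factor. -/
def lineMul (F S : Type*) [Field F] [Field S] [Algebra F S] :
    Sˣ →* (F × S) ≃ₗ[F] (F × S) where
  toFun w := (LinearEquiv.refl F F).prodCongr (unitMul F S w)
  map_one' := by ext <;> simp
  map_mul' w w' := by ext <;> simp

@[simp] theorem lineMul_apply (w : Sˣ) (y : F × S) : lineMul F S w y = (y.1, w * y.2) := rfl

@[simp] theorem lineMul_symm_apply (w : Sˣ) (y : F × S) :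
    (lineMul F S w).symm y = (y.1, (w : S)⁻¹ * y.2) := by
  rw [LinearEquiv.symm_apply_eq, lineMul_apply, mul_inv_cancel_left₀ w.ne_zero]

theorem forall_lineMul_mem {K : Subgroup ((F × S) ≃ₗ[F] (F × S))} {s : Sˣ}
    (hs : ∀ v, v ∈ Subgroup.zpowers s) (h : lineMul F S s ∈ K) (w : Sˣ) : lineMul F S w ∈ K := by
  obtain ⟨k, rfl⟩ := hs w
  rw [map_zpow]
  exact K.zpow_mem h k

theorem generator_ne_algebraMap (hn : 2 ≤ finrank F S) {s : Sˣ}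
    (hs : ∀ v, v ∈ Subgroup.zpowers s) (a : F) : (s : S) ≠ algebraMap F S a := by
  intro h
  have : finrank F S ≤ 1 := by
    refine finrank_le_one (1 : S) fun y => ?_
    by_cases hy : y = 0
    · exact ⟨0, by simp [hy]⟩
    · obtain ⟨k, hk⟩ := hs (Units.mk0 y hy)
      refine ⟨a ^ k, ?_⟩
      have := congrArg Units.val hk
      simp only [Units.val_zpow_eq_zpow_val, Units.val_mk0] at this
      rw [Algebra.smul_def, mul_one, map_zpow₀, ← h, this]
  omega

theorem eq_smul_of_lineMul_apply_eq_smul (hn : 2 ≤ finrank F S) {s : Sˣ}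
    (hs : ∀ v, v ∈ Subgroup.zpowers s) (w : F × S) (a : F) (h : lineMul F S s w = a • w) :
    ∃ b : F, w = b • ((1, 0) : F × S) := by
  refine ⟨w.1, ?_⟩
  have h2 : (s : S) * w.2 = a • w.2 := congrArg Prod.snd h
  rw [Algebra.smul_def] at h2
  have : w.2 = 0 := by
    by_contra h0
    exact generator_ne_algebraMap hn hs a (mul_right_cancel₀ h0 h2)
  ext <;> simp [this]

theorem eq_smul_of_comp_lineMul_eq (hn : 2 ≤ finrank F S) {s : Sˣ}
    (hs : ∀ v, v ∈ Subgroup.zpowers s) (φ : Dual F (F × S)) (a : F)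
    (h : ∀ y, φ (lineMul F S s y) = a * φ y) : ∃ b : F, φ = b • LinearMap.fst F F S := by
  have h0 : ∀ y : S, φ (0, y) = 0 := by
    intro y
    have hne : (s : S) - algebraMap F S a ≠ 0 := sub_ne_zero.2 (generator_ne_algebraMap hn hs a)
    have h1 := h (0, ((s : S) - algebraMap F S a)⁻¹ * y)
    rw [← smul_eq_mul (a := a), ← map_smul, ← sub_eq_zero, ← map_sub] at h1
    convert h1 using 2
    ext
    · simp
    · simp only [lineMul_apply, Prod.snd_sub, Prod.smul_snd]
      rw [Algebra.smul_def, ← sub_mul, mul_inv_cancel_left₀ hne]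
  refine ⟨φ (1, 0), LinearMap.ext fun y => ?_⟩
  have : y = y.1 • ((1, 0) : F × S) + (0, y.2) := by ext <;> simp
  conv_lhs => rw [this, map_add, map_smul, h0]
  simp [mul_comm]

theorem exists_apply_eq_smul_of_lineMul_mem (hn : 2 ≤ finrank F S)
    {K : Subgroup ((F × S) ≃ₗ[F] (F × S))} (hK : ∀ w, lineMul F S w ∈ K)
    (hhyp : ∃ k ∈ K, ∃ y, (k (0, y)).1 ≠ 0) (hpt : ∃ k ∈ K, (k (1, 0)).2 ≠ 0) (c : F × S) :
    ∃ k ∈ K, ∃ a : F, k c = a • ((1, 0) : F × S) := by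
  let T : F × S → Prop := fun c => ∃ k ∈ K, ∃ a : F, k c = a • ((1, 0) : F × S)
  have hmove : ∀ {c} {k}, k ∈ K → T (k c) → T c := by
    rintro c k hk ⟨k', hk', a, ha⟩
    exact ⟨k' * k, K.mul_mem hk' hk, a, ha⟩
  have hmove' : ∀ {c} {k}, k ∈ K → T c → T (k c) := by
    intro c k hk h
    refine hmove (K.inv_mem hk) ?_
    change T (k.symm (k c))
    rwa [LinearEquiv.symm_apply_apply]
  have hscale : ∀ {c} (r : F), T c → T (r • c) := by
    rintro c r ⟨k, hk, a, ha⟩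
    exact ⟨k, hk, r * a, by rw [map_smul, ha, smul_smul]⟩
  have hv : ∀ a : F, T (a, 0) := fun a => ⟨1, K.one_mem, a, by ext <;> simp⟩
  have hSS : ∀ {a : F} {y y' : S}, y ≠ 0 → y' ≠ 0 → T (a, y) → T (a, y') := by
    intro a y y' hy hy' h
    refine hmove (hK (Units.mk0 (y * y'⁻¹) (mul_ne_zero hy (inv_ne_zero hy')))) ?_
    rw [lineMul_apply, Units.val_mk0, inv_mul_cancel_right₀ hy']
    exact h
  have hRR : ∀ {a a' : F} {y y' : S}, a ≠ 0 → a' ≠ 0 → y ≠ 0 → y' ≠ 0 → T (a, y) →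
      T (a', y') := by
    intro a a' y y' ha ha' hy hy' h
    have h1 := hscale (a' * a⁻¹) h
    have h2 : (a' * a⁻¹) • ((a, y) : F × S) = (a', (a' * a⁻¹) • y) := by
      ext
      · simp [inv_mul_cancel_right₀ ha]
      · simp
    rw [h2] at h1
    exact hSS (smul_ne_zero (mul_ne_zero ha' (inv_ne_zero ha)) hy) hy' h1
  have hfinish : ∀ {a : F} {y y' : S}, a ≠ 0 → y ≠ 0 → y' ≠ 0 → T (a, y) → T (0, y') → T c := by
    intro a y y' ha hy hy' h h'
    obtain ⟨b, z⟩ := c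
    by_cases hz : z = 0
    · rw [hz]
      exact hv b
    by_cases hb : b = 0
    · rw [hb]
      exact hSS hy' hz h'
    exact hRR ha hb hy hz h
  obtain ⟨k, hk, hkv⟩ := hpt
  obtain ⟨a, z, hkv'⟩ : ∃ a z, k (1, 0) = (a, z) := ⟨_, _, rfl⟩
  have hz : z ≠ 0 := by rwa [hkv'] at hkv
  have hT : T (a, z) := by
    rw [← hkv']
    exact hmove' hk (hv 1)
  by_cases ha : a = 0
  · subst ha
    obtain ⟨y', hy'⟩ : ∃ y', y' ∉ F ∙ z := by
      by_contra! hall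
      have := finrank_le_one z fun y => Submodule.mem_span_singleton.1 (hall y)
      omega
    have hy0 : y' ≠ 0 := fun h0 => hy' (h0 ▸ Submodule.zero_mem _)
    obtain ⟨b, z', ht⟩ : ∃ b z', k.symm (0, y') = (b, z') := ⟨_, _, rfl⟩
    have hz' : z' ≠ 0 := by
      rintro rfl
      refine hy' (Submodule.mem_span_singleton.2 ⟨b, ?_⟩)
      have h1 : ((b, 0) : F × S) = b • ((1, 0) : F × S) := by ext <;> simp
      rw [LinearEquiv.symm_apply_eq, h1, map_smul, hkv'] at ht
      exact (congrArg Prod.snd ht).symm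
    have hsymm : ∀ {y}, y ≠ 0 → T (k.symm (0, y)) := fun hy =>
      hmove' (K.inv_mem hk) (hSS hz hy hT)
    by_cases hb : b = 0
    · have h1 : k.symm (0, z + y') = (1, z') := by
        have h2 : ((0, z + y') : F × S) = (0, z) + (0, y') := by ext <;> simp
        rw [h2, map_add, ht, ← hkv', LinearEquiv.symm_apply_apply, hb]
        ext <;> simp
      have h0 : z + y' ≠ 0 := fun h0 => hy' (by
        rw [← neg_eq_of_add_eq_zero_right h0]
        exact Submodule.neg_mem _ (Submodule.mem_span_singleton_self z))
      exact hfinish one_ne_zero hz' hz (h1 ▸ hsymm h0) hT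
    · exact hfinish hb hz' hz (ht ▸ hsymm hy0) hT
  · obtain ⟨k', hk', y, hy⟩ := hhyp
    obtain ⟨b, z', ht⟩ : ∃ b z', k' (0, y) = (b, z') := ⟨_, _, rfl⟩
    have hb : b ≠ 0 := by rwa [ht] at hy
    have hy0 : y ≠ 0 := by
      rintro rfl
      refine hb ?_
      have h1 : k' (0, 0) = 0 := map_zero k'
      rw [ht] at h1
      exact congrArg Prod.fst h1
    refine hfinish ha hz hy0 hT (hmove hk' ?_)
    rw [ht]
    by_cases hz' : z' = 0
    · rw [hz']
      exact hv b
    · exact hRR ha hb hz hz' hT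

theorem eq_top_of_lineMul_mem_of_transvection [Finite S] (hn : 2 ≤ finrank F S)
    {K : Subgroup ((F × S) ≃ₗ[F] (F × S))} (hK : ∀ w, lineMul F S w ∈ K)
    (hhyp : ∃ k ∈ K, ∃ y, (k (0, y)).1 ≠ 0) (hpt : ∃ k ∈ K, (k (1, 0)).2 ≠ 0) {c : F × S}
    {f : Dual F (F × S)} (hc : c ≠ 0) (hf : f ≠ 0) (hfc : f c = 0) (h : HasPersp K c f) :
    K = ⊤ := by
  have hex := exists_apply_eq_smul_of_lineMul_mem hn hK hhyp hpt
  obtain ⟨g, hg0, hgv, hg⟩ : ∃ g : Dual F (F × S), g ≠ 0 ∧ g (1, 0) = 0 ∧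
      HasPersp K ((1, 0) : F × S) g := by
    obtain ⟨k, hk, a, ha⟩ := hex c
    have ha0 : a ≠ 0 := by
      rintro rfl
      rw [zero_smul] at ha
      exact hc (k.map_eq_zero_iff.1 ha)
    have h1 := h.conj hk
    rw [ha, hasPersp_smul] at h1
    refine ⟨_, ?_, ?_, h1⟩
    · intro h0
      rw [smul_eq_zero, or_iff_right ha0] at h0
      refine hf (LinearMap.ext fun y => ?_)
      simpa using LinearMap.congr_fun h0 (k y)
    · have h2 : k.symm (a • ((1, 0) : F × S)) = c := by rw [← ha, LinearEquiv.symm_apply_apply]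
      rw [map_smul] at h2
      have h3 : f (a • k.symm ((1, 0) : F × S)) = 0 := by rw [h2, hfc]
      rw [map_smul] at h3
      exact h3
  have hψ : g ∘ₗ LinearMap.inr F F S ≠ 0 := by
    intro h0
    refine hg0 (LinearMap.ext fun y => ?_)
    have : y = y.1 • ((1, 0) : F × S) + LinearMap.inr F F S y.2 := by ext <;> simp
    rw [this, map_add, map_smul, hgv, smul_zero, zero_add]
    exact LinearMap.congr_fun h0 y.2
  have hcenter : ∀ f : Dual F (F × S), f (1, 0) = 0 → HasPersp K ((1, 0) : F × S) f := by
    intro f hfv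
    obtain ⟨b, hb⟩ := dualMul_surjective hψ (f ∘ₗ LinearMap.inr F F S)
    have hfeq : ∀ y, f y = g (0, b * y.2) := by
      intro y
      have hy : y = y.1 • ((1, 0) : F × S) + LinearMap.inr F F S y.2 := by ext <;> simp
      conv_lhs => rw [hy, map_add, map_smul, hfv, smul_zero, zero_add]
      exact (LinearMap.congr_fun hb y.2).symm
    by_cases hb0 : b = 0
    · have : f = 0 := LinearMap.ext fun y => by
        rw [hfeq, hb0, zero_mul]
        exact map_zero g
      rw [this]
      exact hasPersp_zero_right _
    · have h1 := hg.conj (hK (Units.mk0 b hb0)⁻¹)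
      convert h1 using 1
      · simp
      · ext y
        · change f (1, 0) = g ((lineMul F S (Units.mk0 b hb0)⁻¹).symm (1, 0))
          simp only [lineMul_symm_apply, mul_zero, hfv, hgv]
        · change f (0, y) = g ((lineMul F S (Units.mk0 b hb0)⁻¹).symm (0, y))
          simp [lineMul_symm_apply, -map_inv, hfeq]
  refine eq_top_of_persp_of_det (fun c f hfc => ?_) fun a ha => ?_
  · obtain ⟨k, hk, a, ha⟩ := hex c
    have h1 : HasPersp K ((1, 0) : F × S) (a • (f ∘ₗ (k.symm : (F × S) →ₗ[F] (F × S)))) := by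
      refine hcenter _ ?_
      have h2 : k.symm (a • ((1, 0) : F × S)) = c := by rw [← ha, LinearEquiv.symm_apply_apply]
      rw [map_smul] at h2
      change a • f (k.symm (1, 0)) = 0
      rw [← map_smul, h2, hfc]
    rw [← hasPersp_smul, ← ha] at h1
    have h2 := h1.conj (K.inv_mem hk)
    convert h2 using 1
    · exact (k.symm_apply_apply c).symm
    · ext y <;> exact congrArg f (k.symm_apply_apply _).symm
  · obtain ⟨u, hu⟩ := exists_det_unitMul_eq (F := F) (E := S) ha
    refine ⟨_, hK u, ?_⟩
    rw [← hu]
    have : (lineMul F S u : (F × S) →ₗ[F] (F × S)) =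
        LinearMap.prodMap LinearMap.id (unitMul F S u : S →ₗ[F] S) := rfl
    rw [this, LinearMap.det_prodMap, LinearMap.det_id, one_mul]

end LineMul

section TransvectionFreeCount

open Module

variable {F V X : Type*} [Field F] [AddCommGroup V] [Module F V] [AddCommGroup X] [Module F X]
  {π : V →ₗ[F] X} {v : V} {K : Subgroup (V ≃ₗ[F] V)}

theorem TransvectionFree.map_conj (hK : TransvectionFree K) (a : V ≃ₗ[F] V) :
    TransvectionFree (K.map (MulAut.conj a).toMonoidHom) := by
  rintro c f hc hfc ⟨_, ⟨k, hk, rfl⟩, hg⟩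
  have hg' : ∀ y, a (k (a.symm y)) = y + f y • c := hg
  have h0 : f ∘ₗ (a : V →ₗ[F] V) = 0 := by
    refine hK (a.symm c) _ (fun h => hc (a.symm.map_eq_zero_iff.1 h)) (by simp [hfc])
      ⟨k, hk, fun y => ?_⟩
    have := hg' (a y)
    rw [LinearEquiv.symm_apply_apply, ← LinearEquiv.eq_symm_apply] at this
    simpa using this
  refine LinearMap.ext fun y => ?_
  simpa using LinearMap.congr_fun h0 (a.symm y)

theorem TransvectionFree.conjCount_le [Finite V] [Finite X] (hK : TransvectionFree K)
    (hπ : Function.Surjective π) (hker : LinearMap.ker π = F ∙ v) (hv : v ≠ 0) {h : V ≃ₗ[F] V}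
    {s : X ≃ₗ[F] X} (hh : h v = v) (hs : ∀ y, s (π y) = π (h y)) (hs1 : ∀ y, s y = y → y = 0)
    {M : ℕ} (hM : ∀ K' : Subgroup (V ≃ₗ[F] V), TransvectionFree K' →
      conjCount (pointImage π v K') s ≤ M) :
    conjCount K h ≤ (Nat.card V - 1) * M := by
  have hfinV : Finite (V ≃ₗ[F] V) := DFunLike.finite _
  have hfinX : Finite (X ≃ₗ[F] X) := DFunLike.finite _
  have hπv : π v = 0 := by
    rw [← LinearMap.mem_ker, hker]; exact Submodule.mem_span_singleton_self v
  have hex : ∀ u : {u : V // u ≠ 0}, ∃ t : V ≃ₗ[F] V, t u = v :=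
    fun u => exists_linearEquiv_apply_eq u.2 hv
  choose t ht using hex
  let K' : {u : V // u ≠ 0} → Subgroup (V ≃ₗ[F] V) := fun u =>
    K.map (MulAut.conj (t u)).toMonoidHom
  have hK' : ∀ u, TransvectionFree (K' u) := fun u => hK.map_conj _
  let U : {g : V ≃ₗ[F] V // g⁻¹ * h * g ∈ K} → {u : V // u ≠ 0} := fun g =>
    ⟨g.1⁻¹ v, fun h0 => hv (g.1.symm.map_eq_zero_iff.1 h0)⟩
  have hm : ∀ g, (g.1 * (t (U g))⁻¹) v = v := by
    intro g
    have h1 : (t (U g))⁻¹ v = g.1⁻¹ v := (LinearEquiv.symm_apply_eq _).2 (ht (U g)).symm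
    rw [LinearEquiv.mul_apply, h1]
    exact g.1.apply_symm_apply v
  have hmem : ∀ g, (g.1 * (t (U g))⁻¹)⁻¹ * h * (g.1 * (t (U g))⁻¹) ∈ K' (U g) := fun g =>
    ⟨_, g.2, by simp [mul_assoc]⟩
  have hd : ∀ g, ∃ l : X ≃ₗ[F] X, ∀ y, l (π y) = π ((g.1 * (t (U g))⁻¹) y) := fun g =>
    exists_descend hπ hker (hm g)
  choose d hd using hd
  have hinv : ∀ (m : V ≃ₗ[F] V) (l : X ≃ₗ[F] X), (∀ y, l (π y) = π (m y)) →
      ∀ y, l⁻¹ (π y) = π (m⁻¹ y) := by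
    intro m l hl y
    change l.symm (π y) = π (m.symm y)
    rw [LinearEquiv.symm_apply_eq, hl, LinearEquiv.apply_symm_apply]
  have hinvv : ∀ m : V ≃ₗ[F] V, m v = v → m⁻¹ v = v := fun m hm =>
    (LinearEquiv.symm_apply_eq m).2 hm.symm
  have hfix : ∀ g, ((g.1 * (t (U g))⁻¹)⁻¹ * h * (g.1 * (t (U g))⁻¹)) v = v := by
    intro g
    rw [LinearEquiv.mul_apply, hm, LinearEquiv.mul_apply, hh, hinvv _ (hm g)]
  have hdesc : ∀ g y, ((d g)⁻¹ * s * d g) (π y) =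
      π (((g.1 * (t (U g))⁻¹)⁻¹ * h * (g.1 * (t (U g))⁻¹)) y) := by
    intro g y
    rw [LinearEquiv.mul_apply, hd, LinearEquiv.mul_apply, hs, hinv _ _ (hd g)]
    rfl
  have hd' : ∀ g, (d g)⁻¹ * s * d g ∈ pointImage π v (K' (U g)) := fun g =>
    ⟨_, hmem g, hfix g, hdesc g⟩
  let Φ : {g : V ≃ₗ[F] V // g⁻¹ * h * g ∈ K} →
      Σ u : {u : V // u ≠ 0}, {l : X ≃ₗ[F] X // l⁻¹ * s * l ∈ pointImage π v (K' u)} :=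
    fun g => ⟨U g, d g, hd' g⟩
  have hcancel : ∀ m m' : V ≃ₗ[F] V, m v = v → m' v = v → (∀ y, π (m y) = π (m' y)) →
      m⁻¹ * h * m = m'⁻¹ * h * m' → m = m' := by
    intro m m' hmv hmv' hmm heq
    have hcomm : m' * m⁻¹ * h = h * (m' * m⁻¹) := by
      have : m' * (m⁻¹ * h * m) * m⁻¹ = m' * (m'⁻¹ * h * m') * m⁻¹ := by rw [heq]
      simpa [mul_assoc] using this
    have htπ : ∀ y, π ((m' * m⁻¹) y) = π y := by
      intro y
      rw [LinearEquiv.mul_apply, ← hmm]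
      exact congrArg π (m.apply_symm_apply y)
    obtain ⟨f, hf⟩ := exists_dual_eq_smul hker hv
      (φ := ((m' * m⁻¹ : V ≃ₗ[F] V) : V →ₗ[F] V) - LinearMap.id) (fun y => by
        rw [LinearMap.sub_apply, map_sub, LinearEquiv.coe_coe, htπ, LinearMap.id_apply, sub_self])
    have hfy : ∀ y, (m' * m⁻¹) y = y + f y • v := fun y => by
      rw [← hf]
      simp
    have hfh : ∀ y, f (h y) = f y := by
      intro y
      have h1 : (m' * m⁻¹) (h y) = h ((m' * m⁻¹) y) := LinearEquiv.congr_fun hcomm y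
      rw [hfy, hfy, map_add, map_smul, hh,
        add_right_inj] at h1
      exact smul_left_injective F hv h1
    have hfv : f v = 0 := by
      have h1 := hfy v
      rw [LinearEquiv.mul_apply, hinvv m hmv, hmv', left_eq_add, smul_eq_zero] at h1
      exact h1.resolve_right hv
    have hsurj : Function.Surjective fun y => s y - y := by
      refine Finite.surjective_of_injective fun y z hyz => ?_
      refine sub_eq_zero.1 (hs1 (y - z) ?_)
      rw [map_sub, sub_eq_sub_iff_sub_eq_sub]
      exact hyz
    have hf0 : ∀ y, f y = 0 := by
      intro y
      obtain ⟨z, hz⟩ := hsurj (π y)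
      obtain ⟨w, rfl⟩ := hπ z
      have h1 : y - (h w - w) ∈ LinearMap.ker π := by
        rw [LinearMap.mem_ker, map_sub, map_sub, ← hs]
        exact sub_eq_zero.2 hz.symm
      rw [hker] at h1
      obtain ⟨r, hr⟩ := Submodule.mem_span_singleton.1 h1
      have h2 : y = r • v + (h w - w) := by rw [hr]; abel
      rw [h2, map_add, map_smul, hfv, map_sub, hfh]
      simp
    have h1 : m' * m⁻¹ = 1 := by
      ext y
      rw [hfy, hf0]
      simp
    exact (mul_inv_eq_one.1 h1).symm
  have hΦ : Function.Injective Φ := by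
    intro g g' hgg
    have hU : U g = U g' := congrArg Sigma.fst hgg
    have hdd : d g = d g' := by
      have : ∀ (a b : Σ u : {u : V // u ≠ 0},
          {l : X ≃ₗ[F] X // l⁻¹ * s * l ∈ pointImage π v (K' u)}), a = b → a.2.1 = b.2.1 := by
        rintro a _ rfl
        rfl
      exact this _ _ hgg
    have hππ : ∀ y, π ((g.1 * (t (U g))⁻¹) y) = π ((g'.1 * (t (U g'))⁻¹) y) := fun y => by
      rw [← hd, ← hd, hdd]
    have h1 := hcancel _ _ (hm g) (hm g') hππ
      ((hK' (U g')).eq_of_descend hker hv (hU ▸ hmem g) (hmem g') (hfix g) (hfix g') fun y => by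
        rw [← hdesc, ← hdesc, hdd])
    rw [hU] at h1
    exact Subtype.ext (mul_right_cancel h1)
  calc conjCount K h ≤ Nat.card (Σ u : {u : V // u ≠ 0},
      {l : X ≃ₗ[F] X // l⁻¹ * s * l ∈ pointImage π v (K' u)}) :=
        Nat.card_le_card_of_injective Φ hΦ
    _ ≤ (Nat.card V - 1) * M := by
      have := Fintype.ofFinite {u : V // u ≠ 0}
      rw [Nat.card_sigma]
      refine (Finset.sum_le_card_nsmul _ _ M fun u _ => hM _ (hK' u)).trans ?_
      rw [smul_eq_mul, Finset.card_univ, ← Nat.card_eq_fintype_card, card_ne_zero]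

end TransvectionFreeCount

section LineMulCount

open Module

variable {F S : Type*} [Field F] [Field S] [Algebra F S]
  {K : Subgroup ((F × S) ≃ₗ[F] (F × S))}

theorem ker_snd_eq_span : LinearMap.ker (LinearMap.snd F F S) = F ∙ ((1, 0) : F × S) := by
  ext y
  rw [LinearMap.mem_ker, Submodule.mem_span_singleton]
  constructor
  · intro h
    have h' : y.2 = 0 := h
    exact ⟨y.1, by ext <;> simp [h']⟩
  · rintro ⟨a, rfl⟩
    simp

theorem one_zero_ne_zero {F S : Type*} [Field F] [Field S] : ((1, 0) : F × S) ≠ 0 :=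
  fun h => one_ne_zero (congrArg Prod.fst h)

theorem finrank_field_prod [Finite S] : finrank F (F × S) = finrank F S + 1 := by
  have : Finite F := Finite.of_injective _ (algebraMap F S).injective
  rw [finrank_prod, finrank_self, add_comm]

theorem conjCount_unitMul_mul_card_le [Finite S] (hn : finrank F S = 2) (hq : 3 ≤ Nat.card F)
    {s : Sˣ} (hs : ∀ w : Sˣ, w ∈ Subgroup.zpowers s) {L : Subgroup (S ≃ₗ[F] S)} (hL : L ≠ ⊤) :
    Nat.card F * conjCount L (unitMul F S s) ≤ 2 * Nat.card (S ≃ₗ[F] S) := by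
  have : Finite F := Finite.of_injective _ (algebraMap F S).injective
  have : Finite (S ≃ₗ[F] S) := DFunLike.finite _
  refine conjCount_induction
    (P := fun a _ => Nat.card F * a ≤ 2 * Nat.card (S ≃ₗ[F] S)) (by simp) ?_
  intro L' hL' hsL
  have hidx : Nat.card F ≤ L'.index := by
    by_contra! hlt
    refine hL' hL (eq_top_of_persp_of_det (fun c f hfc => hasPersp_of_index_lt ?_ c f hfc)
      fun a ha => ?_)
    · rw [hn]
      simpa using hlt
    · obtain ⟨u, hu⟩ := exists_det_unitMul_eq (F := F) (E := S) ha
      exact ⟨_, forall_unitMul_mem hs hsL u, hu⟩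
  have hf := card_fixedBy_unitMul_le_two hn hq (K := L') hs
  rw [conjCount_eq_card_fixedBy_mul, ← L'.index_mul_card, ← mul_assoc, ← mul_assoc]
  exact Nat.mul_le_mul_right _ (by rw [mul_comm]; exact Nat.mul_le_mul hf hidx)

theorem TransvectionFree.conjCount_lineMul_le [Finite S] (hK : TransvectionFree K)
    (hn : 2 ≤ finrank F S) {s : Sˣ} (hs : ∀ w : Sˣ, w ∈ Subgroup.zpowers s) {A B : ℕ} (hA : 0 < A)
    (hAB : ∀ K' : Subgroup ((F × S) ≃ₗ[F] (F × S)), TransvectionFree K' →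
      A * conjCount (pointImage (LinearMap.snd F F S) (1, 0) K') (unitMul F S s) ≤
        B * Nat.card (S ≃ₗ[F] S)) :
    Nat.card F ^ finrank F S * A * conjCount K (lineMul F S s) ≤
      B * Nat.card ((F × S) ≃ₗ[F] (F × S)) := by
  have : Finite F := Finite.of_injective _ (algebraMap F S).injective
  have h1 := hK.conjCount_le (π := LinearMap.snd F F S) (v := (1, 0)) (h := lineMul F S s)
    (s := unitMul F S s) (M := B * Nat.card (S ≃ₗ[F] S) / A) Prod.snd_surjective ker_snd_eq_span
    one_zero_ne_zero (by simp) (fun y => rfl) (fun y hy => ?_) fun K' hK' => ?_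
  · rw [card_linearEquiv_eq (F := F) (X := S) finrank_field_prod]
    calc _ ≤ Nat.card F ^ finrank F S * A *
          ((Nat.card (F × S) - 1) * (B * Nat.card (S ≃ₗ[F] S) / A)) := Nat.mul_le_mul_left _ h1
      _ = Nat.card F ^ finrank F S * (Nat.card (F × S) - 1) *
          (A * (B * Nat.card (S ≃ₗ[F] S) / A)) := by ring
      _ ≤ Nat.card F ^ finrank F S * (Nat.card (F × S) - 1) * (B * Nat.card (S ≃ₗ[F] S)) :=
        Nat.mul_le_mul_left _ (Nat.mul_div_le _ _)
      _ = _ := by ring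
  · by_contra h0
    refine generator_ne_algebraMap (F := F) hn hs 1 (mul_right_cancel₀ h0 ?_)
    rw [map_one, one_mul]
    exact hy
  · rw [Nat.le_div_iff_mul_le hA, mul_comm]
    exact hAB K' hK'

theorem TransvectionFree.pow_mul_conjCount_lineMul_le [Finite S] (hK : TransvectionFree K)
    (hn : 3 ≤ finrank F S) (h42 : finrank F S = 3 → Nat.card F ≠ 2) {s : Sˣ}
    (hs : ∀ w : Sˣ, w ∈ Subgroup.zpowers s) :
    Nat.card F ^ (2 * finrank F S) * conjCount K (lineMul F S s) ≤
      Nat.card ((F × S) ≃ₗ[F] (F × S)) := by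
  have : Finite F := Finite.of_injective _ (algebraMap F S).injective
  have h := hK.conjCount_lineMul_le (by omega) hs (A := Nat.card F ^ finrank F S) (B := 1)
    (pow_pos Nat.card_pos _) fun K' hK' => ?_
  · rwa [← pow_add, ← two_mul, one_mul] at h
  · rw [one_mul]
    refine pow_mul_conjCount_unitMul_le hn (fun htop => ?_) hs
    have h1 := hK'.pow_le_index_pointImage (π := LinearMap.snd F F S) Prod.snd_surjective
      ker_snd_eq_span one_zero_ne_zero hn h42
    rw [htop, Subgroup.index_top] at h1
    have h2 : 1 < Nat.card F ^ (finrank F S - 1) :=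
      Nat.one_lt_pow (by omega) Finite.one_lt_card
    omega

theorem card_div_mul_conjCount_lineMul_le [Finite S] (hn : 2 ≤ finrank F S)
    (h3 : finrank F S = 2 → 3 ≤ Nat.card F) (h42 : finrank F S = 3 → Nat.card F ≠ 2) {s : Sˣ}
    (hs : ∀ w : Sˣ, w ∈ Subgroup.zpowers s) (htop : K ≠ ⊤) :
    (Nat.card (F × S) - 1) / (Nat.card F - 1) * conjCount K (lineMul F S s) ≤
      Nat.card ((F × S) ≃ₗ[F] (F × S)) := by
  have : Finite F := Finite.of_injective _ (algebraMap F S).injective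
  have hq : 1 < Nat.card F := Finite.one_lt_card
  refine conjCount_induction (P := fun a _ => (Nat.card (F × S) - 1) / (Nat.card F - 1) * a ≤
      Nat.card ((F × S) ≃ₗ[F] (F × S))) (by simp) ?_
  intro K' hK' hsK
  have hne := hK' htop
  have hall := forall_lineMul_mem hs hsK
  have hdiv := Nat.mul_div_le (Nat.card (F × S) - 1) (Nat.card F - 1)
  have hred : (Nat.card (F × S) - 1) * conjCount K' (lineMul F S s) ≤
      (Nat.card F - 1) * Nat.card ((F × S) ≃ₗ[F] (F × S)) →
      (Nat.card (F × S) - 1) / (Nat.card F - 1) * conjCount K' (lineMul F S s) ≤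
      Nat.card ((F × S) ≃ₗ[F] (F × S)) := by
    intro h
    refine Nat.le_of_mul_le_mul_left (c := Nat.card F - 1) ?_ (by omega)
    rw [← mul_assoc]
    exact (Nat.mul_le_mul_right _ hdiv).trans h
  by_cases hTF : TransvectionFree K'
  · have hV : Nat.card (F × S) = Nat.card F ^ (finrank F S + 1) := by
      rw [natCard_eq_pow_finrank (K := F), finrank_field_prod]
    by_cases h2 : finrank F S = 2
    · have h := hTF.conjCount_lineMul_le hn hs (A := Nat.card F) (B := 2) Nat.card_pos
        fun K'' hK'' => conjCount_unitMul_mul_card_le h2 (h3 h2) hs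
          (hK''.pointImage_ne_top Prod.snd_surjective ker_snd_eq_span one_zero_ne_zero hn (h3 h2))
      rw [← pow_succ, ← hV] at h
      have h4 : 2 * ((Nat.card (F × S) - 1) / (Nat.card F - 1)) ≤ Nat.card (F × S) :=
        (Nat.mul_le_mul_right _ (by have := h3 h2; omega)).trans (hdiv.trans (Nat.sub_le _ _))
      refine Nat.le_of_mul_le_mul_left (c := 2) ?_ two_pos
      rw [← mul_assoc]
      exact (Nat.mul_le_mul_right _ h4).trans h
    · refine le_trans (Nat.mul_le_mul_right _ ?_)
        (hTF.pow_mul_conjCount_lineMul_le (by omega) h42 hs)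
      refine (Nat.div_le_self _ _).trans ((Nat.sub_le _ _).trans ?_)
      rw [hV]
      exact Nat.pow_le_pow_right hq.le (by omega)
  · simp only [TransvectionFree, not_forall] at hTF
    obtain ⟨c, f, hc, hfc, hp, hf⟩ := hTF
    by_cases hpt : ∃ k ∈ K', (k (1, 0)).2 ≠ 0
    · by_cases hhyp : ∃ k ∈ K', ∃ y, (k (0, y)).1 ≠ 0
      · exact absurd (eq_top_of_lineMul_mem_of_transvection hn hall hhyp hpt hc hf hfc hp) hne
      · push Not at hhyp
        refine hred (card_mul_conjCount_le_of_fixes_hyperplane (f := LinearMap.fst F F S)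
          (fun h => ?_) (eq_smul_of_comp_lineMul_eq hn hs) fun k hk => ⟨(k (1, 0)).1, fun y => ?_⟩)
        · have := LinearMap.congr_fun h (1, 0)
          simp at this
        · have hy : y = y.1 • ((1, 0) : F × S) + (0, y.2) := by ext <;> simp
          change (k y).1 = _
          conv_lhs => rw [hy, map_add, map_smul, Prod.fst_add, hhyp k hk]
          simp [mul_comm]
    · push Not at hpt
      refine hred (card_mul_conjCount_le_of_fixes_point (v := (1, 0)) one_zero_ne_zero
        (eq_smul_of_lineMul_apply_eq_smul hn hs) fun k hk => ⟨(k (1, 0)).1, ?_⟩)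
      ext <;> simp [hpt k hk]

end LineMulCount

section AutCongr

open Module

variable {F V W : Type*} [Field F] [AddCommGroup V] [Module F V] [AddCommGroup W] [Module F W]

/-- Conjugation by a linear equivalence, as an isomorphism of general linear groups. -/
def linearAutCongr (e : V ≃ₗ[F] W) : (V ≃ₗ[F] V) ≃* (W ≃ₗ[F] W) where
  toFun g := e.symm ≪≫ₗ g ≪≫ₗ e
  invFun g := e ≪≫ₗ g ≪≫ₗ e.symm
  left_inv g := by ext; simp
  right_inv g := by ext; simp
  map_mul' g g' := by ext; simp

@[simp] theorem linearAutCongr_apply (e : V ≃ₗ[F] W) (g : V ≃ₗ[F] V) (y : W) :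
    linearAutCongr e g y = e (g (e.symm y)) := rfl

@[simp] theorem linearAutCongr_symm_apply (e : V ≃ₗ[F] W) (g : W ≃ₗ[F] W) (y : V) :
    (linearAutCongr e).symm g y = e.symm (g (e y)) := rfl

theorem hasPersp_of_map_linearAutCongr {e : V ≃ₗ[F] W} {K : Subgroup (V ≃ₗ[F] V)} {c : W}
    {f : Dual F W} (h : HasPersp (K.map (linearAutCongr e).toMonoidHom) c f) :
    HasPersp K (e.symm c) (f ∘ₗ (e : V →ₗ[F] W)) := by
  obtain ⟨_, ⟨k, hk, rfl⟩, hg⟩ := h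
  refine ⟨k, hk, fun y => ?_⟩
  have h1 : e (k (e.symm (e y))) = e y + f (e y) • c := hg (e y)
  rw [LinearEquiv.symm_apply_apply, ← LinearEquiv.eq_symm_apply] at h1
  simpa using h1

theorem TransvectionFree.map_linearAutCongr {K : Subgroup (V ≃ₗ[F] V)} (hK : TransvectionFree K)
    (e : V ≃ₗ[F] W) : TransvectionFree (K.map (linearAutCongr e).toMonoidHom) := by
  intro c f hc hfc h
  have h0 := hK _ _ (fun h => hc (e.symm.map_eq_zero_iff.1 h)) (by simp [hfc])
    (hasPersp_of_map_linearAutCongr h)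
  refine LinearMap.ext fun y => ?_
  simpa using LinearMap.congr_fun h0 (e.symm y)

end AutCongr

section SingerLine

open Module

variable {F E S : Type*} [Field F] [Field E] [Algebra F E] [Field S] [Algebra F S]
  {K : Subgroup (E ≃ₗ[F] E)} {e : E ≃ₗ[F] F × S}

theorem eq_top_of_unitMul_mem_of_lineMul_mem [Finite E] (hn : finrank F E = 3)
    (hq : 3 ≤ Nat.card F) (hE : ∀ u, unitMul F E u ∈ K)
    (hS : ∀ w, lineMul F S w ∈ K.map (linearAutCongr e).toMonoidHom) : K = ⊤ := by
  have : Finite F := Finite.of_injective _ (algebraMap F E).injective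
  obtain ⟨r, hr0, hr1⟩ : ∃ r : F, r ≠ 0 ∧ r ≠ 1 := by
    classical
    have := Fintype.ofFinite F
    rw [Nat.card_eq_fintype_card] at hq
    obtain ⟨r, hr⟩ := Finset.exists_mem_notMem_of_card_lt_card (s := ({0, 1} : Finset F))
      (t := Finset.univ) ((Finset.card_le_two).trans_lt (by rw [Finset.card_univ]; omega))
    exact ⟨r, by simpa using hr⟩
  have hr0' : algebraMap F E r⁻¹ ≠ 0 := by simpa using hr0
  have hr0'' : algebraMap F S r ≠ 0 := by simpa using hr0
  have h1 : HasPersp (K.map (linearAutCongr e).toMonoidHom) ((1, 0) : F × S)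
      ((r⁻¹ - 1) • LinearMap.fst F F S) := by
    refine ⟨_, mul_mem ⟨_, hE (Units.mk0 _ hr0'), rfl⟩ (hS (Units.mk0 _ hr0'')), fun y => ?_⟩
    have h2 : ∀ z : F × S, (linearAutCongr e).toMonoidHom (unitMul F E (Units.mk0 _ hr0')) z =
        r⁻¹ • z := by
      intro z
      change e (algebraMap F E r⁻¹ * e.symm z) = _
      rw [← Algebra.smul_def, map_smul, LinearEquiv.apply_symm_apply]
    rw [LinearEquiv.mul_apply, h2]
    ext
    · simp
      ring
    · simp only [lineMul_apply, Units.val_mk0, ← Algebra.smul_def, Prod.smul_snd, smul_smul,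
        inv_mul_cancel₀ hr0]
      simp
  refine eq_top_of_unitMul_mem_of_homology hn hE (c := e.symm (1, 0)) ?_
    (hasPersp_of_map_linearAutCongr h1)
  simp only [LinearMap.comp_apply, LinearEquiv.coe_coe, LinearEquiv.apply_symm_apply,
    LinearMap.smul_apply, LinearMap.fst_apply, smul_eq_mul, mul_one]
  rw [sub_ne_zero]
  intro h
  exact hr1 (inv_eq_one.1 h)

theorem pow_le_index_of_lineMul_mem [Finite E] [Finite S] (hn : 4 ≤ finrank F E)
    (h42 : finrank F E = 4 → Nat.card F ≠ 2) (htop : K ≠ ⊤) (hE : ∀ u, unitMul F E u ∈ K) {s : Sˣ}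
    (hs : ∀ w : Sˣ, w ∈ Subgroup.zpowers s)
    (hS : lineMul F S s ∈ K.map (linearAutCongr e).toMonoidHom) :
    Nat.card F ^ (2 * finrank F S) ≤ K.index := by
  have : Finite F := Finite.of_injective _ (algebraMap F E).injective
  have : Finite (S ≃ₗ[F] S) := DFunLike.finite _
  have hdim : finrank F E = finrank F S + 1 := by rw [e.finrank_eq, finrank_field_prod]
  have hfree := (transvectionFree_of_unitMul_mem (by omega) htop hE).map_linearAutCongr e
  have hidx : (K.map (linearAutCongr e).toMonoidHom).index = K.index :=
    K.index_map_equiv (linearAutCongr e)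
  have h1 := hfree.index_eq (π := LinearMap.snd F F S) (v := (1, 0)) Prod.snd_surjective
    ker_snd_eq_span one_zero_ne_zero fun w hw => ?_
  · rw [← hidx, h1, two_mul, pow_add]
    refine Nat.mul_le_mul_left _ ?_
    have hmem : unitMul F S s ∈ pointImage (LinearMap.snd F F S) (1, 0)
        (K.map (linearAutCongr e).toMonoidHom) := ⟨_, hS, by simp, fun y => rfl⟩
    have hne : pointImage (LinearMap.snd F F S) (1, 0)
        (K.map (linearAutCongr e).toMonoidHom) ≠ ⊤ := by
      intro h
      have h2 := hfree.pow_le_index_pointImage (π := LinearMap.snd F F S) Prod.snd_surjective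
        ker_snd_eq_span one_zero_ne_zero (by omega) (by intro h; exact h42 (by omega))
      rw [h, Subgroup.index_top] at h2
      have h3 : 1 < Nat.card F ^ (finrank F S - 1) :=
        Nat.one_lt_pow (by omega) Finite.one_lt_card
      omega
    have h4 := pow_mul_card_fixedBy_le_of_unitMul_mem (by omega) hne (forall_unitMul_mem hs hmem) hs
    refine (Nat.le_mul_of_pos_right _ ?_).trans h4
    have : Nonempty (MulAction.fixedBy ((S ≃ₗ[F] S) ⧸ pointImage (LinearMap.snd F F S) (1, 0)
        (K.map (linearAutCongr e).toMonoidHom)) (unitMul F S s)) := by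
      refine ⟨((1 : S ≃ₗ[F] S) : (S ≃ₗ[F] S) ⧸ _), ?_⟩
      rw [MulAction.mem_fixedBy, MulAction.Quotient.smul_coe, smul_eq_mul, mul_one, QuotientGroup.eq,
        mul_one]
      exact inv_mem hmem
    exact Nat.card_pos
  · have h0 : e.symm (1, 0) ≠ 0 := fun h => one_zero_ne_zero (e.symm.map_eq_zero_iff.1 h)
    have h0' : e.symm w ≠ 0 := fun h => hw (e.symm.map_eq_zero_iff.1 h)
    refine ⟨_, ⟨_, hE (Units.mk0 (e.symm w * (e.symm (1, 0))⁻¹)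
      (mul_ne_zero h0' (inv_ne_zero h0))), rfl⟩, ?_⟩
    change e (e.symm w * (e.symm (1, 0))⁻¹ * e.symm (1, 0)) = w
    rw [inv_mul_cancel_right₀ h0, LinearEquiv.apply_symm_apply]

theorem pow_mul_add_le {q n f : ℕ} (hq : 2 ≤ q) (hn : 4 ≤ n) (h42 : n = 4 → q ≠ 2)
    (hf : (n = 4 → 4 ≤ q) → (n = 5 → 3 ≤ q) → f ≤ q ^ (n - 3)) (hf' : 3 * f < 4 * n) :
    q ^ n * f + (q ^ n - 1) / (q - 1) ≤ q ^ (2 * (n - 1)) := by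
  by_cases h4 : n = 4 ∧ q = 3
  · obtain ⟨rfl, rfl⟩ := h4
    norm_num
    omega
  by_cases h5 : n = 5 ∧ q = 2
  · obtain ⟨rfl, rfl⟩ := h5
    norm_num
    omega
  have hf1 := hf (fun h => by have := h42 h; omega) (fun h => by omega)
  obtain ⟨m, rfl⟩ : ∃ m, n = m + 3 := ⟨n - 3, by omega⟩
  have h1 : (q ^ (m + 3) - 1) / (q - 1) ≤ q ^ (m + 3) * q ^ m :=
    (Nat.div_le_self _ _).trans ((Nat.sub_le _ _).trans
      (Nat.le_mul_of_pos_right _ (pow_pos (by omega) _)))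
  have h2 : q ^ (2 * (m + 3 - 1)) = q * (q ^ (m + 3) * q ^ m) := by
    rw [← pow_add, ← pow_succ']
    congr 1
    omega
  have h3 : q ^ (m + 3) * f ≤ q ^ (m + 3) * q ^ m := Nat.mul_le_mul_left _ hf1
  rw [h2]
  nlinarith [Nat.mul_le_mul_right (q ^ (m + 3) * q ^ m) hq]

/-- The weight inequality for a Singer cycle and a generator of a smaller Singer cycle. -/
theorem singer_line_weights [Finite E] [Finite S] (e : E ≃ₗ[F] F × S) (hn : 3 ≤ finrank F E)
    (h3 : finrank F E = 3 → 3 ≤ Nat.card F) (h42 : finrank F E = 4 → Nat.card F ≠ 2) {u : Eˣ}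
    (hu : ∀ w : Eˣ, w ∈ Subgroup.zpowers u) {s : Sˣ} (hs : ∀ w : Sˣ, w ∈ Subgroup.zpowers s)
    (htop : K ≠ ⊤) :
    Nat.card E * conjCount K (unitMul F E u) + (Nat.card E - 1) / (Nat.card F - 1) *
      conjCount K ((linearAutCongr e).symm (lineMul F S s)) ≤ Nat.card (E ≃ₗ[F] E) := by
  have : Finite F := Finite.of_injective _ (algebraMap F E).injective
  have : Finite (E ≃ₗ[F] E) := DFunLike.finite _
  have hdim : finrank F E = finrank F S + 1 := by rw [e.finrank_eq, finrank_field_prod]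
  have hE := natCard_eq_pow_finrank (K := F) (V := E)
  have hcardV : Nat.card (F × S) = Nat.card E := Nat.card_congr e.symm.toEquiv
  have hcardG : Nat.card ((F × S) ≃ₗ[F] (F × S)) = Nat.card (E ≃ₗ[F] E) :=
    Nat.card_congr (linearAutCongr e).symm.toEquiv
  have hmap : ∀ (K : Subgroup (E ≃ₗ[F] E)), conjCount (K.map (linearAutCongr e).toMonoidHom)
      (lineMul F S s) = conjCount K ((linearAutCongr e).symm (lineMul F S s)) := by
    intro K
    rw [← conjCount_map (linearAutCongr e), MulEquiv.apply_symm_apply]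
  have hmapne : ∀ {K : Subgroup (E ≃ₗ[F] E)}, K ≠ ⊤ →
      K.map (linearAutCongr e).toMonoidHom ≠ ⊤ := by
    intro K hK h
    refine hK (Subgroup.map_injective (f := (linearAutCongr e).toMonoidHom) (linearAutCongr e).injective ?_)
    rw [h]
    exact (Subgroup.map_top_of_surjective _ (linearAutCongr e).surjective).symm
  by_cases hx : ∃ g : E ≃ₗ[F] E, g⁻¹ * unitMul F E u * g ∈ K
  swap
  · have h0 : conjCount K (unitMul F E u) = 0 := by
      rw [conjCount, Nat.card_eq_zero]
      exact Or.inl ⟨fun g => hx ⟨g.1, g.2⟩⟩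
    rw [h0, mul_zero, zero_add, ← hmap, ← hcardV, ← hcardG]
    exact card_div_mul_conjCount_lineMul_le (by omega) (fun h => h3 (by omega))
      (fun h => h42 (by omega)) hs (hmapne htop)
  obtain ⟨g, hg⟩ := hx
  obtain ⟨K', hK', htop', hxK', hhK'⟩ : ∃ K' : Subgroup (E ≃ₗ[F] E), unitMul F E u ∈ K' ∧ K' ≠ ⊤ ∧
      conjCount K' (unitMul F E u) = conjCount K (unitMul F E u) ∧
      conjCount K' ((linearAutCongr e).symm (lineMul F S s)) =
        conjCount K ((linearAutCongr e).symm (lineMul F S s)) := by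
    refine ⟨K.map (MulAut.conj g).toMonoidHom, ⟨_, hg, by simp [mul_assoc]⟩, fun h => htop ?_,
      conjCount_map_conj _ _ _, conjCount_map_conj _ _ _⟩
    refine Subgroup.map_injective (f := (MulAut.conj g).toMonoidHom) (MulAut.conj g).injective ?_
    rw [h]
    exact (Subgroup.map_top_of_surjective _ (MulAut.conj g).surjective).symm
  rw [← hxK', ← hhK']
  have hall := forall_unitMul_mem hu hK'
  by_cases hh : ∃ g : E ≃ₗ[F] E, g⁻¹ * (linearAutCongr e).symm (lineMul F S s) * g ∈ K'
  swap
  · have h0 : conjCount K' ((linearAutCongr e).symm (lineMul F S s)) = 0 := by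
      rw [conjCount, Nat.card_eq_zero]
      exact Or.inl ⟨fun g => hh ⟨g.1, g.2⟩⟩
    rw [h0, mul_zero, add_zero, hE]
    exact pow_mul_conjCount_unitMul_le hn htop' hu
  obtain ⟨g, hg⟩ := hh
  have hmem : lineMul F S s ∈ K'.map (linearAutCongr (g ≪≫ₗ e)).toMonoidHom := by
    refine ⟨_, hg, LinearEquiv.ext fun y => ?_⟩
    have h1 : ∀ z, g (g⁻¹ z) = z := fun z => g.apply_symm_apply z
    change e (g (g⁻¹ (e.symm (lineMul F S s (e (g (g.symm (e.symm y)))))))) = _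
    rw [h1]
    simp
  obtain hn3 | hn4 : finrank F E = 3 ∨ 4 ≤ finrank F E := by omega
  · exact absurd (eq_top_of_unitMul_mem_of_lineMul_mem hn3 (h3 hn3) hall
      (forall_lineMul_mem hs hmem)) htop'
  have hidx := pow_le_index_of_lineMul_mem hn4 h42 htop' hall hs hmem
  have hfree := (transvectionFree_of_unitMul_mem hn htop' hall).map_linearAutCongr e
  have hB := hfree.pow_mul_conjCount_lineMul_le (by omega) (fun h => h42 (by omega)) hs
  rw [hmap, hcardG] at hB
  have harith := pow_mul_add_le (q := Nat.card F) (n := finrank F E)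
    (f := Nat.card (MulAction.fixedBy ((E ≃ₗ[F] E) ⧸ K') (unitMul F E u))) Finite.one_lt_card hn4 h42
    (fun h4 h5 => card_fixedBy_le_pow_sub_three hn4 h4 h5 hu) (three_mul_card_fixedBy_lt hn hu)
  rw [conjCount_eq_card_fixedBy_mul K' (unitMul F E u), hE]
  have hr : finrank F E - 1 = finrank F S := by omega
  rw [hr] at harith
  have hcard := K'.index_mul_card
  generalize Nat.card (MulAction.fixedBy ((E ≃ₗ[F] E) ⧸ K') (unitMul F E u)) = f at *
  generalize conjCount K' ((linearAutCongr e).symm (lineMul F S s)) = c at *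
  generalize (Nat.card F ^ finrank F E - 1) / (Nat.card F - 1) = N at *
  generalize Nat.card F ^ finrank F E = Q at *
  have hpos : 0 < Nat.card F ^ (2 * finrank F S) := pow_pos Nat.card_pos _
  generalize Nat.card F ^ (2 * finrank F S) = R at *
  refine Nat.le_of_mul_le_mul_left (c := R) ?_ hpos
  have h5 : R * Nat.card K' ≤ Nat.card (E ≃ₗ[F] E) := by
    rw [← hcard]
    exact Nat.mul_le_mul_right _ hidx
  calc R * (Q * (f * Nat.card K') + N * c) = Q * f * (R * Nat.card K') + N * (R * c) := by ring
    _ ≤ Q * f * Nat.card (E ≃ₗ[F] E) + N * Nat.card (E ≃ₗ[F] E) :=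
      add_le_add (Nat.mul_le_mul_left _ h5) (Nat.mul_le_mul_left _ hB)
    _ = (Q * f + N) * Nat.card (E ≃ₗ[F] E) := by ring
    _ ≤ R * Nat.card (E ≃ₗ[F] E) := Nat.mul_le_mul_right _ harith

/-- The covering number of the affine group, away from the small exceptions. -/
theorem coveringNumber_affineEquiv_of_lineMul [Finite E] [Finite S] (e : E ≃ₗ[F] F × S)
    (hn : 3 ≤ finrank F E) (h3 : finrank F E = 3 → 3 ≤ Nat.card F)
    (h42 : finrank F E = 4 → Nat.card F ≠ 2) :
    coveringNumber (E ≃ᵃ[F] E) =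
      ((Nat.card E + (Nat.card E - 1) / (Nat.card F - 1) : ℕ) : ℕ∞) := by
  have : Finite F := Finite.of_injective _ (algebraMap F E).injective
  obtain ⟨u, hu⟩ := IsCyclic.exists_generator (α := Eˣ)
  obtain ⟨s, hs⟩ := IsCyclic.exists_generator (α := Sˣ)
  have hS : 0 < finrank F S := by
    have : finrank F E = finrank F S + 1 := by rw [e.finrank_eq, finrank_field_prod]
    omega
  refine coveringNumber_affineEquiv (by omega)
    (fun K hK => singer_line_weights e hn h3 h42 hu hs hK) (Nat.card S - 1) ?_
    (e.symm (1, 0)) ?_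
  · rw [← map_pow, ← map_pow, ← Nat.card_units, pow_card_eq_one', map_one, map_one]
  · have h1 : ∀ i : ℕ, ((linearAutCongr e).symm (lineMul F S s) ^ i) (e.symm (1, 0)) =
        e.symm (1, 0) := by
      intro i
      rw [← map_pow, ← map_pow, linearAutCongr_symm_apply, LinearEquiv.apply_symm_apply,
        lineMul_apply, mul_zero]
    rw [Finset.sum_congr rfl fun i _ => h1 i, Finset.sum_const, Finset.card_range]
    have hq0 : ((Nat.card S - 1 : ℕ) : F) = -1 := by
      rw [natCard_eq_pow_finrank (K := F) (V := S), Nat.cast_sub (Nat.one_le_pow _ _ Nat.card_pos)]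
      have := Fintype.ofFinite F
      rw [Nat.card_eq_fintype_card, Nat.cast_pow, FiniteField.cast_card_eq_zero, zero_pow hS.ne']
      simp
    rw [← Nat.cast_smul_eq_nsmul F, hq0, neg_one_smul, neg_ne_zero]
    exact fun h => one_zero_ne_zero (e.symm.map_eq_zero_iff.1 h)

end SingerLine

section Separated

variable {G : Type*} [Group G] {K : Subgroup G} {x : G}

/-- If the conjugates of `x` by the `t i` never lie two at a time in a conjugate of `K`, then few
conjugates of `x` lie in `K`. -/
theorem card_mul_conjCount_le_of_separated [Finite G] {ι : Type*} [Finite ι] (t : ι → G)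
    (ht : ∀ i j g, g⁻¹ * (t i * x * (t i)⁻¹) * g ∈ K → g⁻¹ * (t j * x * (t j)⁻¹) * g ∈ K → i = j) :
    Nat.card ι * conjCount K x ≤ Nat.card G := by
  rw [conjCount, ← Nat.card_prod]
  refine Nat.card_le_card_of_injective (fun a => t a.1 * a.2.1) ?_
  have key : ∀ i (g : G), g⁻¹ * x * g ∈ K → (t i * g)⁻¹ * (t i * x * (t i)⁻¹) * (t i * g) ∈ K := by
    intro i g hg
    convert hg using 1
    group
  rintro ⟨i, g, hg⟩ ⟨j, g', hg'⟩ h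
  have h' : t i * g = t j * g' := h
  have h1 : i = j := ht i j _ (key i g hg) (h' ▸ key j g' hg')
  subst h1
  have h2 : g = g' := mul_left_cancel h'
  subst h2
  rfl

theorem map_conj_ne_top (htop : K ≠ ⊤) (g : G) : K.map (MulAut.conj g).toMonoidHom ≠ ⊤ := by
  intro h
  refine htop (Subgroup.map_injective (f := (MulAut.conj g).toMonoidHom) (MulAut.conj g).injective ?_)
  rw [h]
  exact (Subgroup.map_top_of_surjective _ (MulAut.conj g).surjective).symm

theorem conjCount_eq_zero (h : ¬ ∃ g, g⁻¹ * x * g ∈ K) : conjCount K x = 0 := by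
  rw [conjCount, Nat.card_eq_zero]
  exact Or.inl ⟨fun g => h ⟨g.1, g.2⟩⟩

end Separated

section FullCenters

open Module

variable {F V : Type*} [Field F] [AddCommGroup V] [Module F V] [FiniteDimensional F V]

/-- The centers `c` such that every transvection with center `c` belongs to `K`. -/
def fullCenters (K : Subgroup (V ≃ₗ[F] V)) : Submodule F V where
  carrier := {c | ∀ g : Dual F V, g c = 0 → HasPersp K c g}
  zero_mem' := fun g _ => hasPersp_zero_left g
  smul_mem' := by
    intro a c hc g hg
    rw [hasPersp_smul]
    refine hc _ ?_
    rw [LinearMap.smul_apply, ← map_smul]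
    exact hg
  add_mem' := by
    intro c c' hc hc' g hg
    by_cases h : c' ∈ Submodule.span F {c}
    · obtain ⟨a, rfl⟩ := Submodule.mem_span_singleton.1 h
      have h1 : c + a • c = (1 + a) • c := by rw [add_smul, one_smul]
      rw [h1] at hg ⊢
      rw [hasPersp_smul]
      refine hc _ ?_
      rw [LinearMap.smul_apply, ← map_smul]
      exact hg
    · obtain ⟨f, hf1, hf⟩ := exists_dual_apply_eq_one h
      obtain ⟨k, hk, hkf⟩ := hc f (hf _ (Submodule.mem_span_singleton_self c))
      have h1 : k c' = c + c' := by rw [hkf, hf1, one_smul, add_comm]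
      have h2 := (hc' (g ∘ₗ (k : V →ₗ[F] V)) (by simpa [h1] using hg)).conj hk
      rw [h1] at h2
      convert h2 using 1
      ext y
      simp

theorem apply_mem_fullCenters {K : Subgroup (V ≃ₗ[F] V)} {c : V} (hc : c ∈ fullCenters K)
    {k : V ≃ₗ[F] V} (hk : k ∈ K) : k c ∈ fullCenters K := by
  intro g hg
  have h2 := (hc (g ∘ₗ (k : V →ₗ[F] V)) (by simpa using hg)).conj hk
  convert h2 using 1
  ext y
  simp

theorem fullCenters_ne_top (h2 : Nat.card F = 2)
    {K : Subgroup (V ≃ₗ[F] V)} (htop : K ≠ ⊤) : fullCenters K ≠ ⊤ := by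
  intro h
  refine htop (eq_top_of_persp_of_det (fun c f hfc => ?_) fun a ha => ⟨1, one_mem _, ?_⟩)
  · have : c ∈ fullCenters K := h ▸ Submodule.mem_top
    exact this f hfc
  · rw [eq_one_of_card_eq_two h2 ha]
    exact LinearMap.det_id

end FullCenters

section CountingFrames

open Module

variable {F V : Type*} [Field F] [AddCommGroup V] [Module F V]

/-- A bound for the number of conjugates of `h` in `K` from the possible images of a frame. -/
theorem card_mul_conjCount_le_of_frame [Finite F] [Finite V] {ι : Type*} [Finite ι] {v : ι → V}
    (hv : LinearIndependent F v) (P : Finset (ι → V)) {K : Subgroup (V ≃ₗ[F] V)} {h : V ≃ₗ[F] V}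
    (hK : ∀ g : V ≃ₗ[F] V, g⁻¹ * h * g ∈ K → (fun i => g (v i)) ∈ P) :
    Nat.card {s : ι → V // LinearIndependent F s} * conjCount K h ≤
      P.card * Nat.card (V ≃ₗ[F] V) := by
  have : Finite (V ≃ₗ[F] V) := DFunLike.finite _
  have hex : ∀ (s : {s : ι → V // LinearIndependent F s})
      (g : V ≃ₗ[F] V), ∃ t : V ≃ₗ[F] V, ∀ i, t (g (v i)) = s.1 i := fun s g => by
    obtain ⟨t, ht⟩ := exists_linearEquiv_comp_eq (F := F) hv s.2
    exact ⟨t * g⁻¹, fun i => by simpa [LinearEquiv.mul_apply] using ht i⟩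
  have hex' : ∀ (s : {s : ι → V // LinearIndependent F s}) (w : P), ∃ t : V ≃ₗ[F] V,
      ∀ g : V ≃ₗ[F] V, (∀ i, g (v i) = w.1 i) → ∀ i, t (g (v i)) = s.1 i := fun s w => by
    by_cases hw : ∃ g : V ≃ₗ[F] V, ∀ i, g (v i) = w.1 i
    · obtain ⟨g, hg⟩ := hw
      obtain ⟨t, ht⟩ := hex s g
      exact ⟨t, fun g' hg' i => by rw [hg', ← hg, ht]⟩
    · exact ⟨1, fun g hg => absurd ⟨g, hg⟩ hw⟩
  choose t ht using hex'
  rw [conjCount, ← Nat.card_prod, ← Fintype.card_coe, ← Nat.card_eq_fintype_card, ← Nat.card_prod]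
  refine Nat.card_le_card_of_injective (fun a => (⟨fun i => a.2.1 (v i), hK _ a.2.2⟩,
    t a.1 ⟨fun i => a.2.1 (v i), hK _ a.2.2⟩ * a.2.1)) ?_
  rintro ⟨s, g, hg⟩ ⟨s', g', hg'⟩ hgg
  simp only [Prod.mk.injEq] at hgg
  obtain ⟨h1, h2⟩ := hgg
  have h3 : s = s' := by
    refine Subtype.ext (funext fun i => ?_)
    rw [← ht s ⟨_, hK g hg⟩ g (fun i => rfl) i, ← ht s' ⟨_, hK g' hg'⟩ g' (fun i => rfl) i]
    exact LinearEquiv.congr_fun h2 (v i)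
  subst h3
  rw [h1] at h2
  have h4 : g = g' := mul_left_cancel h2
  subst h4
  rfl

end CountingFrames

section TransvectionPower

open Module

variable {F E : Type*} [Field F] [Field E] [Algebra F E]

theorem weights_of_transvection_pow [Finite E] (hn : 3 ≤ finrank F E) {u : Eˣ}
    (hu : ∀ w : Eˣ, w ∈ Subgroup.zpowers u) {h : E ≃ₗ[F] E} {j : ℕ} {c : E} {f : Dual F E}
    (hc : c ≠ 0) (hf : f ≠ 0) (hfc : f c = 0) (hj : ∀ y, (h ^ j) y = y + f y • c) {N : ℕ}
    (hB : ∀ K : Subgroup (E ≃ₗ[F] E), K ≠ ⊤ → (¬ ∃ g, g⁻¹ * unitMul F E u * g ∈ K) →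
      N * conjCount K h ≤ Nat.card (E ≃ₗ[F] E))
    {K : Subgroup (E ≃ₗ[F] E)} (htop : K ≠ ⊤) :
    Nat.card E * conjCount K (unitMul F E u) + N * conjCount K h ≤ Nat.card (E ≃ₗ[F] E) := by
  have : Finite F := Finite.of_injective _ (algebraMap F E).injective
  by_cases hx : ∃ g, g⁻¹ * unitMul F E u * g ∈ K
  swap
  · rw [conjCount_eq_zero hx, mul_zero, zero_add]
    exact hB K htop hx
  have hh : ¬ ∃ g, g⁻¹ * h * g ∈ K := by
    rintro ⟨g', hg'⟩
    obtain ⟨g, hg⟩ := hx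
    have hs := (g * g'⁻¹).symm_apply_apply
    refine map_conj_ne_top htop g (eq_top_of_unitMul_mem_of_transvection hn
      (forall_unitMul_mem hu ⟨_, hg, by simp [mul_assoc]⟩) (c := (g * g'⁻¹) c)
      (f := f ∘ₗ ((g * g'⁻¹).symm : E →ₗ[F] E)) ?_ ?_ ?_ ?_)
    · exact fun h0 => hc ((g * g'⁻¹).map_eq_zero_iff.1 h0)
    · intro h0
      refine hf (LinearMap.ext fun y => ?_)
      have h1 := LinearMap.congr_fun h0 ((g * g'⁻¹) y)
      rwa [LinearMap.comp_apply, LinearEquiv.coe_coe, hs] at h1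
    · rw [LinearMap.comp_apply, LinearEquiv.coe_coe, hs, hfc]
    · refine ⟨(g * g'⁻¹) * h ^ j * (g * g'⁻¹)⁻¹, ⟨_, pow_mem hg' j, ?_⟩, fun y => ?_⟩
      · have : g'⁻¹ * h * g' = g'⁻¹ * h * (g'⁻¹)⁻¹ := by rw [inv_inv]
        rw [this, conj_pow]
        simp [mul_assoc]
      · rw [LinearEquiv.mul_apply, LinearEquiv.mul_apply (g * g'⁻¹), hj, map_add, map_smul]
        congr 1
        exact (g * g'⁻¹).apply_symm_apply y
  rw [conjCount_eq_zero hh, mul_zero, add_zero, natCard_eq_pow_finrank (K := F) (V := E)]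
  exact pow_mul_conjCount_unitMul_le hn htop hu

end TransvectionPower

section JordanLine

open Module

variable {F S : Type*} [Field F] [Field S] [Algebra F S]

theorem one_add_one_eq_zero_of_card (h2 : Nat.card F = 2) : (1 : F) + 1 = 0 := by
  have : Finite F := Nat.finite_of_card_ne_zero (by omega)
  have := Fintype.ofFinite F
  have h := FiniteField.cast_card_eq_zero F
  rw [← Nat.card_eq_fintype_card, h2] at h
  rw [one_add_one_eq_two]
  exact_mod_cast h

/-- The units of `S` acting on `F × F × S`, trivially on the first two factors. -/
def planeMul (F S : Type*) [Field F] [Field S] [Algebra F S] :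
    Sˣ →* (F × F × S) ≃ₗ[F] (F × F × S) where
  toFun w := (LinearEquiv.refl F F).prodCongr (lineMul F S w)
  map_one' := by ext <;> simp
  map_mul' w w' := by ext <;> simp

@[simp] theorem planeMul_apply (w : Sˣ) (y : F × F × S) :
    planeMul F S w y = (y.1, y.2.1, w * y.2.2) := rfl

@[simp] theorem planeMul_symm_apply (w : Sˣ) (y : F × F × S) :
    (planeMul F S w).symm y = (y.1, y.2.1, (w : S)⁻¹ * y.2.2) := by
  rw [LinearEquiv.symm_apply_eq, planeMul_apply, mul_inv_cancel_left₀ w.ne_zero]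

/-- The automorphism of `F × F × S` which is a Jordan block on `F × F` and multiplication by `s` on
`S`. -/
def jordanLine (F : Type*) [Field F] [Algebra F S] (s : Sˣ) : (F × F × S) ≃ₗ[F] (F × F × S) where
  toFun y := (y.1 + y.2.1, y.2.1, s * y.2.2)
  map_add' y y' := by
    ext
    · simp; ring
    · simp
    · simp [mul_add]
  map_smul' a y := by
    ext
    · simp; ring
    · simp
    · simp
  invFun y := (y.1 - y.2.1, y.2.1, (s : S)⁻¹ * y.2.2)
  left_inv y := by simp
  right_inv y := by simp

@[simp] theorem jordanLine_apply (s : Sˣ) (y : F × F × S) :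
    jordanLine F s y = (y.1 + y.2.1, y.2.1, s * y.2.2) := rfl

@[simp] theorem jordanLine_symm_apply (s : Sˣ) (y : F × F × S) :
    (jordanLine F s).symm y = (y.1 - y.2.1, y.2.1, (s : S)⁻¹ * y.2.2) := rfl

/-- The second coordinate functional on `F × F × S`. -/
def sndFst (F S : Type*) [Field F] [Field S] [Algebra F S] : Dual F (F × F × S) :=
  LinearMap.fst F F S ∘ₗ LinearMap.snd F F (F × S)

@[simp] theorem sndFst_apply (y : F × F × S) : sndFst F S y = y.2.1 := rfl

/-- The projection of `F × F × S` to `S`. -/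
def sndSnd (F S : Type*) [Field F] [Field S] [Algebra F S] : (F × F × S) →ₗ[F] S :=
  LinearMap.snd F F S ∘ₗ LinearMap.snd F F (F × S)

@[simp] theorem sndSnd_apply (y : F × F × S) : sndSnd F S y = y.2.2 := rfl

variable {s : Sˣ}

theorem jordanLine_pow_apply (s : Sˣ) (k : ℕ) (y : F × F × S) :
    (jordanLine F s ^ k) y = (y.1 + k * y.2.1, y.2.1, (s : S) ^ k * y.2.2) := by
  induction k with
  | zero => simp
  | succ k ih =>
    rw [pow_succ', LinearEquiv.mul_apply, ih, jordanLine_apply]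
    ext
    · simp; ring
    · simp
    · simp [pow_succ', mul_assoc]

theorem generator_pow_three [Finite S] (h2 : Nat.card F = 2) (hS : finrank F S = 2)
    (hs : ∀ w : Sˣ, w ∈ Subgroup.zpowers s) : s ^ 3 = 1 := by
  have h := orderOf_eq_of_generator (F := F) hs
  rw [h2, hS] at h
  have h1 := pow_orderOf_eq_one s
  rwa [h] at h1

theorem jordanLine_pow_three [Finite S] (h2 : Nat.card F = 2) (hS : finrank F S = 2)
    (hs : ∀ w : Sˣ, w ∈ Subgroup.zpowers s) (y : F × F × S) :
    (jordanLine F s ^ 3) y = y + sndFst F S y • ((1, 0, 0) : F × F × S) := by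
  have h1 : (s : S) ^ 3 = 1 := by
    rw [← Units.val_pow_eq_pow_val, generator_pow_three h2 hS hs, Units.val_one]
  have h3 : (3 : F) = 1 := by linear_combination one_add_one_eq_zero_of_card h2
  rw [jordanLine_pow_apply, h1]
  ext <;> simp [h3]

theorem jordanLine_pow_four [Finite S] (h2 : Nat.card F = 2) (hS : finrank F S = 2)
    (hs : ∀ w : Sˣ, w ∈ Subgroup.zpowers s) : jordanLine F s ^ 4 = planeMul F S s := by
  have h1 : (s : S) ^ 3 = 1 := by
    rw [← Units.val_pow_eq_pow_val, generator_pow_three h2 hS hs, Units.val_one]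
  have h3 : (4 : F) = 0 := by linear_combination 2 * one_add_one_eq_zero_of_card h2
  refine LinearEquiv.ext fun y => ?_
  rw [jordanLine_pow_apply, pow_succ, h1]
  ext <;> simp [h3]

variable {K : Subgroup ((F × F × S) ≃ₗ[F] (F × F × S))}

theorem planeMul_mem_of_jordanLine_mem [Finite S] (h2 : Nat.card F = 2) (hS : finrank F S = 2)
    (hs : ∀ w : Sˣ, w ∈ Subgroup.zpowers s) (hK : jordanLine F s ∈ K) (w : Sˣ) :
    planeMul F S w ∈ K := by
  obtain ⟨k, rfl⟩ := hs w
  change planeMul F S (s ^ k) ∈ K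
  rw [map_zpow, ← jordanLine_pow_four h2 hS hs]
  exact K.zpow_mem (K.pow_mem hK _) k

theorem eq_zero_of_generator_mul_eq (hS : 2 ≤ finrank F S)
    (hs : ∀ w : Sˣ, w ∈ Subgroup.zpowers s) {y : S} (hy : (s : S) * y = y) : y = 0 := by
  by_contra h0
  refine generator_ne_algebraMap hS hs 1 ?_
  rw [map_one]
  exact mul_right_cancel₀ h0 (by rw [hy, one_mul])

theorem generator_sub_one_ne_zero (hS : 2 ≤ finrank F S)
    (hs : ∀ w : Sˣ, w ∈ Subgroup.zpowers s) : (s : S) - 1 ≠ 0 := by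
  rw [sub_ne_zero]
  intro h
  exact generator_ne_algebraMap hS hs 1 (by rw [h, map_one])

/-- The automorphism `(a, b, y) ↦ (a + γ y, b + ψ y, y)` for `i = (ψ, γ)`. -/
def planeShear (i : Dual F S × Dual F S) : (F × F × S) ≃ₗ[F] (F × F × S) where
  toFun y := (y.1 + i.2 y.2.2, y.2.1 + i.1 y.2.2, y.2.2)
  map_add' y y' := by
    ext
    · simp; ring
    · simp; ring
    · simp
  map_smul' a y := by
    ext
    · simp; ring
    · simp; ring
    · simp
  invFun y := (y.1 - i.2 y.2.2, y.2.1 - i.1 y.2.2, y.2.2)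
  left_inv y := by simp
  right_inv y := by simp

@[simp] theorem planeShear_apply (i : Dual F S × Dual F S) (y : F × F × S) :
    planeShear i y = (y.1 + i.2 y.2.2, y.2.1 + i.1 y.2.2, y.2.2) := rfl

@[simp] theorem planeShear_symm_apply (i : Dual F S × Dual F S) (y : F × F × S) :
    (planeShear i).symm y = (y.1 - i.2 y.2.2, y.2.1 - i.1 y.2.2, y.2.2) := rfl

theorem planeShear_inv_mul (i j : Dual F S × Dual F S) :
    (planeShear i)⁻¹ * planeShear j = planeShear (j - i) := by
  refine LinearEquiv.ext fun y => ?_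
  change (planeShear i).symm (planeShear j y) = _
  ext
  · simp; ring
  · simp; ring
  · simp

theorem eq_zero_of_planeShear_conj_mem [Finite S] (h2 : Nat.card F = 2) (hS : finrank F S = 2)
    (hs : ∀ w : Sˣ, w ∈ Subgroup.zpowers s) (hK : jordanLine F s ∈ K)
    (hP : ∀ g : Dual F (F × F × S), g (1, 0, 0) = 0 → HasPersp K (1, 0, 0) g →
      g = 0 ∨ g = sndFst F S) {i : Dual F S × Dual F S}
    (hi : planeShear i * jordanLine F s * (planeShear i)⁻¹ ∈ K) : i = 0 := by
  have h1 : i.1 = 0 := by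
    have h3 : HasPersp K ((1, 0, 0) : F × F × S) (sndFst F S - i.1 ∘ₗ sndSnd F S) := by
      refine ⟨_, pow_mem hi 3, fun y => ?_⟩
      rw [conj_pow]
      change planeShear i ((jordanLine F s ^ 3) ((planeShear i).symm y)) = _
      rw [jordanLine_pow_three h2 hS hs]
      ext
      · simp; ring
      · simp
      · simp
    rcases hP _ (by simp) h3 with h | h
    · have := LinearMap.congr_fun h (0, 1, 0)
      simp at this
    · ext y
      have := LinearMap.congr_fun h (0, 0, y)
      simpa using this
  have h4 : i.2 = 0 := by
    have h3 : HasPersp K ((1, 0, 0) : F × F × S)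
        (i.2 ∘ₗ LinearMap.mulLeft F ((s : S) - 1) ∘ₗ sndSnd F S) := by
      refine ⟨_, mul_mem (inv_mem hK) hi, fun y => ?_⟩
      change (jordanLine F s).symm (planeShear i (jordanLine F s ((planeShear i).symm y))) = _
      ext
      · simp [h1, sub_mul]; ring
      · simp [h1]
      · simp
    have h5 : i.2 ∘ₗ LinearMap.mulLeft F ((s : S) - 1) ∘ₗ sndSnd F S = 0 := by
      rcases hP _ (by simp) h3 with h | h
      · exact h
      · have := LinearMap.congr_fun h (0, 1, 0)
        simp at this
    ext y
    have := LinearMap.congr_fun h5 (0, 0, ((s : S) - 1)⁻¹ * y)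
    simpa [generator_sub_one_ne_zero hS.ge hs] using this
  exact Prod.ext h1 h4

end JordanLine

section JordanLineCount

open Module

variable {F S : Type*} [Field F] [Field S] [Algebra F S] {s : Sˣ}
  {K : Subgroup ((F × F × S) ≃ₗ[F] (F × F × S))}

theorem natCard_dual_of_card_eq_two [Finite S] (h2 : Nat.card F = 2) (hS : finrank F S = 2) :
    Nat.card (Dual F S × Dual F S) = 16 := by
  rw [Nat.card_prod, natCard_eq_pow_finrank (K := F) (V := Dual F S), Subspace.dual_finrank_eq, h2,
    hS]
  norm_num

theorem fixes_jordanLine_point (h2 : Nat.card F = 2) (hS : finrank F S = 2)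
    (hs : ∀ w : Sˣ, w ∈ Subgroup.zpowers s) (w : F × F × S) (a : F)
    (h : jordanLine F s w = a • w) : ∃ b : F, w = b • ((1, 0, 0) : F × F × S) := by
  by_cases ha : a = 0
  · rw [ha, zero_smul] at h
    exact ⟨0, by rw [zero_smul]; exact (jordanLine F s).map_eq_zero_iff.1 h⟩
  · rw [eq_one_of_card_eq_two h2 ha, one_smul, jordanLine_apply] at h
    have h1 := congrArg Prod.fst h
    have h3 := congrArg (fun z : F × F × S => z.2.2) h
    simp only [add_eq_left] at h1 h3
    refine ⟨w.1, ?_⟩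
    ext
    · simp
    · simp [h1]
    · simp [eq_zero_of_generator_mul_eq hS.ge hs h3]

theorem fixes_jordanLine_hyperplane (h2 : Nat.card F = 2) (hS : finrank F S = 2)
    (hs : ∀ w : Sˣ, w ∈ Subgroup.zpowers s) (φ : Dual F (F × F × S)) (a : F)
    (h : ∀ y, φ (jordanLine F s y) = a * φ y) : ∃ b : F, φ = b • sndFst F S := by
  by_cases ha : a = 0
  · refine ⟨0, LinearMap.ext fun y => ?_⟩
    have := h ((jordanLine F s).symm y)
    rw [LinearEquiv.apply_symm_apply, ha, zero_mul] at this
    simpa using this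
  · simp only [eq_one_of_card_eq_two h2 ha, one_mul] at h
    have h1 : φ (1, 0, 0) = 0 := by
      have h3 := h (0, 1, 0)
      have h4 : jordanLine F s (0, 1, 0) = (1, 0, 0) + (0, 1, 0) := by ext <;> simp
      rw [h4, map_add, add_eq_right] at h3
      exact h3
    have h5 : ∀ y : S, φ (0, 0, y) = 0 := by
      intro y
      have h3 := h (0, 0, ((s : S) - 1)⁻¹ * y)
      have h4 : jordanLine F s (0, 0, ((s : S) - 1)⁻¹ * y) =
          (0, 0, y) + (0, 0, ((s : S) - 1)⁻¹ * y) := by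
        ext
        · simp
        · simp
        · have := generator_sub_one_ne_zero hS.ge hs
          simp
          field_simp
          ring
      rw [h4, map_add, add_eq_right] at h3
      exact h3
    refine ⟨φ (0, 1, 0), LinearMap.ext fun y => ?_⟩
    have h6 : y = y.1 • (1, 0, 0) + y.2.1 • (0, 1, 0) + (0, 0, y.2.2) := by ext <;> simp
    conv_lhs => rw [h6]
    rw [map_add, map_add, map_smul, map_smul, h1, h5]
    simp [mul_comm]

theorem mem_fullCenters_of_jordanLine_mem [Finite S] (h2 : Nat.card F = 2) (hS : finrank F S = 2)
    (hs : ∀ w : Sˣ, w ∈ Subgroup.zpowers s) (hK : jordanLine F s ∈ K) {g : Dual F (F × F × S)}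
    (hg1 : g (1, 0, 0) = 0) (hg : HasPersp K (1, 0, 0) g) (hg0 : g ≠ 0) (hgf : g ≠ sndFst F S) :
    ((1, 0, 0) : F × F × S) ∈ fullCenters K := by
  have hf : HasPersp K ((1, 0, 0) : F × F × S) (sndFst F S) :=
    ⟨_, pow_mem hK 3, jordanLine_pow_three h2 hS hs⟩
  have hf' : ∀ b : F, HasPersp K ((1, 0, 0) : F × F × S) (b • sndFst F S) := by
    intro b
    by_cases hb : b = 0
    · rw [hb, zero_smul]
      exact hasPersp_zero_right _
    · rw [eq_one_of_card_eq_two h2 hb, one_smul]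
      exact hf
  have hdec : ∀ g' : Dual F (F × F × S), g' (1, 0, 0) = 0 → g' = g' (0, 1, 0) • sndFst F S +
      (g' ∘ₗ LinearMap.inr F F (F × S) ∘ₗ LinearMap.inr F F S) ∘ₗ sndSnd F S := by
    intro g' hg'
    refine LinearMap.ext fun y => ?_
    have h6 : y = y.1 • (1, 0, 0) + y.2.1 • (0, 1, 0) + (0, 0, y.2.2) := by ext <;> simp
    conv_lhs => rw [h6]
    rw [map_add, map_add, map_smul, map_smul, hg']
    simp [mul_comm]
  set χ := g ∘ₗ LinearMap.inr F F (F × S) ∘ₗ LinearMap.inr F F S with hχ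
  have hχ0 : χ ≠ 0 := by
    intro h0
    have h1 := hdec g hg1
    rw [← hχ, h0, LinearMap.zero_comp, add_zero] at h1
    by_cases hb : g (0, 1, 0) = 0
    · rw [hb, zero_smul] at h1
      exact hg0 h1
    · rw [eq_one_of_card_eq_two h2 hb, one_smul] at h1
      exact hgf h1
  have hχK : HasPersp K ((1, 0, 0) : F × F × S) (χ ∘ₗ sndSnd F S) := by
    have h1 := hg.sub_right (hf' (g (0, 1, 0))) (by simp [hg1])
    have h3 : g - g (0, 1, 0) • sndFst F S = χ ∘ₗ sndSnd F S := by
      rw [sub_eq_iff_eq_add']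
      exact hdec g hg1
    rwa [h3] at h1
  have hall : ∀ ψ : Dual F S, HasPersp K ((1, 0, 0) : F × F × S) (ψ ∘ₗ sndSnd F S) := by
    intro ψ
    obtain ⟨b, rfl⟩ := dualMul_surjective hχ0 ψ
    by_cases hb : b = 0
    · convert hasPersp_zero_right (K := K) _
      ext y <;> simp [hb]
    · have h1 := hχK.conj (planeMul_mem_of_jordanLine_mem h2 hS hs hK
        (Units.mk0 b⁻¹ (inv_ne_zero hb)))
      convert h1 using 1
      · ext <;> simp
      · refine LinearMap.ext fun y => ?_
        simp
  intro g' hg'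
  rw [hdec g' hg']
  exact (hf' _).add_right (hall _) (by simp)

theorem exists_snd_smul [Finite S] (h2 : Nat.card F = 2) (hS : finrank F S = 2)
    (hs : ∀ w : Sˣ, w ∈ Subgroup.zpowers s) {U : Submodule F (F × F × S)}
    (hU : ∀ y ∈ U, jordanLine F s y ∈ U) {w : F × F × S} (hw : w ∈ U) (hw0 : w.2.2 ≠ 0) (y : S) :
    ((0, 0, y) : F × F × S) ∈ U := by
  have hpow : ∀ (k : ℕ), ∀ z ∈ U, (jordanLine F s ^ k) z ∈ U := by
    intro k
    induction k with
    | zero => exact fun z hz => hz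
    | succ k ih =>
      intro z hz
      rw [pow_succ, LinearEquiv.mul_apply]
      exact ih _ (hU z hz)
  have hpl : ∀ (k : ℕ), ∀ z ∈ U, planeMul F S (s ^ k) z ∈ U := by
    intro k z hz
    rw [map_pow, ← jordanLine_pow_four h2 hS hs, ← pow_mul]
    exact hpow _ z hz
  have h1 := generator_sub_one_ne_zero hS.ge hs
  have h3 : ((0, 0, ((s : S) - 1) * w.2.2) : F × F × S) ∈ U := by
    have := U.sub_mem (hpl 1 w hw) hw
    convert this using 1
    ext <;> simp [sub_mul]
  by_cases hy : y = 0
  · rw [hy]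
    exact U.zero_mem
  · obtain ⟨k, hk⟩ := mem_powers_iff_mem_zpowers.2
      (hs (Units.mk0 (y / (((s : S) - 1) * w.2.2)) (div_ne_zero hy (mul_ne_zero h1 hw0))))
    have := hpl k _ h3
    have hk' : (s : S) ^ k = y / (((s : S) - 1) * w.2.2) := by
      simpa using congrArg Units.val hk
    rw [planeMul_apply, Units.val_pow_eq_pow_val, hk'] at this
    convert this using 3
    field_simp

end JordanLineCount

section JordanLineBound

open Module

variable {F S : Type*} [Field F] [Field S] [Algebra F S] {s : Sˣ}
  {K : Subgroup ((F × F × S) ≃ₗ[F] (F × F × S))}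

theorem natCard_prod_prod_of_card_eq_two [Finite S] (h2 : Nat.card F = 2) (hS : finrank F S = 2) :
    Nat.card (F × F × S) = 16 := by
  rw [Nat.card_prod, Nat.card_prod, natCard_eq_pow_finrank (K := F) (V := S), h2, hS]
  norm_num

theorem finrank_prod_prod (F S : Type*) [Field F] [Field S] [Algebra F S] [Finite S] :
    finrank F (F × F × S) = finrank F S + 2 := by
  rw [finrank_prod, finrank_prod, finrank_self]
  omega

/-- The subspace `0 × 0 × S`. -/
def sndSndRange (F S : Type*) [Field F] [Field S] [Algebra F S] : Submodule F (F × F × S) :=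
  LinearMap.range (LinearMap.inr F F (F × S) ∘ₗ LinearMap.inr F F S)

theorem finrank_sndSndRange (F S : Type*) [Field F] [Field S] [Algebra F S] :
    finrank F (sndSndRange F S) = finrank F S :=
  LinearMap.finrank_range_of_inj (LinearMap.inr_injective.comp LinearMap.inr_injective)

theorem finrank_ker_sndSnd [Finite S] : finrank F (LinearMap.ker (sndSnd F S)) = 2 := by
  have h := LinearMap.finrank_range_add_finrank_ker (sndSnd F S)
  rw [LinearMap.range_eq_top.2 (fun y => ⟨(0, 0, y), rfl⟩), finrank_top, finrank_prod_prod] at h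
  omega

theorem exists_finset_linearIndependent {V : Type*} [AddCommGroup V] [Module F V] [Finite V]
    (h2 : Nat.card F = 2) {U : Submodule F V} (hU : finrank F U = 2) :
    ∃ P : Finset (Fin 2 → V), P.card ≤ 6 ∧
      ∀ t : Fin 2 → V, LinearIndependent F t → (∀ i, t i ∈ U) → t ∈ P := by
  classical
  have : Finite F := Nat.finite_of_card_ne_zero (by omega)
  have := Fintype.ofFinite F
  have := Fintype.ofFinite {t : Fin 2 → U // LinearIndependent F t}
  have hF : Fintype.card F = 2 := by rw [← Nat.card_eq_fintype_card, h2]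
  refine ⟨(Finset.univ : Finset {t : Fin 2 → U // LinearIndependent F t}).image
    fun t i => (t.1 i : V), ?_, fun t ht htU => ?_⟩
  · refine Finset.card_image_le.trans ?_
    rw [Finset.card_univ, ← Nat.card_eq_fintype_card, card_linearIndependent hU.ge, hU, hF]
    simp [Fin.prod_univ_two]
  · refine Finset.mem_image.2 ⟨⟨fun i => ⟨t i, htU i⟩, ?_⟩, Finset.mem_univ _, rfl⟩
    exact LinearIndependent.of_comp U.subtype ht

theorem fifteen_mul_conjCount_le_of_plane [Finite S] (h2 : Nat.card F = 2) (hS : finrank F S = 2)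
    (hs : ∀ w : Sˣ, w ∈ Subgroup.zpowers s)
    (hK : ∀ k ∈ K, ∀ y ∈ LinearMap.ker (sndSnd F S), k y ∈ LinearMap.ker (sndSnd F S)) :
    15 * conjCount K (jordanLine F s) ≤ Nat.card ((F × F × S) ≃ₗ[F] (F × F × S)) := by
  classical
  have : Finite F := Finite.of_injective _ (algebraMap F S).injective
  have := Fintype.ofFinite F
  have hF : Fintype.card F = 2 := by rw [← Nat.card_eq_fintype_card, h2]
  have hfrV : Nat.card {t : Fin 2 → (F × F × S) // LinearIndependent F t} = 210 := by
    rw [card_linearIndependent (by rw [finrank_prod_prod]; omega), finrank_prod_prod, hS, hF]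
    simp [Fin.prod_univ_two]
  obtain ⟨P, hPcard, hPmem⟩ := exists_finset_linearIndependent h2 (finrank_ker_sndSnd (F := F) (S := S))
  obtain ⟨Q, hQcard, hQmem⟩ :=
    exists_finset_linearIndependent h2 ((finrank_sndSndRange F S).trans hS)
  obtain ⟨v, hv, hvU⟩ : ∃ v : Fin 2 → F × F × S, LinearIndependent F v ∧
      ∀ i, v i ∈ LinearMap.ker (sndSnd F S) := by
    let bas := finBasisOfFinrankEq F (LinearMap.ker (sndSnd F S)) finrank_ker_sndSnd
    exact ⟨fun i => bas i, bas.linearIndependent.map' (Submodule.subtype _)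
      (Submodule.ker_subtype _), fun i => (bas i).2⟩
  have key := card_mul_conjCount_le_of_frame hv
    (P ∪ Q) (K := K) (h := jordanLine F s) ?_
  · rw [hfrV] at key
    have h3 := (Finset.card_union_le P Q).trans (add_le_add hPcard hQcard)
    have h4 := key.trans (Nat.mul_le_mul_right _ h3)
    omega
  · intro g hg
    have hgv : LinearIndependent F fun i => g (v i) :=
      hv.map' (g : (F × F × S) →ₗ[F] (F × F × S)) g.ker
    set U := (LinearMap.ker (sndSnd F S)).map (g : (F × F × S) →ₗ[F] (F × F × S)) with hU
    have hUfin : finrank F U = 2 := by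
      rw [hU, LinearEquiv.finrank_map_eq, finrank_ker_sndSnd]
    have hUinv : ∀ y ∈ U, jordanLine F s y ∈ U := by
      rintro _ ⟨y, hy, rfl⟩
      refine ⟨_, hK _ hg y hy, ?_⟩
      change g (g.symm (jordanLine F s (g y))) = _
      rw [LinearEquiv.apply_symm_apply]
      rfl
    have hvU' : ∀ i, g (v i) ∈ U := fun i => ⟨v i, hvU i, rfl⟩
    rw [Finset.mem_union]
    by_cases hex : ∃ w ∈ U, w.2.2 ≠ 0
    · right
      obtain ⟨w, hw, hw0⟩ := hex
      have hle : sndSndRange F S ≤ U := by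
        rintro _ ⟨y, rfl⟩
        exact exists_snd_smul h2 hS hs hUinv hw hw0 y
      have heq := Submodule.eq_of_le_of_finrank_eq hle (by rw [finrank_sndSndRange, hS, hUfin])
      refine hQmem _ hgv fun i => ?_
      rw [heq]
      exact hvU' i
    · left
      push Not at hex
      exact hPmem _ hgv fun i => hex _ (hvU' i)

theorem fifteen_mul_conjCount_le_of_mem [Finite S] (h2 : Nat.card F = 2) (hS : finrank F S = 2)
    (hs : ∀ w : Sˣ, w ∈ Subgroup.zpowers s) (hK : jordanLine F s ∈ K) (htop : K ≠ ⊤)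
    (h1 : ((1, 0, 0) : F × F × S) ∈ fullCenters K) :
    15 * conjCount K (jordanLine F s) ≤ Nat.card ((F × F × S) ≃ₗ[F] (F × F × S)) := by
  have : Finite F := Finite.of_injective _ (algebraMap F S).injective
  have hcard := natCard_prod_prod_of_card_eq_two h2 hS
  have hone : ((1, 0, 0) : F × F × S) ≠ 0 := fun h => one_ne_zero (congrArg Prod.fst h)
  have hcenter : ∀ a : F, ((a, 0, 0) : F × F × S) ∈ fullCenters K := by
    intro a
    have := (fullCenters K).smul_mem a h1
    convert this using 1
    ext <;> simp
  have hsec : ∀ w ∈ fullCenters K, w.2.1 ≠ 0 → w.2.2 = 0 →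
      ∀ b : F, ((0, b, 0) : F × F × S) ∈ fullCenters K := by
    intro w hw hw1 hw2 b
    have := (fullCenters K).smul_mem b ((fullCenters K).sub_mem hw (hcenter w.1))
    convert this using 1
    ext <;> simp [hw2, eq_one_of_card_eq_two h2 hw1]
  by_cases hex : ∃ w ∈ fullCenters K, w.2.2 ≠ 0
  · obtain ⟨w, hw, hw0⟩ := hex
    have hS0 := exists_snd_smul h2 hS hs (fun y hy => apply_mem_fullCenters hy hK) hw hw0
    have hker : ∀ y : F × F × S, y ∈ fullCenters K ↔ y.2.1 = 0 := by
      intro y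
      constructor
      · intro hy
        by_contra hy1
        refine fullCenters_ne_top h2 htop (eq_top_iff.2 fun z _ => ?_)
        have h3 := hsec (y - (0, 0, y.2.2)) ((fullCenters K).sub_mem hy (hS0 _)) (by simpa using hy1)
          (by simp) z.2.1
        have := (fullCenters K).add_mem ((fullCenters K).add_mem (hcenter z.1) h3) (hS0 z.2.2)
        convert this using 1
        ext <;> simp
      · intro hy
        have := (fullCenters K).add_mem (hcenter y.1) (hS0 y.2.2)
        convert this using 1
        ext <;> simp [hy]
    have h3 := card_mul_conjCount_le_of_fixes_hyperplane (K := K) (f := sndFst F S)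
      (h := jordanLine F s) ?_ (fixes_jordanLine_hyperplane h2 hS hs) fun k hk => ⟨1, fun y => ?_⟩
    · rw [hcard, h2] at h3
      omega
    · intro h
      simpa using LinearMap.congr_fun h (0, 1, 0)
    · rw [one_mul, sndFst_apply, sndFst_apply]
      by_cases hy : y.2.1 = 0
      · rw [hy, ← hker]
        exact apply_mem_fullCenters ((hker y).2 hy) hk
      · rw [eq_one_of_card_eq_two h2 hy]
        refine eq_one_of_card_eq_two h2 fun h => hy ?_
        rw [← hker] at h ⊢
        have := apply_mem_fullCenters h (inv_mem hk)
        convert this using 1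
        exact (k.symm_apply_apply y).symm
  · push Not at hex
    by_cases hex' : ∃ w ∈ fullCenters K, w.2.1 ≠ 0
    · obtain ⟨w, hw, hw0⟩ := hex'
      refine fifteen_mul_conjCount_le_of_plane h2 hS hs fun k hk y hy => ?_
      refine hex _ (apply_mem_fullCenters ?_ hk)
      have := (fullCenters K).add_mem (hcenter y.1) (hsec w hw hw0 (hex w hw) y.2.1)
      convert this using 1
      have hy' : y.2.2 = 0 := hy
      ext <;> simp [hy']
    · push Not at hex'
      have h3 := card_mul_conjCount_le_of_fixes_point (K := K) (h := jordanLine F s) hone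
        (fixes_jordanLine_point h2 hS hs) fun k hk => ⟨(k (1, 0, 0)).1, ?_⟩
      · rw [hcard, h2] at h3
        omega
      · have h4 := apply_mem_fullCenters h1 hk
        ext
        · simp
        · simp [hex' _ h4]
        · simp [hex _ h4]

theorem fifteen_mul_conjCount_jordanLine_le [Finite S] (h2 : Nat.card F = 2) (hS : finrank F S = 2)
    (hs : ∀ w : Sˣ, w ∈ Subgroup.zpowers s) (htop : K ≠ ⊤) :
    15 * conjCount K (jordanLine F s) ≤ Nat.card ((F × F × S) ≃ₗ[F] (F × F × S)) := by
  have : Finite F := Finite.of_injective _ (algebraMap F S).injective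
  have : Finite ((F × F × S) ≃ₗ[F] (F × F × S)) := DFunLike.finite _
  have : Finite (Dual F S) := DFunLike.finite _
  have hconj : ∀ a : (F × F × S) ≃ₗ[F] (F × F × S), ∀ z, a⁻¹ * z * a ∈ K →
      z ∈ K.map (MulAut.conj a).toMonoidHom := fun a z hz => ⟨_, hz, by simp [mul_assoc]⟩
  by_cases hP : ∃ a : (F × F × S) ≃ₗ[F] (F × F × S),
      jordanLine F s ∈ K.map (MulAut.conj a).toMonoidHom ∧ ∃ g : Dual F (F × F × S),
        g (1, 0, 0) = 0 ∧ HasPersp (K.map (MulAut.conj a).toMonoidHom) (1, 0, 0) g ∧ g ≠ 0 ∧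
          g ≠ sndFst F S
  · obtain ⟨a, ha, g, hg1, hg, hg0, hgf⟩ := hP
    rw [← conjCount_map_conj K _ a]
    exact fifteen_mul_conjCount_le_of_mem h2 hS hs ha (map_conj_ne_top htop a)
      (mem_fullCenters_of_jordanLine_mem h2 hS hs ha hg1 hg hg0 hgf)
  · have h3 := card_mul_conjCount_le_of_separated (K := K) (x := jordanLine F s)
      (planeShear (F := F) (S := S)) fun i j g hi hj => ?_
    · rw [natCard_dual_of_card_eq_two h2 hS] at h3
      omega
    · have hi' := hconj ((planeShear i)⁻¹ * g) (jordanLine F s) (by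
        convert hi using 1
        group)
      have hj' := hconj ((planeShear i)⁻¹ * g) (planeShear (j - i) * jordanLine F s *
        (planeShear (j - i))⁻¹) (by
        rw [← planeShear_inv_mul]
        convert hj using 1
        group)
      have h0 := eq_zero_of_planeShear_conj_mem h2 hS hs hi' (fun g' h4 h5 => by
        by_contra hcon
        push Not at hcon
        exact hP ⟨_, hi', g', h4, h5, hcon.1, hcon.2⟩) hj'
      exact (sub_eq_zero.1 h0).symm

/-- The covering number of the affine group of the four-dimensional space over the field with two
elements. -/
theorem coveringNumber_affineEquiv_of_jordanLine {E : Type*} [Field E] [Algebra F E] [Finite E]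
    [Finite S] (e : E ≃ₗ[F] F × F × S) (h2 : Nat.card F = 2) (hS : finrank F S = 2) :
    coveringNumber (E ≃ᵃ[F] E) =
      ((Nat.card E + (Nat.card E - 1) / (Nat.card F - 1) : ℕ) : ℕ∞) := by
  have : Finite F := Finite.of_injective _ (algebraMap F E).injective
  have hfin : finrank F E = 4 := by rw [e.finrank_eq, finrank_prod_prod, hS]
  have hcard : Nat.card E = 16 := by
    rw [Nat.card_congr e.toEquiv, natCard_prod_prod_of_card_eq_two h2 hS]
  have hcardG : Nat.card ((F × F × S) ≃ₗ[F] (F × F × S)) = Nat.card (E ≃ₗ[F] E) :=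
    Nat.card_congr (linearAutCongr e).symm.toEquiv
  obtain ⟨u, hu⟩ := IsCyclic.exists_generator (α := Eˣ)
  obtain ⟨s, hs⟩ := IsCyclic.exists_generator (α := Sˣ)
  have hpow : ∀ (k : ℕ) (y : E), (((linearAutCongr e).symm (jordanLine F s)) ^ k) y =
      e.symm ((jordanLine F s ^ k) (e y)) := fun k y => by
    rw [← map_pow, linearAutCongr_symm_apply]
  have hsum : ∑ i ∈ Finset.range 6, (jordanLine F s ^ i) ((0, 1, 0) : F × F × S) = (1, 0, 0) := by
    have h0 := one_add_one_eq_zero_of_card h2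
    simp only [jordanLine_pow_apply, Finset.sum_range_succ, Finset.sum_range_zero]
    ext
    · simp
      linear_combination 7 * h0
    · simp
      linear_combination 3 * h0
    · simp
  refine coveringNumber_affineEquiv (by omega) (x := unitMul F E u)
    (h := (linearAutCongr e).symm (jordanLine F s)) (fun K hK => ?_) 6 ?_ (e.symm (0, 1, 0)) ?_
  · refine weights_of_transvection_pow (by omega) hu (j := 3) (c := e.symm (1, 0, 0))
      (f := sndFst F S ∘ₗ (e : E →ₗ[F] F × F × S)) ?_ ?_ ?_ (fun y => ?_) (fun K hK _ => ?_) hK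
    · intro h
      exact one_ne_zero (congrArg Prod.fst (e.symm.map_eq_zero_iff.1 h))
    · intro h
      simpa using LinearMap.congr_fun h (e.symm (0, 1, 0))
    · simp
    · rw [hpow, jordanLine_pow_three h2 hS hs, map_add, map_smul, e.symm_apply_apply]
      rfl
    · have hne : K.map (linearAutCongr e).toMonoidHom ≠ ⊤ := by
        intro h
        refine hK (Subgroup.map_injective (f := (linearAutCongr e).toMonoidHom)
          (linearAutCongr e).injective ?_)
        rw [h]
        exact (Subgroup.map_top_of_surjective _ (linearAutCongr e).surjective).symm
      have h3 := fifteen_mul_conjCount_jordanLine_le h2 hS hs hne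
      have h4 := conjCount_map (linearAutCongr e) K ((linearAutCongr e).symm (jordanLine F s))
      rw [MulEquiv.apply_symm_apply] at h4
      rw [h4, hcardG] at h3
      rw [hcard, h2]
      exact h3
  · refine LinearEquiv.ext fun y => ?_
    have h0 := one_add_one_eq_zero_of_card h2
    have h6 : (jordanLine F s ^ 6) (e y) = e y := by
      have h1 : (s : S) ^ 3 = 1 := by
        rw [← Units.val_pow_eq_pow_val, generator_pow_three h2 hS hs, Units.val_one]
      rw [jordanLine_pow_apply, show 6 = 3 * 2 from rfl, pow_mul, h1]
      ext
      · simp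
        left
        linear_combination 3 * h0
      · simp
      · simp
    rw [hpow, h6, e.symm_apply_apply]
    rfl
  · simp only [hpow, e.apply_symm_apply]
    rw [← map_sum, hsum]
    intro h
    exact one_ne_zero (congrArg Prod.fst (e.symm.map_eq_zero_iff.1 h))

end JordanLineBound

section JordanBlock

open Module

/-- The unipotent Jordan block of size three over the field with two elements. -/
def jordanBlock : (ZMod 2 × ZMod 2 × ZMod 2) ≃ₗ[ZMod 2] (ZMod 2 × ZMod 2 × ZMod 2) where
  toFun y := (y.1 + y.2.1, y.2.1 + y.2.2, y.2.2)
  map_add' := by decide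
  map_smul' := by decide
  invFun y := (y.1 + y.2.1 + y.2.2, y.2.1 + y.2.2, y.2.2)
  left_inv := by decide
  right_inv := by decide

@[simp] theorem jordanBlock_apply (y : ZMod 2 × ZMod 2 × ZMod 2) :
    jordanBlock y = (y.1 + y.2.1, y.2.1 + y.2.2, y.2.2) := rfl

theorem jordanBlock_sq_apply (y : ZMod 2 × ZMod 2 × ZMod 2) :
    (jordanBlock ^ 2) y = y + (y.2.2 : ZMod 2) • ((1, 0, 0) : ZMod 2 × ZMod 2 × ZMod 2) := by
  rw [sq, LinearEquiv.mul_apply]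
  revert y
  decide

theorem fixes_jordanBlock_point : ∀ (w : ZMod 2 × ZMod 2 × ZMod 2) (a : ZMod 2),
    jordanBlock w = a • w → ∃ b : ZMod 2, w = b • ((1, 0, 0) : ZMod 2 × ZMod 2 × ZMod 2) := by
  decide

theorem fixes_jordanBlock_hyperplane (φ : Dual (ZMod 2) (ZMod 2 × ZMod 2 × ZMod 2)) (a : ZMod 2)
    (h : ∀ y, φ (jordanBlock y) = a * φ y) : ∃ b : ZMod 2, φ = b • sndSnd (ZMod 2) (ZMod 2) := by
  by_cases ha : a = 0
  · refine ⟨0, LinearMap.ext fun y => ?_⟩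
    have := h (jordanBlock.symm y)
    rw [LinearEquiv.apply_symm_apply, ha, zero_mul] at this
    simpa using this
  · simp only [eq_one_of_card_eq_two (Nat.card_zmod 2) ha, one_mul] at h
    have h1 : φ (1, 0, 0) = 0 := by
      have h3 := h (0, 1, 0)
      have h4 : jordanBlock (0, 1, 0) = (1, 0, 0) + (0, 1, 0) := by decide
      rw [h4, map_add, add_eq_right] at h3
      exact h3
    have h2 : φ (0, 1, 0) = 0 := by
      have h3 := h (0, 0, 1)
      have h4 : jordanBlock (0, 0, 1) = (0, 1, 0) + (0, 0, 1) := by decide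
      rw [h4, map_add, add_eq_right] at h3
      exact h3
    refine ⟨φ (0, 0, 1), LinearMap.ext fun y => ?_⟩
    have h6 : y = y.1 • (1, 0, 0) + y.2.1 • (0, 1, 0) + y.2.2 • (0, 0, 1) := by ext <;> simp
    conv_lhs => rw [h6]
    rw [map_add, map_add, map_smul, map_smul, map_smul, h1, h2]
    simp [mul_comm]

theorem jordanBlock_trichotomy
    {K : Subgroup ((ZMod 2 × ZMod 2 × ZMod 2) ≃ₗ[ZMod 2] (ZMod 2 × ZMod 2 × ZMod 2))}
    (hK : jordanBlock ∈ K) (h7 : ¬ 7 ∣ Nat.card K) :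
    (∀ k ∈ K, k (1, 0, 0) = (1, 0, 0)) ∨ (∀ k ∈ K, ∀ y, (k y).2.2 = y.2.2) := by
  set O := MulAction.orbit K ((1, 0, 0) : ZMod 2 × ZMod 2 × ZMod 2) with hO
  have hmem : ∀ k ∈ K, ∀ y, k y ∈ O ↔ y ∈ O := by
    intro k hk y
    change (⟨k, hk⟩ : K) • y ∈ O ↔ _
    rw [hO, ← MulAction.orbit_eq_iff, ← MulAction.orbit_eq_iff, MulAction.orbit_smul]
  have hJ := hmem _ hK
  have h1 : ((1, 0, 0) : ZMod 2 × ZMod 2 × ZMod 2) ∈ O := MulAction.mem_orbit_self _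
  have h11 := hJ (0, 1, 0)
  have h12 := hJ (0, 0, 1)
  have h13 := hJ (0, 1, 1)
  have h14 := hJ (1, 0, 1)
  rw [show jordanBlock (0, 1, 0) = (1, 1, 0) by decide] at h11
  rw [show jordanBlock (0, 0, 1) = (0, 1, 1) by decide] at h12
  rw [show jordanBlock (0, 1, 1) = (1, 0, 1) by decide] at h13
  rw [show jordanBlock (1, 0, 1) = (1, 1, 1) by decide] at h14
  have hlist : ∀ y : ZMod 2 × ZMod 2 × ZMod 2, y ≠ 0 → y = (1, 0, 0) ∨ y = (0, 1, 0) ∨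
      y = (1, 1, 0) ∨ y = (0, 0, 1) ∨ y = (0, 1, 1) ∨ y = (1, 0, 1) ∨ y = (1, 1, 1) := by decide
  have hne : ∀ (k : (ZMod 2 × ZMod 2 × ZMod 2) ≃ₗ[ZMod 2] (ZMod 2 × ZMod 2 × ZMod 2)) y,
      y ≠ 0 → k y ≠ 0 := fun k y hy h => hy (k.map_eq_zero_iff.1 h)
  by_cases h2 : ((0, 1, 0) : ZMod 2 × ZMod 2 × ZMod 2) ∈ O <;>
    by_cases h3 : ((0, 0, 1) : ZMod 2 × ZMod 2 × ZMod 2) ∈ O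
  · exfalso
    have hO' : O = {0}ᶜ := by
      ext y
      refine ⟨?_, fun hy => ?_⟩
      · rintro ⟨k, rfl⟩
        exact hne k.1 _ (by decide)
      · rcases hlist y hy with rfl | rfl | rfl | rfl | rfl | rfl | rfl <;> tauto
    refine h7 ?_
    have h8 := MulAction.index_stabilizer K ((1, 0, 0) : ZMod 2 × ZMod 2 × ZMod 2)
    rw [← hO, hO'] at h8
    have h9 : ({0}ᶜ : Set (ZMod 2 × ZMod 2 × ZMod 2)).ncard = 7 := by
      rw [Set.ncard_compl, Set.ncard_singleton]
      simp
    rw [h9] at h8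
    rw [← h8]
    exact Subgroup.index_dvd_card _
  · right
    have hO' : ∀ y, y ∈ O ↔ y ≠ 0 ∧ y.2.2 = 0 := by
      intro y
      constructor
      · intro hy
        have hy0 : y ≠ 0 := by
          obtain ⟨k, rfl⟩ := hy
          exact hne k.1 _ (by decide)
        rcases hlist y hy0 with rfl | rfl | rfl | rfl | rfl | rfl | rfl <;>
          first | decide | (exfalso; tauto)
      · rintro ⟨hy, hy'⟩
        rcases hlist y hy with rfl | rfl | rfl | rfl | rfl | rfl | rfl <;> tauto
    intro k hk y
    by_cases hy0 : y = 0
    · rw [hy0, map_zero]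
    have h5 := hmem k hk y
    rw [hO', hO'] at h5
    simp only [ne_eq, hne k y hy0, not_false_eq_true, hy0, true_and] at h5
    by_cases hy : y.2.2 = 0
    · rw [hy, h5.2 hy]
    · rw [eq_one_of_card_eq_two (Nat.card_zmod 2) hy,
        eq_one_of_card_eq_two (Nat.card_zmod 2) (fun h => hy (h5.1 h))]
  · left
    have hB : ∀ y, y ≠ 0 → y ∉ O → y = (0, 1, 0) ∨ y = (1, 1, 0) := by
      intro y hy hyO
      rcases hlist y hy with rfl | rfl | rfl | rfl | rfl | rfl | rfl <;> tauto
    intro k hk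
    have h5 := hB (k (0, 1, 0)) (hne k _ (by decide)) (by rwa [hmem k hk])
    have h6 := hB (k (1, 1, 0)) (hne k _ (by decide)) (by rwa [hmem k hk, h11])
    have h8 : k (1, 0, 0) = k (1, 1, 0) - k (0, 1, 0) := by
      rw [← map_sub]
      congr 1
    have h9 := hne k (1, 0, 0) (by decide)
    rw [h8] at h9 ⊢
    rcases h5 with h5 | h5 <;> rcases h6 with h6 | h6 <;> rw [h5, h6] at h9 ⊢ <;>
      first | decide | simp at h9
  · left
    intro k hk
    have h5 : k (1, 0, 0) ∈ O := (hmem k hk _).2 h1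
    rcases hlist _ (hne k (1, 0, 0) (by decide)) with h | h | h | h | h | h | h <;>
      rw [h] at h5 ⊢ <;> exfalso <;> tauto

end JordanBlock

section LinearGroupThree

open Module Polynomial

theorem pow_seven_eq_one_of_no_fixed {E : Type*} [AddCommGroup E] [Module (ZMod 2) E]
    [FiniteDimensional (ZMod 2) E] (hn : finrank (ZMod 2) E = 3) {g : E ≃ₗ[ZMod 2] E}
    (hg : ∀ v, g v = v → v = 0) : g ^ 7 = 1 := by
  set p := LinearMap.charpoly (g : E →ₗ[ZMod 2] E) with hp
  have hroot : ∀ a : ZMod 2, p.eval a ≠ 0 := by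
    intro a ha
    have h1 := (Module.End.hasEigenvalue_iff_isRoot_charpoly (g : E →ₗ[ZMod 2] E) a).2 ha
    obtain ⟨v, hv⟩ := h1.exists_hasEigenvector
    have h2 : g v = a • v := hv.apply_eq_smul
    by_cases ha0 : a = 0
    · rw [ha0, zero_smul] at h2
      exact hv.2 (g.map_eq_zero_iff.1 h2)
    · rw [eq_one_of_card_eq_two (Nat.card_zmod 2) ha0, one_smul] at h2
      exact hv.2 (hg v h2)
  have hform : p = X ^ 3 + (C (p.coeff 0) + C (p.coeff 1) * X + C (p.coeff 2) * X ^ 2) := by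
    have h1 := (LinearMap.charpoly_monic (g : E →ₗ[ZMod 2] E)).as_sum
    rw [LinearMap.charpoly_natDegree, hn, ← hp] at h1
    simpa [Finset.sum_range_succ] using h1
  have h2 : (2 : (ZMod 2)[X]) = 0 := by
    have : (C (2 : ZMod 2) : (ZMod 2)[X]) = 0 := by
      rw [show (2 : ZMod 2) = 0 from rfl, C_0]
    exact this
  have hdvd : p ∣ X ^ 7 - 1 := by
    have h0 := hroot 0
    have h1 := hroot 1
    rw [hform] at h0 h1 ⊢
    simp only [eval_add, eval_pow, eval_X, eval_C, eval_mul] at h0 h1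
    generalize p.coeff 0 = a at *
    generalize p.coeff 1 = b at *
    generalize p.coeff 2 = c at *
    have hc : a = 1 ∧ (b = 1 ∧ c = 0 ∨ b = 0 ∧ c = 1) := by
      clear hform
      revert a b c
      decide
    rcases hc with ⟨rfl, ⟨rfl, rfl⟩ | ⟨rfl, rfl⟩⟩
    · refine ⟨(X + 1) * (X ^ 3 + X ^ 2 + 1), ?_⟩
      simp only [C_0, C_1]
      linear_combination (-(1 + X + X ^ 2 + 2 * X ^ 3 + 2 * X ^ 4 + X ^ 5 + X ^ 6)) * h2
    · refine ⟨(X + 1) * (X ^ 3 + X + 1), ?_⟩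
      simp only [C_0, C_1]
      linear_combination (-(1 + X + X ^ 2 + 2 * X ^ 3 + 2 * X ^ 4 + X ^ 5 + X ^ 6)) * h2
  obtain ⟨r, hr⟩ := hdvd
  have h3 : aeval (g : E →ₗ[ZMod 2] E) (X ^ 7 - 1 : (ZMod 2)[X]) = 0 := by
    rw [hr, map_mul, hp, LinearMap.aeval_self_charpoly, zero_mul]
  rw [map_sub, map_pow, aeval_X, map_one, sub_eq_zero] at h3
  refine LinearEquiv.ext fun y => ?_
  have h4 := LinearMap.congr_fun h3 y
  have h5 : ∀ k : ℕ, (((g : E →ₗ[ZMod 2] E) ^ k : E →ₗ[ZMod 2] E)) y = (g ^ k) y := by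
    intro k
    induction k with
    | zero => rfl
    | succ k ih =>
      rw [pow_succ', pow_succ', LinearEquiv.mul_apply, ← ih]
      rfl
  rw [h5] at h4
  exact h4

theorem card_linearEquiv_three {E : Type*} [AddCommGroup E] [Module (ZMod 2) E] [Finite E]
    (hn : finrank (ZMod 2) E = 3) : Nat.card (E ≃ₗ[ZMod 2] E) = 168 := by
  rw [card_linearEquiv, hn, Nat.card_zmod]
  rfl

theorem card_sylow_seven_le {G : Type*} [Group G] (hG : Nat.card G = 168) :
    Nat.card (Sylow 7 G) ≤ 8 := by
  have : Finite G := Nat.finite_of_card_ne_zero (by omega)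
  have : Fact (Nat.Prime 7) := ⟨by norm_num⟩
  let P : Sylow 7 G := default
  have h1 := card_sylow_modEq_one 7 G
  have h2 := P.card_dvd_index
  have h3 : ¬ 7 ∣ P.index := P.not_dvd_index
  have h4 : P.index ∣ 24 := by
    have h5 : P.index ∣ 24 * 7 := by
      have := Subgroup.index_dvd_card (P : Subgroup G)
      rwa [hG] at this
    exact Nat.Coprime.dvd_of_dvd_mul_right
      ((Nat.Prime.coprime_iff_not_dvd (by norm_num)).2 h3).symm h5
  have h6 := h2.trans h4
  have h7 := Nat.le_of_dvd (by norm_num) h6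
  generalize Nat.card (Sylow 7 G) = n at *
  unfold Nat.ModEq at h1
  interval_cases n <;> omega

/-- A cover of the general linear group by the point stabilizers and the Sylow 7-subgroups. -/
theorem exists_cover_linearEquiv_three {E : Type*} [AddCommGroup E] [Module (ZMod 2) E] [Finite E]
    (hn : finrank (ZMod 2) E = 3) :
    ∃ S : Finset (Subgroup (E ≃ₗ[ZMod 2] E)), IsSubgroupCover S ∧ S.card ≤ 15 := by
  classical
  have : Fact (Nat.Prime 7) := ⟨by norm_num⟩
  have : Finite (E ≃ₗ[ZMod 2] E) := DFunLike.finite _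
  have hG := card_linearEquiv_three hn
  have := Fintype.ofFinite {v : E // v ≠ 0}
  have := Fintype.ofFinite (Sylow 7 (E ≃ₗ[ZMod 2] E))
  have hE : Nat.card E = 8 := by
    rw [natCard_eq_pow_finrank (K := ZMod 2) (V := E), hn, Nat.card_zmod]
    rfl
  refine ⟨(Finset.univ : Finset {v : E // v ≠ 0}).image
    (fun v => MulAction.stabilizer (E ≃ₗ[ZMod 2] E) v.1) ∪
    (Finset.univ : Finset (Sylow 7 (E ≃ₗ[ZMod 2] E))).image
      (fun P : Sylow 7 (E ≃ₗ[ZMod 2] E) => (P : Subgroup (E ≃ₗ[ZMod 2] E))),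
    ⟨fun H hH => ?_, fun g => ?_⟩, ?_⟩
  · rintro rfl
    simp only [Finset.mem_union, Finset.mem_image, Finset.mem_univ, true_and, Subtype.exists] at hH
    rcases hH with ⟨v, hv, h⟩ | ⟨P, h⟩
    · have hex : ∃ w : E, w ≠ 0 ∧ w ≠ v := by
        by_contra hcon
        push Not at hcon
        have h1 : Nat.card {w : E // w ≠ 0} ≤ 1 :=
          Finite.card_le_one_iff_subsingleton.2
            ⟨fun a b => Subtype.ext ((hcon a.1 a.2).trans (hcon b.1 b.2).symm)⟩
        rw [card_ne_zero, hE] at h1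
        omega
      obtain ⟨w, hw, hwv⟩ := hex
      obtain ⟨g, hg⟩ := exists_linearEquiv_apply_eq (F := ZMod 2) hv hw
      have h1 : g ∈ MulAction.stabilizer (E ≃ₗ[ZMod 2] E) v := h ▸ Subgroup.mem_top g
      exact hwv (hg.symm.trans h1)
    · obtain ⟨k, hk⟩ := (IsPGroup.iff_card).1 P.isPGroup'
      rw [h, Subgroup.card_top, hG] at hk
      have h2 : 2 ∣ 7 ^ k := by rw [← hk]; norm_num
      have := (Nat.Prime.dvd_of_dvd_pow Nat.prime_two h2)
      omega
  · simp only [Finset.mem_union, Finset.mem_image, Finset.mem_univ, true_and, Subtype.exists]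
    by_cases hg : ∃ v, v ≠ 0 ∧ g v = v
    · obtain ⟨v, hv, hgv⟩ := hg
      exact ⟨_, Or.inl ⟨v, hv, rfl⟩, hgv⟩
    · push Not at hg
      have h7 : g ^ 7 = 1 := pow_seven_eq_one_of_no_fixed hn fun v hv => by
        by_contra h0
        exact hg v h0 hv
      have hp : IsPGroup 7 (Subgroup.zpowers g) := by
        rintro ⟨_, j, rfl⟩
        refine ⟨1, Subtype.ext ?_⟩
        change (g ^ j) ^ (7 ^ 1) = 1
        rw [pow_one, ← zpow_natCast, ← zpow_mul, mul_comm, zpow_mul]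
        simp only [Nat.cast_ofNat]
        rw [show (7 : ℤ) = ((7 : ℕ) : ℤ) from rfl, zpow_natCast, h7, one_zpow]
      obtain ⟨P, hP⟩ := hp.exists_le_sylow
      exact ⟨_, Or.inr ⟨P, rfl⟩, hP (Subgroup.mem_zpowers g)⟩
  · refine (Finset.card_union_le _ _).trans ?_
    have h1 := Finset.card_image_le (s := (Finset.univ : Finset {v : E // v ≠ 0}))
      (f := fun v => MulAction.stabilizer (E ≃ₗ[ZMod 2] E) v.1)
    have h2 := Finset.card_image_le (s := (Finset.univ : Finset (Sylow 7 (E ≃ₗ[ZMod 2] E))))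
      (f := fun P : Sylow 7 (E ≃ₗ[ZMod 2] E) => (P : Subgroup (E ≃ₗ[ZMod 2] E)))
    rw [Finset.card_univ, ← Nat.card_eq_fintype_card] at h1 h2
    rw [card_ne_zero, hE] at h1
    have h3 := card_sylow_seven_le hG
    omega

theorem not_seven_dvd_card_of_no_conj {G : Type*} [Group G] (hG : Nat.card G = 168)
    {K : Subgroup G} {x : G} (hx : x ^ 7 = 1) (hK : ¬ ∃ g, g⁻¹ * x * g ∈ K) :
    ¬ 7 ∣ Nat.card K := by
  have : Finite G := Nat.finite_of_card_ne_zero (by omega)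
  intro h7
  have h1 := card_fixedBy_modEq_index K (r := 7) (by norm_num) hx
  have h2 := K.index_mul_card
  have h3 : Nat.card (MulAction.fixedBy (G ⧸ K) x) = 0 := by
    have h4 := conjCount_eq_card_fixedBy_mul K x
    rw [conjCount_eq_zero hK] at h4
    exact (Nat.mul_eq_zero.1 h4.symm).resolve_right Nat.card_pos.ne'
  rw [h3] at h1
  obtain ⟨c, hc⟩ := h7
  obtain ⟨d, hd⟩ := (Nat.modEq_zero_iff_dvd).1 h1
  rw [hc, hd, hG] at h2
  have : 49 * (d * c) = 168 := by rw [← h2]; ring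
  omega

theorem seven_mul_conjCount_jordanBlock_le {K : Subgroup ((ZMod 2 × ZMod 2 × ZMod 2) ≃ₗ[ZMod 2]
    (ZMod 2 × ZMod 2 × ZMod 2))} (h7 : ¬ 7 ∣ Nat.card K) :
    7 * conjCount K jordanBlock ≤
      Nat.card ((ZMod 2 × ZMod 2 × ZMod 2) ≃ₗ[ZMod 2] (ZMod 2 × ZMod 2 × ZMod 2)) := by
  have hcard : Nat.card (ZMod 2 × ZMod 2 × ZMod 2) = 8 := by simp
  by_cases hh : ∃ g, g⁻¹ * jordanBlock * g ∈ K
  swap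
  · rw [conjCount_eq_zero hh]
    omega
  obtain ⟨g, hg⟩ := hh
  rw [← conjCount_map_conj K _ g]
  have hcardK : Nat.card (K.map (MulAut.conj g).toMonoidHom) = Nat.card K :=
    Nat.card_congr (K.equivMapOfInjective _ (MulAut.conj g).injective).symm.toEquiv
  rw [← hcardK] at h7
  rcases jordanBlock_trichotomy (K := K.map (MulAut.conj g).toMonoidHom)
    ⟨_, hg, by simp [mul_assoc]⟩ h7 with h | h
  · have h3 := card_mul_conjCount_le_of_fixes_point (K := K.map (MulAut.conj g).toMonoidHom)
      (v := (1, 0, 0)) (by decide) fixes_jordanBlock_point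
      fun k hk => ⟨1, by rw [one_smul, h k hk]⟩
    rw [hcard, Nat.card_zmod] at h3
    omega
  · have h3 := card_mul_conjCount_le_of_fixes_hyperplane (K := K.map (MulAut.conj g).toMonoidHom)
      (f := sndSnd (ZMod 2) (ZMod 2)) ?_ fixes_jordanBlock_hyperplane
      fun k hk => ⟨1, fun y => by rw [one_mul]; exact h k hk y⟩
    · rw [hcard, Nat.card_zmod] at h3
      omega
    · intro h0
      simpa using LinearMap.congr_fun h0 (0, 0, 1)

/-- The covering number of the general linear group of degree three over the field with two
elements. -/
theorem coveringNumber_linearEquiv_three {E : Type*} [Field E] [Algebra (ZMod 2) E] [Finite E]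
    (hn : finrank (ZMod 2) E = 3) : coveringNumber (E ≃ₗ[ZMod 2] E) = (15 : ℕ) := by
  have : Finite (E ≃ₗ[ZMod 2] E) := DFunLike.finite _
  obtain ⟨S, hS, hScard⟩ := exists_cover_linearEquiv_three hn
  have hG := card_linearEquiv_three hn
  have hE : Nat.card E = 8 := by
    rw [natCard_eq_pow_finrank (K := ZMod 2) (V := E), hn, Nat.card_zmod]
    rfl
  obtain ⟨u, hu⟩ := IsCyclic.exists_generator (α := Eˣ)
  have hx7 : unitMul (ZMod 2) E u ^ 7 = 1 := by
    have h1 := orderOf_eq_of_generator (F := ZMod 2) hu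
    rw [hn, Nat.card_zmod] at h1
    have h2 := pow_orderOf_eq_one u
    rw [h1] at h2
    rw [← map_pow, ← map_one (unitMul (ZMod 2) E)]
    exact congrArg _ h2
  let e : E ≃ₗ[ZMod 2] ZMod 2 × ZMod 2 × ZMod 2 := LinearEquiv.ofFinrankEq _ _ (by
    rw [hn, finrank_prod_prod, finrank_self])
  have hcardG : Nat.card ((ZMod 2 × ZMod 2 × ZMod 2) ≃ₗ[ZMod 2] (ZMod 2 × ZMod 2 × ZMod 2)) =
      Nat.card (E ≃ₗ[ZMod 2] E) := Nat.card_congr (linearAutCongr e).symm.toEquiv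
  refine coveringNumber_eq (fun T hT => ?_) hS hScard
  refine le_card_of_isSubgroupCover_of_weights (a := 8) (b := 7) (x := unitMul (ZMod 2) E u)
    (h := (linearAutCongr e).symm jordanBlock) hT fun K hK => ?_
  rw [← hE]
  refine weights_of_transvection_pow (by omega) hu (j := 2) (c := e.symm (1, 0, 0))
    (f := sndSnd (ZMod 2) (ZMod 2) ∘ₗ (e : E →ₗ[ZMod 2] ZMod 2 × ZMod 2 × ZMod 2)) ?_ ?_ ?_
    (fun y => ?_) (fun K hK hx => ?_) hK
  · intro h
    exact one_ne_zero (congrArg Prod.fst (e.symm.map_eq_zero_iff.1 h))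
  · intro h
    simpa using LinearMap.congr_fun h (e.symm (0, 0, 1))
  · simp
  · rw [← map_pow, linearAutCongr_symm_apply, jordanBlock_sq_apply, map_add, map_smul,
      e.symm_apply_apply]
    rfl
  · have h7 := not_seven_dvd_card_of_no_conj hG hx7 hx
    have hcardK : Nat.card (K.map (linearAutCongr e).toMonoidHom) = Nat.card K :=
      Nat.card_congr (K.equivMapOfInjective _ (linearAutCongr e).injective).symm.toEquiv
    rw [← hcardK] at h7
    have h3 := seven_mul_conjCount_jordanBlock_le h7
    have h4 := conjCount_map (linearAutCongr e) K ((linearAutCongr e).symm jordanBlock)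
    rw [MulEquiv.apply_symm_apply] at h4
    rwa [h4, hcardG] at h3

end LinearGroupThree

section DimensionOne

theorem coveringNumber_klein :
    coveringNumber (Multiplicative (ZMod 2 × ZMod 2)) = (3 : ℕ) := by
  classical
  have hgen : ∀ a b g : Multiplicative (ZMod 2 × ZMod 2), a ≠ 1 → b ≠ 1 → a ≠ b →
      g = 1 ∨ g = a ∨ g = b ∨ g = a * b := by decide
  have hsq : ∀ g : Multiplicative (ZMod 2 × ZMod 2), g ^ 2 = 1 := by decide
  have hcard : (Finset.univ.erase (1 : Multiplicative (ZMod 2 × ZMod 2))).card = 3 := by decide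
  refine coveringNumber_eq (fun T hT => ?_)
    (S := (Finset.univ.erase 1).image fun g => Subgroup.zpowers g) ⟨?_, fun g => ?_⟩
    (Finset.card_image_le.trans hcard.le)
  · choose f hfT hf using hT.2
    rw [← hcard]
    refine Finset.card_le_card_of_injOn f (fun g _ => hfT g) fun a ha b hb hab => ?_
    by_contra hne
    refine hT.1 (f a) (hfT a) (eq_top_iff.2 fun g _ => ?_)
    have hb' : b ∈ f a := hab ▸ hf b
    rcases hgen a b g (by simpa using ha) (by simpa using hb) hne with rfl | rfl | rfl | rfl
    · exact one_mem _
    · exact hf _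
    · exact hb'
    · exact mul_mem (hf a) hb'
  · simp only [Finset.mem_image]
    rintro _ ⟨g, -, rfl⟩ htop
    have h1 := orderOf_le_of_pow_eq_one two_pos (hsq g)
    rw [← Nat.card_zpowers, htop, Subgroup.card_top] at h1
    simp [Nat.card_eq_fintype_card] at h1
  · simp only [Finset.mem_image, exists_exists_and_eq_and]
    by_cases hg : g = 1
    · exact ⟨Multiplicative.ofAdd (1, 0), by decide, hg ▸ one_mem _⟩
    · exact ⟨g, by simpa using hg, Subgroup.mem_zpowers g⟩

variable {F : Type*} [Field F]

theorem linearEquiv_self_apply (g : F ≃ₗ[F] F) (v : F) : g v = g 1 * v := by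
  conv_lhs => rw [← mul_one v, ← smul_eq_mul, map_smul, smul_eq_mul]
  exact mul_comm _ _

theorem isCyclic_linearEquiv_self [Finite F] : IsCyclic (F ≃ₗ[F] F) := by
  have : Finite (F ≃ₗ[F] F) := DFunLike.finite _
  let f : (F ≃ₗ[F] F) →* F :=
    { toFun := fun g => g 1
      map_one' := rfl
      map_mul' := fun g h => linearEquiv_self_apply g (h 1) }
  refine isCyclic_of_injective_ringHom f fun g h hgh => ?_
  ext v
  rw [linearEquiv_self_apply g, linearEquiv_self_apply h]
  exact congrArg (· * v) hgh

theorem coveringNumber_affineEquiv_self [Finite F] (hF : 3 ≤ Nat.card F) :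
    coveringNumber (F ≃ᵃ[F] F) = ((Nat.card F + 1 : ℕ) : ℕ∞) := by
  classical
  have := Fintype.ofFinite F
  have : Finite (F ≃ₗ[F] F) := DFunLike.finite _
  have : Finite (F ≃ᵃ[F] F) := DFunLike.finite _
  obtain ⟨x, hx⟩ := (isCyclic_linearEquiv_self (F := F)).exists_generator
  let A : F → Subgroup (F ≃ᵃ[F] F) := fun v => affineStabilizer F v
  refine coveringNumber_eq (fun T hT => ?_)
    (S := insert AffineEquiv.linearHom.ker (Finset.univ.image A)) ⟨?_, fun g => ?_⟩ ?_
  · refine le_card_of_isSubgroupCover_of_hom hT _ affineEquiv_linearHom_surjective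
      eq_one_of_map_linearHom_eq_top (Nat.card_congr kerLinearHomEquiv) (x := x) (h := 1)
      (fun K hK => ?_) (AffineEquiv.constVAdd F F 1) rfl 1 rfl fun h => ?_
    · rw [conjCount_eq_zero, mul_zero, zero_add, one_mul]
      · exact conjCount_le K 1
      · rintro ⟨g, hg⟩
        refine hK (eq_top_iff.2 fun y _ => ?_)
        have hcomm : g⁻¹ * x * g = x := by
          obtain ⟨n, rfl⟩ := hx g
          group
        rw [hcomm] at hg
        exact Subgroup.zpowers_le.2 hg (hx y)
    · have h1 : (1 : F) + 0 = 0 := congrArg (fun e : F ≃ᵃ[F] F => e 0) h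
      simp at h1
  · intro M hM htop
    simp only [Finset.mem_insert, Finset.mem_image, Finset.mem_univ, true_and] at hM
    rcases hM with rfl | ⟨v, rfl⟩
    · have hunits : 1 < Nat.card Fˣ := by
        rw [Nat.card_units]
        omega
      have := Finite.one_lt_card_iff_nontrivial.1 hunits
      obtain ⟨u, hu⟩ := exists_ne (1 : Fˣ)
      have h1 : (LinearEquiv.smulOfUnit u : F ≃ₗ[F] F).toAffineEquiv ∈
          (AffineEquiv.linearHom : (F ≃ᵃ[F] F) →* F ≃ₗ[F] F).ker := htop ▸ Subgroup.mem_top _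
      have h2 : u • (1 : F) = 1 := LinearEquiv.congr_fun (MonoidHom.mem_ker.1 h1) 1
      exact hu (Units.ext (by simpa [Units.smul_def] using h2))
    · have h1 : AffineEquiv.constVAdd F F 1 ∈ A v := htop ▸ Subgroup.mem_top _
      have h2 : 1 + v = v := h1
      simp at h2
  · by_cases hg : g.linear 1 = 1
    · refine ⟨_, Finset.mem_insert_self _ _, MonoidHom.mem_ker.2 ?_⟩
      ext v
      change g.linear v = v
      rw [linearEquiv_self_apply, hg, one_mul]
    · refine ⟨A (g 0 / (1 - g.linear 1)), by simp, ?_⟩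
      have h1 : 1 - g.linear 1 ≠ 0 := sub_ne_zero.2 (Ne.symm hg)
      change g _ = _
      rw [affineEquiv_apply_eq, linearEquiv_self_apply]
      field_simp
      ring
  · refine (Finset.card_insert_le _ _).trans (Nat.succ_le_succ ?_)
    exact Finset.card_image_le.trans (by simp [Nat.card_eq_fintype_card])

end DimensionOne

section Main

open Module

theorem geom_quotient_succ {q : ℕ} (hq : 2 ≤ q) (n : ℕ) :
    (q ^ (n + 1) - 1) / (q - 1) = q ^ n + (q ^ n - 1) / (q - 1) := by
  obtain ⟨r, rfl⟩ : ∃ r, q = r + 2 := ⟨q - 2, by omega⟩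
  have h1 : 0 < (r + 2) ^ n := by positivity
  have h2 : (r + 2) ^ (n + 1) - 1 = ((r + 2) ^ n - 1) + (r + 2) ^ n * (r + 1) := by
    have : (r + 2) ^ (n + 1) = (r + 2) ^ n + (r + 2) ^ n * (r + 1) := by ring
    omega
  rw [h2, show r + 2 - 1 = r + 1 from rfl, Nat.add_mul_div_right _ _ (by omega), add_comm]

theorem exists_coveringNumber_eq_of_four_le {q m : ℕ} {F : Type} [Field F] [Finite F] (p : ℕ)
    [Fact p.Prime] [CharP F p] (hF : Nat.card F = q) (hm : 4 ≤ m) (h : m = 4 → 3 ≤ q) :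
    ∃ (G : Type) (_ : Group G) (_ : Finite G),
      coveringNumber G = (((q ^ m - 1) / (q - 1) : ℕ) : ℕ∞) := by
  obtain ⟨n, rfl⟩ : ∃ n, m = n + 4 := ⟨m - 4, by omega⟩
  let E := FiniteField.Extension F p (n + 3)
  have hE : finrank F E = n + 3 := FiniteField.finrank_extension F p (n + 3)
  have hcE : Nat.card E = q ^ (n + 3) := by
    rw [← hF]
    exact FiniteField.natCard_extension F p (n + 3)
  have hq : 2 ≤ q := hF ▸ Finite.one_lt_card
  refine ⟨E ≃ᵃ[F] E, inferInstance, DFunLike.finite _, ?_⟩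
  rw [geom_quotient_succ hq (n + 3), ← hcE, ← hF]
  by_cases h52 : n = 1 ∧ q = 2
  · obtain ⟨rfl, rfl⟩ := h52
    have hS := FiniteField.finrank_extension F p 2
    refine coveringNumber_affineEquiv_of_jordanLine (LinearEquiv.ofFinrankEq _ _ ?_) hF hS
    rw [hE, finrank_prod_prod, hS]
  · have hS := FiniteField.finrank_extension F p (n + 2)
    refine coveringNumber_affineEquiv_of_lineMul (S := FiniteField.Extension F p (n + 2))
      (LinearEquiv.ofFinrankEq _ _ ?_) (by omega) (by omega) (by omega)
    rw [hE, finrank_field_prod, hS]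

end Main

theorem statement6 (p d m : ℕ) (hp : p.Prime) (hd : 0 < d) (hm : 2 ≤ m) (hm3 : m ≠ 3) :
    ∃ (G : Type) (_ : Group G) (_ : Finite G),
      coveringNumber G = ((((p ^ d) ^ m - 1) / (p ^ d - 1) : ℕ) : ℕ∞) := by
  have : Fact p.Prime := ⟨hp⟩
  have hF : Nat.card (GaloisField p d) = p ^ d := GaloisField.card p d hd.ne'
  have hq : 2 ≤ p ^ d := hF ▸ Finite.one_lt_card
  generalize p ^ d = q at hF hq ⊢
  obtain rfl | hm4 : m = 2 ∨ 4 ≤ m := by omega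
  · rw [geom_quotient_succ hq 1, pow_one, Nat.div_self (by omega)]
    obtain rfl | hq3 : q = 2 ∨ 3 ≤ q := by omega
    · exact ⟨_, inferInstance, inferInstance, coveringNumber_klein⟩
    · exact ⟨_, inferInstance, DFunLike.finite _,
        hF ▸ coveringNumber_affineEquiv_self (F := GaloisField p d) (hF ▸ hq3)⟩
  · by_cases h42 : m = 4 ∧ q = 2
    · obtain ⟨rfl, rfl⟩ := h42
      exact ⟨_, inferInstance, DFunLike.finite _, coveringNumber_linearEquiv_three
        (E := GaloisField 2 3) (GaloisField.finrank 2 (by norm_num))⟩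
    · exact exists_coveringNumber_eq_of_four_le p hF hm4 (by omega)
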